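/- Let S be a finite set of prime numbers. Call a quadruple (x, y, z, n) a primitive solution if n ≥ 2 is an integer, z is a nonzero integer, x and y are S-units, gcd(x, y) is nth-power free, and x + y = z^n. Then there are only finitely many primitive solutions (x, y, z, n) if and only if 2 ∉ S. -/

import Mathlib

/-- An `S`-unit: a nonzero integer all of whose prime divisors belong to `S`. -/
def IsSUnit (S : Finset ℕ) (x : ℤ) : Prop :=
  x ≠ 0 ∧ ∀ p : ℕ, p.Prime → (p : ℤ) ∣ x → p ∈ S

/-- A natural number is `n`th-power free if no `n`th power of a prime divides it. -/
def NthPowerFree (n d : ℕ) : Prop :=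
  ∀ p : ℕ, p.Prime → ¬ p ^ n ∣ d

section Part1
open Polynomial

/-- naive height -/
def HtLE {K : Type*} [Field K] (a : K) (h : ℝ) : Prop :=
  ∃ D : ℕ, 0 < D ∧ (D : ℝ) ≤ Real.exp h ∧ IsIntegral ℤ ((D : K) * a) ∧
    ∀ σ : K →+* ℂ, ‖σ ((D : K) * a)‖ ≤ Real.exp h

lemma padic_norm_le_one_of_integral {p : ℕ} [Fact p.Prime] (x : ℚ_[p]) (hx : IsIntegral ℤ x) :
    ‖x‖ ≤ 1 := by
  have h1 : IsIntegral ℤ_[p] x := hx.tower_top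
  obtain ⟨y, hy⟩ := (IsIntegrallyClosed.isIntegral_iff (R := ℤ_[p]) (K := ℚ_[p])).1 h1
  rw [← hy]
  exact y.2

lemma liouville {K : Type*} [Field K] [NumberField K] {p : ℕ} [hp : Fact p.Prime] (φ : K →+* ℚ_[p])
    (V : K) (hV : IsIntegral ℤ V) (B : ℝ) (hB1 : 1 ≤ B) (hB : ∀ σ : K →+* ℂ, ‖σ V‖ ≤ B) (A : ℕ)
    (hA : ‖φ V‖ ≤ (p : ℝ) ^ (-(A : ℤ)))
    (hlt : (2 * B) ^ (Module.finrank ℚ K) < (p : ℝ) ^ A) : V = 0 := by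
  by_contra hne
  have hc := NumberField.Embeddings.coeff_bdd_of_norm_le (A := ℂ) (K := K) (x := V) hB 0
  set c : ℤ := (minpoly ℤ V).coeff 0 with hcdef
  have hmin : minpoly ℚ V = (minpoly ℤ V).map (algebraMap ℤ ℚ) :=
    minpoly.isIntegrallyClosed_eq_field_fractions' ℚ hV
  have hc0 : c ≠ 0 := by
    intro h0
    have h5 : (minpoly ℚ V).coeff 0 = 0 := by rw [hmin, coeff_map, ← hcdef, h0]; simp
    exact minpoly.coeff_zero_ne_zero (hV.tower_top (A := ℚ)) hne h5
  have hcb : (|c| : ℝ) < (p : ℝ) ^ A := by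
    refine lt_of_le_of_lt ?_ hlt
    rw [hmin, coeff_map] at hc
    have : ‖(algebraMap ℤ ℚ) c‖ = (|c| : ℝ) := by
      simp [Int.norm_eq_abs]
    rw [← hcdef, this, max_eq_left hB1] at hc
    refine hc.trans ?_
    rw [mul_comm, mul_pow]
    gcongr
    exact_mod_cast Nat.choose_le_two_pow _ _
  have hdvd : ∃ W : K, IsIntegral ℤ W ∧ (c : K) = V * W := by
    have h1 : aeval V (minpoly ℤ V) = 0 := minpoly.aeval ℤ V
    rw [← divX_mul_X_add (minpoly ℤ V)] at h1
    simp only [map_add, map_mul, aeval_X, aeval_C] at h1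
    refine ⟨-(aeval V (minpoly ℤ V).divX), ?_, ?_⟩
    · apply IsIntegral.neg
      rw [aeval_eq_sum_range]
      exact IsIntegral.sum _ fun i _ => IsIntegral.smul _ (hV.pow i)
    · rw [hcdef]
      have : (algebraMap ℤ K) ((minpoly ℤ V).coeff 0) = (((minpoly ℤ V).coeff 0 : ℤ) : K) := by simp
      rw [this] at h1
      linear_combination h1
  obtain ⟨W, hW, hcW⟩ := hdvd
  have h2 : ‖(c : ℚ_[p])‖ ≤ (p : ℝ) ^ (-(A : ℤ)) := by
    have : (c : ℚ_[p]) = φ V * φ W := by rw [← map_mul, ← hcW, map_intCast]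
    rw [this, norm_mul]
    have hw : ‖φ W‖ ≤ 1 := padic_norm_le_one_of_integral _ (hW.map (φ.toIntAlgHom))
    calc _ ≤ ‖φ V‖ * 1 := by gcongr
      _ ≤ _ := by simpa using hA
  rw [Padic.norm_int_le_pow_iff_dvd] at h2
  have h3 := Int.le_of_dvd (abs_pos.2 hc0) ((dvd_abs _ _).2 h2)
  have : ((p : ℝ) ^ A) ≤ |(c : ℝ)| := by exact_mod_cast h3
  linarith
end Part1

section Part2
open Finset

/-- the shift operator on sequences -/
def shiftE (R : Type*) [CommRing R] : Module.End R (ℕ → R) where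
  toFun f := fun e => f (e + 1)
  map_add' _ _ := rfl
  map_smul' _ _ := rfl

lemma newton_zero {R : Type*} [CommRing R] (m : ℕ) : ∀ f : ℕ → R,
    ((shiftE R - 1) ^ m) f = 0 → (∀ e < m, f e = 0) → f = 0 := by
  induction m with
  | zero => intro f h _; simpa using h
  | succ m ih =>
    intro f h h0
    have h1 : (shiftE R - 1) f = 0 := by
      apply ih
      · rw [pow_succ] at h; exact h
      · intro e he
        change f (e + 1) - f e = 0
        rw [h0 _ (by omega), h0 _ (by omega), sub_zero]
    funext e
    induction e with
    | zero => exact h0 0 (by omega)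
    | succ e ihe =>
      have h2 := congrFun h1 e
      have h3 : f (e + 1) - f e = 0 := h2
      rw [ihe] at h3
      simpa using h3

lemma newton_kill {R : Type*} [CommRing R] (h : R) (s : ℕ) :
    ((shiftE R - h • (1 : Module.End R (ℕ → R))) ^ (s + 1))
      (fun e => (e.choose s : R) * h ^ e) = 0 := by
  induction s with
  | zero =>
    funext e
    simp [shiftE, pow_succ, mul_comm]
  | succ s ih =>
    rw [pow_succ]
    have : (shiftE R - h • (1 : Module.End R (ℕ → R)))
        (fun e => (e.choose (s + 1) : R) * h ^ e) = h • (fun e => (e.choose s : R) * h ^ e) := by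
      funext e
      simp [shiftE, Nat.choose_succ_succ]
      ring
    rw [Module.End.mul_apply, this, map_smul, ih, smul_zero]

lemma newton_term {R : Type*} [CommRing R] (h : R) (μ S s : ℕ) (hs : s < S)
    (hh : (h - 1) ^ μ = 0) :
    ((shiftE R - 1) ^ (μ + S)) (fun e => (e.choose s : R) * h ^ e) = 0 := by
  set F : ℕ → R := fun e => (e.choose s : R) * h ^ e with hF
  set a := (shiftE R - h • (1 : Module.End R (ℕ → R))) with ha
  set b := (h - 1) • (1 : Module.End R (ℕ → R)) with hb
  have hab : shiftE R - 1 = a + b := by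
    apply LinearMap.ext; intro f; funext e; simp [ha, hb]; ring
  have hc : Commute a b := by
    rw [hb]; exact (Commute.one_right a).smul_right _
  rw [hab, hc.add_pow, LinearMap.sum_apply]
  apply Finset.sum_eq_zero
  intro k hk
  have hk' : k ≤ μ + S := by simpa [Nat.lt_succ_iff] using hk
  have hbp : ∀ m, b ^ m = (h - 1) ^ m • (1 : Module.End R (ℕ → R)) := by
    intro m; rw [hb, smul_pow, one_pow]
  by_cases hkS : S ≤ k
  · have h1 : (a ^ k) F = 0 := by
      have : k = (k - (s + 1)) + (s + 1) := by omega
      rw [this, pow_add, Module.End.mul_apply, newton_kill, map_zero]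
    have : a ^ k * b ^ (μ + S - k) * (((μ + S).choose k : ℕ) : Module.End R (ℕ → R))
       = b ^ (μ + S - k) * (((μ + S).choose k : ℕ) : Module.End R (ℕ → R)) * a ^ k := by
      rw [(hc.pow_pow _ _).eq, mul_assoc, mul_assoc, (Nat.cast_commute _ _).eq]
    rw [this, Module.End.mul_apply, h1, map_zero]
  · have : b ^ (μ + S - k) = 0 := by
      rw [hbp, show μ + S - k = μ + (S - k) by omega, pow_add, hh, zero_mul, zero_smul]
    rw [this]; simp

lemma newton {R : Type*} [CommRing R] (g : R) (μ I S : ℕ) (hg : (g - 1) ^ μ = 0)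
    (q : ℕ → ℕ → R) 
    (h0 : ∀ e < μ + S, ∑ i ∈ range I, ∑ s ∈ range S, q i s * (e.choose s : R) * g ^ (i * e) = 0) :
    ∀ e, ∑ i ∈ range I, ∑ s ∈ range S, q i s * (e.choose s : R) * g ^ (i * e) = 0 := by
  set f : ℕ → R := fun e => ∑ i ∈ range I, ∑ s ∈ range S, q i s * (e.choose s : R) * g ^ (i * e)
    with hf
  have key : f = 0 := by
    apply newton_zero (μ + S) f _ h0
    have : f = ∑ i ∈ range I, ∑ s ∈ range S, q i s • (fun e => (e.choose s : R) * (g ^ i) ^ e) := by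
      funext e
      simp only [hf, Finset.sum_apply, Pi.smul_apply, smul_eq_mul, pow_mul, mul_assoc]
    rw [this, map_sum]
    apply Finset.sum_eq_zero; intro i _
    rw [map_sum]
    apply Finset.sum_eq_zero; intro s hs
    rw [map_smul, newton_term _ _ _ _ (Finset.mem_range.1 hs), smul_zero]
    obtain ⟨c, hc⟩ := sub_one_dvd_pow_sub_one g i
    rw [hc, mul_pow, hg, zero_mul]
  intro e
  exact congrFun key e

lemma pigeon (M m0 I S X : ℕ) [NeZero M] (c : ℕ → ℕ → ℕ → ZMod M)
    (hcard : M ^ m0 < (X + 1) ^ (I * S)) :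
    ∃ q : ℕ → ℕ → ℤ, (∀ i s, |q i s| ≤ X) ∧ (∃ i < I, ∃ s < S, q i s ≠ 0) ∧
      ∀ e < m0, ∑ i ∈ range I, ∑ s ∈ range S, (q i s : ZMod M) * c e i s = 0 := by
  let F : (Fin I × Fin S → Fin (X + 1)) → (Fin m0 → ZMod M) := fun v e =>
    ∑ i : Fin I, ∑ s : Fin S, ((v (i, s) : ℕ) : ZMod M) * c e i s
  obtain ⟨v, v', hne, heq⟩ := Fintype.exists_ne_map_eq_of_card_lt F (by
    simp [ZMod.card, hcard])
  refine ⟨fun i s => if h : i < I ∧ s < S then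
    ((v (⟨i, h.1⟩, ⟨s, h.2⟩) : ℕ) : ℤ) - ((v' (⟨i, h.1⟩, ⟨s, h.2⟩) : ℕ) : ℤ) else 0, ?_, ?_, ?_⟩
  · intro i s
    dsimp only
    split_ifs with h
    · have h1 := (v (⟨i, h.1⟩, ⟨s, h.2⟩)).2
      have h2 := (v' (⟨i, h.1⟩, ⟨s, h.2⟩)).2
      rw [abs_le]; constructor <;> omega
    · simp
  · by_contra hcon
    push Not at hcon
    apply hne
    funext ⟨i, s⟩
    have := hcon i i.2 s s.2
    simp only [i.2, s.2, and_self, dite_true] at this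
    ext
    have h3 : ((v (i, s) : ℕ) : ℤ) = ((v' (i, s) : ℕ) : ℤ) := by simpa [sub_eq_zero] using this
    exact_mod_cast h3
  · intro e he
    have h1 := congrFun heq ⟨e, he⟩
    simp only [F] at h1
    rw [Finset.sum_range]
    simp_rw [Finset.sum_range]
    rw [← sub_eq_zero, ← Finset.sum_sub_distrib] at h1
    rw [← h1]
    apply Finset.sum_congr rfl; intro i _
    rw [← Finset.sum_sub_distrib]
    apply Finset.sum_congr rfl; intro s _
    simp [sub_mul]
end Part2

section Part3
open Finset Polynomial

lemma coeff_prod_le {K ι : Type*} [CommRing K] (s : Finset ι) (f : ι → K[X]) (d : ι → ℕ)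
    (h : ∀ i ∈ s, (f i).natDegree ≤ d i) :
    (∏ i ∈ s, f i).coeff (∑ i ∈ s, d i) = ∏ i ∈ s, (f i).coeff (d i) := by
  classical
  induction s using Finset.induction_on with
  | empty => simp
  | insert a s ha ih =>
    rw [prod_insert ha, sum_insert ha, prod_insert ha,
      coeff_mul_add_eq_of_natDegree_le (h a (mem_insert_self _ _)), ih]
    · exact fun i hi => h i (mem_insert_of_mem hi)
    · exact (natDegree_prod_le _ _).trans
        (sum_le_sum fun i hi => h i (mem_insert_of_mem hi))

lemma det_coeff {K ι : Type*} [CommRing K] [Fintype ι] [DecidableEq ι] (M : Matrix ι ι K[X])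
    (d : ι → ℕ) (h : ∀ i j, (M i j).natDegree ≤ d i) :
    M.det.coeff (∑ i, d i) = (Matrix.of fun i j => (M i j).coeff (d i)).det ∧
    M.det.natDegree ≤ ∑ i, d i := by
  rw [← Matrix.det_transpose, Matrix.det_apply]
  constructor
  · rw [← Matrix.det_transpose, Matrix.det_apply, finsetSum_coeff]
    refine sum_congr rfl fun σ _ => ?_
    rw [coeff_smul]
    congr 1
    have h1 : ∑ i, d i = ∑ i, d i := rfl
    simp only [Matrix.transpose_apply]
    rw [coeff_prod_le _ _ d (fun i _ => h i _)]
    rfl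
  · refine natDegree_sum_le_of_forall_le _ _ fun σ _ => ?_
    refine (natDegree_smul_le _ _).trans ((natDegree_prod_le _ _).trans (sum_le_sum fun i _ => ?_))
    exact h i _

lemma zero_det {K : Type*} [Field K] [DecidableEq K] (F a : K) (I S : ℕ)
    (hF : ∀ i j : ℕ, i < j → F ^ i ≠ F ^ j)
    (P : ℕ → K[X]) (hP : ∃ i < I, P i ≠ 0) (hdeg : ∀ i < I, (P i).natDegree < S)
    (E : Finset K) (hE : S * I ≤ E.card)
    (hz : ∀ e ∈ E, ∃ y : K, y ≠ 0 ∧ ∀ t < I,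
      ∑ i ∈ range I, (P i).eval (e + t * a) * (y * F ^ t) ^ i = 0) : False := by
  classical
  set s := (range I).filter (fun i => P i ≠ 0) with hs
  set m := s.card with hm
  have hm1 : 0 < m := by
    obtain ⟨i, hi, hi'⟩ := hP
    exact Finset.card_pos.2 ⟨i, by simp [hs, hi, hi']⟩
  have hmI : m ≤ I := by simpa using (Finset.card_filter_le (range I) (fun i => P i ≠ 0))
  let idx : Fin m ≃ s := s.equivFin.symm
  have hidx : ∀ l, (idx l : ℕ) < I ∧ P (idx l) ≠ 0 := fun l => by
    have := Finset.mem_filter.1 (idx l).2; exact ⟨Finset.mem_range.1 this.1, this.2⟩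
  let M : Matrix (Fin m) (Fin m) K[X] := Matrix.of fun l t =>
    C (F ^ ((idx l : ℕ) * (t : ℕ))) * (P (idx l)).comp (X + C ((t : ℕ) * a))
  let d : Fin m → ℕ := fun l => (P (idx l)).natDegree
  have hMd : ∀ l t, (M l t).natDegree ≤ d l := by
    intro l t
    refine (natDegree_C_mul_le _ ((P (idx l)).comp (X + C ((t : ℕ) * a)))).trans ?_
    rw [natDegree_comp, natDegree_X_add_C, mul_one]
  obtain ⟨hc, hdd⟩ := det_coeff M d hMd
  have hcoef : ∀ l t, (M l t).coeff (d l) = (P (idx l)).leadingCoeff * (F ^ (idx l : ℕ)) ^ (t : ℕ) := by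
    intro l t
    simp only [M, Matrix.of_apply, coeff_C_mul]
    have h1 : ((P (idx l)).comp (X + C ((t : ℕ) * a))).natDegree = d l := by
      rw [natDegree_comp, natDegree_X_add_C, mul_one]
    have h2 : ((P (idx l)).comp (X + C ((t : ℕ) * a))).coeff (d l) = (P (idx l)).leadingCoeff := by
      rw [← h1, coeff_natDegree, leadingCoeff_comp (by rw [natDegree_X_add_C]; exact one_ne_zero), leadingCoeff_X_add_C]
      simp
    rw [h2, pow_mul, mul_comm]
  have hdet0 : (Matrix.of fun l t => (M l t).coeff (d l)).det ≠ 0 := by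
    have : (Matrix.of fun l t => (M l t).coeff (d l)) = Matrix.of fun l t =>
        (P (idx l)).leadingCoeff * (Matrix.vandermonde fun l => F ^ (idx l : ℕ)) l t := by
      ext l t; simp only [Matrix.of_apply, hcoef, Matrix.vandermonde_apply]
    rw [this, Matrix.det_mul_column]
    refine mul_ne_zero (prod_ne_zero_iff.2 fun l _ => by simpa using (hidx l).2) ?_
    rw [Matrix.det_vandermonde_ne_zero_iff]
    intro l l' hll
    have : (idx l : ℕ) = idx l' := by
      rcases lt_trichotomy (idx l : ℕ) (idx l') with h | h | h
      · exact absurd hll (hF _ _ h)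
      · exact h
      · exact absurd hll.symm (hF _ _ h)
    exact idx.injective (Subtype.ext this)
  have hne : M.det ≠ 0 := by
    intro h0; rw [h0] at hc; simp at hc; exact hdet0 hc.symm
  have hroots : E.val ⊆ M.det.roots := by
    intro e he
    rw [mem_roots hne, IsRoot.def, ← coe_evalRingHom, RingHom.map_det]
    obtain ⟨y, hy, hyz⟩ := hz e he
    rw [← Matrix.exists_vecMul_eq_zero_iff]
    refine ⟨fun l => y ^ (idx l : ℕ), ?_, ?_⟩
    · intro h; exact pow_ne_zero _ hy (congrFun h ⟨0, hm1⟩)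
    · funext t
      have h1 := hyz t (lt_of_lt_of_le t.2 hmI)
      have h2 : ∑ i ∈ s, (P i).eval (e + t * a) * (y * F ^ (t : ℕ)) ^ i = 0 := by
        rw [← h1]
        apply sum_subset (filter_subset _ _)
        intro i hi hi'
        have : P i = 0 := by
          by_contra h; exact hi' (mem_filter.2 ⟨hi, h⟩)
        simp [this]
      rw [← Finset.sum_coe_sort, ← idx.sum_comp] at h2
      simp only [Matrix.vecMul, dotProduct, RingHom.mapMatrix_apply, Matrix.map_apply, Pi.zero_apply]
      rw [← h2]
      refine sum_congr rfl fun l _ => ?_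
      simp [M, eval_comp]
      ring
  have h3 : E.card ≤ M.det.natDegree := card_le_degree_of_subset_roots hroots
  have h4 : ∑ l, d l < S * I := by
    calc ∑ l, d l < ∑ l : Fin m, S := by
          refine sum_lt_sum_of_nonempty ⟨⟨0, hm1⟩, mem_univ _⟩ fun l _ => hdeg _ (hidx l).1
      _ = m * S := by simp
      _ ≤ S * I := by rw [mul_comm]; gcongr
  omega

/-- binomial polynomial combination -/
lemma binom_poly {K : Type*} [Field K] [CharZero K] (S : ℕ) (q : ℕ → ℤ) :
    ∃ P : K[X], (S = 0 ∨ P.natDegree < S) ∧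
      (∀ e : ℕ, P.eval (e : K) = ∑ s ∈ range S, (q s : K) * (e.choose s : K)) ∧
      ((∃ s < S, q s ≠ 0) → P ≠ 0) := by
  set P : K[X] := ∑ s ∈ range S, C ((q s : K) / (s.factorial : K)) * descPochhammer K s with hP
  have hev : ∀ e : ℕ, P.eval (e : K) = ∑ s ∈ range S, (q s : K) * (e.choose s : K) := by
    intro e
    rw [hP, eval_finsetSum]
    refine sum_congr rfl fun s _ => ?_
    rw [eval_mul, eval_C, descPochhammer_eval_eq_descFactorial, Nat.descFactorial_eq_factorial_mul_choose]
    have : (s.factorial : K) ≠ 0 := by exact_mod_cast s.factorial_ne_zero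
    push_cast
    field_simp
  refine ⟨P, ?_, hev, ?_⟩
  · rcases Nat.eq_zero_or_pos S with h | h
    · exact Or.inl h
    · right
      have : P.natDegree ≤ S - 1 := by
        refine natDegree_sum_le_of_forall_le _ _ fun s hs => ?_
        refine (natDegree_C_mul_le _ _).trans ?_
        rw [descPochhammer_natDegree]
        have := Finset.mem_range.1 hs
        omega
      omega
  · intro hex hP0
    classical
    let s := Nat.find hex
    obtain ⟨hs1, hs2⟩ := Nat.find_spec hex
    have hmin : ∀ t < s, q t = 0 := by
      intro t ht
      have := Nat.find_min hex ht
      by_contra h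
      exact this ⟨lt_trans ht hs1, h⟩
    have h1 := hev s
    rw [hP0, eval_zero, sum_eq_single s] at h1
    · simp at h1; exact hs2 (by exact_mod_cast h1.symm)
    · intro t ht hts
      rcases lt_or_gt_of_ne hts with h | h
      · simp [hmin t h]
      · simp [Nat.choose_eq_zero_of_lt h]
    · intro h; exact absurd (Finset.mem_range.2 hs1) h

lemma zero_estimate {K : Type*} [Field K] [CharZero K] (α γ : K) (hα : α ≠ 0) (hγ : γ ≠ 0)
    (I S D N r w : ℕ) (hrw : Nat.Coprime r w) (hr : 0 < r) (hDr : D ≤ r)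
    (hcard : S * I ≤ (D - I) * (N - I))
    (q : ℕ → ℕ → ℤ) (hq : ∃ i < I, ∃ s < S, q i s ≠ 0)
    (hz : ∀ j < D, ∀ k < N, ∑ i ∈ range I, ∑ s ∈ range S,
      (q i s : K) * ((r * k + w * j).choose s : K) * (α ^ j * γ ^ k) ^ i = 0)
    (hord : (∀ n : ℕ, 0 < n → α ^ n ≠ 1) ∨ (∀ n : ℕ, 0 < n → γ ^ n ≠ 1)) : False := by
  classical
  choose P hP1 hP2 hP3 using fun i => binom_poly (K := K) S (q i)
  have hpow : ∀ F : K, F ≠ 0 → (∀ n : ℕ, 0 < n → F ^ n ≠ 1) → ∀ i j : ℕ, i < j → F ^ i ≠ F ^ j := by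
    intro F hF0 h i j hij heq
    apply h (j - i) (by omega)
    have : F ^ i * F ^ (j - i) = F ^ i * 1 := by
      rw [← pow_add, mul_one, heq]; congr 1; omega
    exact mul_left_cancel₀ (pow_ne_zero _ hF0) this
  have hS : 0 < S := by obtain ⟨i, _, s, hs, _⟩ := hq; omega
  have hI : 0 < I := by obtain ⟨i, hi, _⟩ := hq; omega
  have hdeg : ∀ i < I, (P i).natDegree < S := fun i _ => (hP1 i).resolve_left (by omega)
  have hPne : ∃ i < I, P i ≠ 0 := by
    obtain ⟨i, hi, h⟩ := hq; exact ⟨i, hi, hP3 i h⟩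
  let ev : ℕ × ℕ → K := fun x => ((r * x.2 + w * x.1 : ℕ) : K)
  let E : Finset K := (range (D - I) ×ˢ range (N - I)).image ev
  have hEc : S * I ≤ E.card := by
    rw [Finset.card_image_of_injOn]
    · simpa using hcard
    · rintro ⟨j, k⟩ h1 ⟨j', k'⟩ h2 heq
      simp only [ev, Nat.cast_inj] at heq
      simp only [coe_product, coe_range, Set.mem_prod, Set.mem_Iio] at h1 h2
      have hj : j % r = j' % r := by
        have h3 : (w * j) ≡ (w * j') [MOD r] := by
          have : (r * k + w * j) ≡ (r * k' + w * j') [MOD r] := by rw [heq]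
          simpa [Nat.ModEq, Nat.add_mod] using this
        exact Nat.ModEq.cancel_left_of_coprime hrw h3
      rw [Nat.mod_eq_of_lt (by omega), Nat.mod_eq_of_lt (by omega)] at hj
      subst hj
      have : r * k = r * k' := by omega
      have := Nat.eq_of_mul_eq_mul_left hr this
      simp [this]
  have hval : ∀ j < D, ∀ k < N, ∑ i ∈ range I, (P i).eval ((r * k + w * j : ℕ) : K) * (α ^ j * γ ^ k) ^ i = 0 := by
    intro j hj k hk
    rw [← hz j hj k hk]
    refine sum_congr rfl fun i _ => ?_
    rw [hP2, sum_mul]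
  rcases hord with h | h
  · refine zero_det α (w : K) I S (hpow α hα h) P hPne hdeg E hEc ?_
    intro e he
    obtain ⟨⟨j, k⟩, hjk, rfl⟩ := Finset.mem_image.1 he
    simp only [mem_product, Finset.mem_range] at hjk
    refine ⟨α ^ j * γ ^ k, mul_ne_zero (pow_ne_zero _ hα) (pow_ne_zero _ hγ), fun t ht => ?_⟩
    rw [← hval (j + t) (by omega) k (by omega)]
    refine sum_congr rfl fun i _ => ?_
    congr 2
    · simp only [ev]; push_cast; ring
    · ring
  · refine zero_det γ (r : K) I S (hpow γ hγ h) P hPne hdeg E hEc ?_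
    intro e he
    obtain ⟨⟨j, k⟩, hjk, rfl⟩ := Finset.mem_image.1 he
    simp only [mem_product, Finset.mem_range] at hjk
    refine ⟨α ^ j * γ ^ k, mul_ne_zero (pow_ne_zero _ hα) (pow_ne_zero _ hγ), fun t ht => ?_⟩
    rw [← hval j (by omega) (k + t) (by omega)]
    refine sum_congr rfl fun i _ => ?_
    congr 2
    · simp only [ev]; push_cast; ring
    · ring
end Part3

section Part4
open Finset Polynomial

lemma zmod_cast_dvd (p k A : ℕ) [NeZero (p ^ A)] (hkA : k ≤ A) (x : ZMod (p ^ A))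
    (hx : ZMod.castHom (pow_dvd_pow p hkA) (ZMod (p ^ k)) x = 0) : ((p : ZMod (p ^ A)) ^ k) ∣ x := by
  rw [ZMod.castHom_apply, ← ZMod.natCast_val, ZMod.natCast_eq_zero_iff] at hx
  obtain ⟨c, hc⟩ := hx
  refine ⟨c, ?_⟩
  rw [← ZMod.natCast_zmod_val x, hc]
  push_cast; rfl

lemma group_root {G : Type*} [CommGroup G] (a b : G) (r w : ℕ) (hrw : Nat.Coprime r w)
    (hab : a ^ r = b ^ w) : ∃ g : G, g ^ r = b ∧ g ^ w = a := by
  obtain ⟨u, v, huv⟩ : ∃ u v : ℤ, u * r + v * w = 1 := Nat.isCoprime_iff_coprime.2 hrw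
  refine ⟨b ^ u * a ^ v, ?_, ?_⟩
  · have : (a ^ v) ^ r = b ^ (v * w) := by
      rw [← zpow_natCast, ← zpow_mul, mul_comm v, zpow_mul, zpow_natCast, hab, ← zpow_natCast,
        ← zpow_mul, mul_comm]
    rw [mul_pow, this, ← zpow_natCast, ← zpow_mul, ← zpow_add, huv, zpow_one]
  · have : (b ^ u) ^ w = a ^ (u * r) := by
      rw [← zpow_natCast, ← zpow_mul, mul_comm u, zpow_mul, zpow_natCast, ← hab, ← zpow_natCast,
        ← zpow_mul, mul_comm]
    rw [mul_pow, this, ← zpow_natCast (a ^ v), ← zpow_mul, ← zpow_add, huv, zpow_one]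

/-- the common root -/
lemma common_root (p k μ : ℕ) [hp : Fact p.Prime] (hμ : 1 ≤ μ) (a b : (ZMod (p ^ (k * μ)))ˣ)
    (P : ℕ) (hP : (p ^ k).totient ∣ P) (r w : ℕ) (hrw : Nat.Coprime r w)
    (hab : a ^ r = b ^ w) :
    ∃ g : ZMod (p ^ (k * μ)), (g - 1) ^ μ = 0 ∧ g ^ r = (b : ZMod (p ^ (k * μ))) ^ P ∧
      g ^ w = (a : ZMod (p ^ (k * μ))) ^ P := by
  have hkA : k ≤ k * μ := Nat.le_mul_of_pos_right k hμ
  have : NeZero (p ^ (k * μ)) := ⟨pow_ne_zero _ hp.1.ne_zero⟩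
  have : NeZero (p ^ k) := ⟨pow_ne_zero _ hp.1.ne_zero⟩
  obtain ⟨g0, h1, h2⟩ := group_root a b r w hrw hab
  refine ⟨((g0 ^ P : (ZMod (p ^ (k * μ)))ˣ) : ZMod (p ^ (k * μ))), ?_, ?_, ?_⟩
  · have h3 : ((p : ZMod (p ^ (k * μ))) ^ k) ∣ (((g0 ^ P : (ZMod (p ^ (k * μ)))ˣ) : ZMod (p ^ (k * μ))) - 1) := by
      apply zmod_cast_dvd p k (k * μ) hkA
      rw [map_sub, map_one, sub_eq_zero]
      obtain ⟨c, rfl⟩ := hP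
      have := ZMod.pow_totient (Units.map (ZMod.castHom (pow_dvd_pow p hkA) (ZMod (p ^ k))).toMonoidHom g0)
      have h4 := congrArg (fun x : (ZMod (p ^ k))ˣ => ((x ^ c : (ZMod (p ^ k))ˣ) : ZMod (p ^ k))) this
      simp only [one_pow, Units.val_one, ← pow_mul] at h4
      rw [← h4, Units.val_pow_eq_pow_val, map_pow, Units.val_pow_eq_pow_val]
      rfl
    obtain ⟨c, hc⟩ := h3
    rw [hc, mul_pow, ← pow_mul]
    have : ((p : ZMod (p ^ (k * μ))) ^ (k * μ)) = 0 := by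
      have := ZMod.natCast_self (p ^ (k * μ))
      push_cast at this; exact this
    rw [this, zero_mul]
  · rw [← Units.val_pow_eq_pow_val, ← pow_mul, mul_comm P, pow_mul g0, h1, Units.val_pow_eq_pow_val]
  · rw [← Units.val_pow_eq_pow_val, ← pow_mul, mul_comm P, pow_mul g0, h2, Units.val_pow_eq_pow_val]

lemma ht_mono {K : Type*} [Field K] (a : K) (h : ℝ) (D : ℕ) (hD : (D : ℝ) ≤ Real.exp h)
    (hintg : IsIntegral ℤ ((D : K) * a)) (hs : ∀ σ : K →+* ℂ, ‖σ ((D : K) * a)‖ ≤ Real.exp h)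
    (m M : ℕ) (hmM : m ≤ M) :
    IsIntegral ℤ ((D : K) ^ M * a ^ m) ∧ ∀ σ : K →+* ℂ, ‖σ ((D : K) ^ M * a ^ m)‖ ≤ Real.exp h ^ M := by
  have h1 : (D : K) ^ M * a ^ m = (D : K) ^ (M - m) * ((D : K) * a) ^ m := by
    rw [mul_pow, ← mul_assoc, ← pow_add]; congr 2; omega
  have hDi : IsIntegral ℤ (D : K) := by
    have := isIntegral_algebraMap (R := ℤ) (A := K) (x := (D : ℤ)); simpa using this
  constructor
  · rw [h1]; exact (hDi.pow _).mul (hintg.pow _)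
  · intro σ
    rw [h1, map_mul, map_pow, map_pow, norm_mul, norm_pow, norm_pow, map_natCast]
    calc _ ≤ Real.exp h ^ (M - m) * Real.exp h ^ m := by
          gcongr
          · simpa using hD
          · exact hs σ
      _ = _ := by rw [← pow_add]; congr 1; omega

lemma core {K : Type*} [Field K] [NumberField K] {p : ℕ} [hp : Fact p.Prime] (φ : K →+* ℚ_[p])
    (α γ : K) (hα : ‖φ α‖ = 1) (hγ : ‖φ γ‖ = 1) (hord : (∀ n : ℕ, 0 < n → α ^ n ≠ 1) ∨ (∀ n : ℕ, 0 < n → γ ^ n ≠ 1))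
    (h0 h1 : ℝ) (hth0 : HtLE α h0) (hth1 : HtLE γ h1)
    (I k μ P S D N r w X : ℕ) (hI : 1 ≤ I) (hμ : 1 ≤ μ) (hS : 1 ≤ S) (hX : 1 ≤ X) (hP0 : 0 < P)
    (hP : (p ^ k).totient ∣ P) (hrw : Nat.Coprime r w) (hr : 0 < r) (hDr : D ≤ r)
    (hcard : S * I ≤ (D - I) * (N - I))
    (hpig : (p ^ (k * μ)) ^ (μ + S) < (X + 1) ^ (I * S))
    (Cs : ℝ) (hCs : ∀ e : ℕ, e ≤ r * N + w * D → ∑ s ∈ range S, (e.choose s : ℝ) ≤ Cs)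
    (hnum : (2 * (I * X * Cs * Real.exp h0 ^ (P * D * I) * Real.exp h1 ^ (P * N * I))) ^ (Module.finrank ℚ K) <
      (p : ℝ) ^ (k * μ))
    (happ : ‖φ α ^ r - φ γ ^ w‖ ≤ (p : ℝ) ^ (-((k * μ : ℕ) : ℤ))) : False := by
  have : NeZero (p ^ (k * μ)) := ⟨pow_ne_zero _ hp.1.ne_zero⟩
  have hα0 : α ≠ 0 := by rintro rfl; simp at hα
  have hγ0 : γ ≠ 0 := by rintro rfl; simp at hγ
  set T := PadicInt.toZModPow (p := p) (k * μ) with hT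
  have hTz : ∀ x : ℤ_[p], T x = 0 ↔ ‖(x : ℚ_[p])‖ ≤ (p : ℝ) ^ (-((k * μ : ℕ) : ℤ)) := by
    intro x
    rw [← RingHom.mem_ker, hT, PadicInt.ker_toZModPow, ← PadicInt.norm_le_pow_iff_mem_span_pow]
    rfl
  let a : ℤ_[p] := ⟨φ α, hα.le⟩
  let b : ℤ_[p] := ⟨φ γ, hγ.le⟩
  have ha : IsUnit a := PadicInt.isUnit_iff.2 hα
  have hb : IsUnit b := PadicInt.isUnit_iff.2 hγ
  let ua : (ZMod (p ^ (k * μ)))ˣ := (ha.map T).unit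
  let ub : (ZMod (p ^ (k * μ)))ˣ := (hb.map T).unit
  have hua : (ua : ZMod (p ^ (k * μ))) = T a := rfl
  have hub : (ub : ZMod (p ^ (k * μ))) = T b := rfl
  have hab : ua ^ r = ub ^ w := by
    ext
    rw [Units.val_pow_eq_pow_val, Units.val_pow_eq_pow_val, hua, hub, ← map_pow, ← map_pow, ← sub_eq_zero, ← map_sub,
      hTz]
    rw [PadicInt.coe_sub, PadicInt.coe_pow, PadicInt.coe_pow]
    exact happ
  obtain ⟨g, hg1, hgr, hgw⟩ := common_root p k μ hμ ua ub P hP r w hrw hab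
  rw [hub] at hgr
  rw [hua] at hgw
  obtain ⟨q, hqX, hqne, hq0⟩ := pigeon (p ^ (k * μ)) (μ + S) I S X
    (fun e i s => (e.choose s : ZMod (p ^ (k * μ))) * g ^ (i * e)) hpig
  have hf := newton g μ I S hg1 (fun i s => (q i s : ZMod (p ^ (k * μ)))) (by
    intro e he; rw [← hq0 e he]; simp only [mul_assoc])
  refine zero_estimate (α ^ P) (γ ^ P) (pow_ne_zero _ hα0) (pow_ne_zero _ hγ0) I S D N r w hrw hr hDr hcard
    q hqne ?_ ?_
  swap
  · rcases hord with h | h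
    · left; intro n hn; rw [← pow_mul]; exact h _ (Nat.mul_pos hP0 hn)
    · right; intro n hn; rw [← pow_mul]; exact h _ (Nat.mul_pos hP0 hn)
  intro j hj l hl
  obtain ⟨Da, hDa0, hDa, hia, hsa⟩ := hth0
  obtain ⟨Dc, hDc0, hDc, hic, hsc⟩ := hth1
  have hex0 : 1 ≤ Real.exp h0 := le_trans (by exact_mod_cast hDa0) hDa
  have hex1 : 1 ≤ Real.exp h1 := le_trans (by exact_mod_cast hDc0) hDc
  have hCs1 : 1 ≤ Cs := by
    refine le_trans ?_ (hCs 0 (Nat.zero_le _))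
    rw [sum_eq_single_of_mem 0 (Finset.mem_range.2 hS)]
    · simp
    · intro s _ hs; rw [Nat.choose_eq_zero_of_lt (by omega)]; simp
  set e := r * l + w * j with he
  have heL : e ≤ r * N + w * D := by
    rw [he]; gcongr
  set V : K := ∑ i ∈ range I, ∑ s ∈ range S,
      (q i s : K) * (e.choose s : K) * ((α ^ P) ^ j * (γ ^ P) ^ l) ^ i with hV
  set W : K := V * ((Da : K) ^ (P * D * I) * (Dc : K) ^ (P * N * I)) with hW
  have hterm : ∀ i < I, IsIntegral ℤ (((α ^ P) ^ j * (γ ^ P) ^ l) ^ i * ((Da : K) ^ (P * D * I) * (Dc : K) ^ (P * N * I))) ∧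
      ∀ σ : K →+* ℂ, ‖σ (((α ^ P) ^ j * (γ ^ P) ^ l) ^ i * ((Da : K) ^ (P * D * I) * (Dc : K) ^ (P * N * I)))‖ ≤
        Real.exp h0 ^ (P * D * I) * Real.exp h1 ^ (P * N * I) := by
    intro i hi
    obtain ⟨u1, u2⟩ := ht_mono α h0 Da hDa hia hsa (P * j * i) (P * D * I) (by gcongr)
    obtain ⟨v1, v2⟩ := ht_mono γ h1 Dc hDc hic hsc (P * l * i) (P * N * I) (by gcongr)
    have : (((α ^ P) ^ j * (γ ^ P) ^ l) ^ i * ((Da : K) ^ (P * D * I) * (Dc : K) ^ (P * N * I))) =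
      ((Da : K) ^ (P * D * I) * α ^ (P * j * i)) * ((Dc : K) ^ (P * N * I) * γ ^ (P * l * i)) := by
      rw [mul_pow, pow_mul α, pow_mul α, pow_mul γ (P * l), pow_mul γ]; ring
    rw [this]
    refine ⟨u1.mul v1, fun σ => ?_⟩
    rw [map_mul, norm_mul]
    gcongr
    · exact u2 σ
    · exact v2 σ
  have hWeq : W = ∑ i ∈ range I, ∑ s ∈ range S,
      ((q i s * (e.choose s : ℤ) : ℤ) : K) * (((α ^ P) ^ j * (γ ^ P) ^ l) ^ i * ((Da : K) ^ (P * D * I) * (Dc : K) ^ (P * N * I))) := by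
    rw [hW, hV, sum_mul]
    refine sum_congr rfl fun i _ => ?_
    rw [sum_mul]
    refine sum_congr rfl fun s _ => ?_
    push_cast; ring
  have hW0 : W = 0 := by
    refine liouville φ W ?_ (I * X * Cs * Real.exp h0 ^ (P * D * I) * Real.exp h1 ^ (P * N * I)) ?_ ?_ (k * μ) ?_ hnum
    · rw [hWeq]
      refine IsIntegral.sum _ fun i hi => IsIntegral.sum _ fun s _ => ?_
      refine IsIntegral.mul ?_ (hterm i (Finset.mem_range.1 hi)).1
      have := isIntegral_algebraMap (R := ℤ) (A := K) (x := (q i s * (e.choose s : ℤ))); simpa using this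
    · have e1 : 1 ≤ Real.exp h0 ^ (P * D * I) := one_le_pow₀ hex0
      have e2 : 1 ≤ Real.exp h1 ^ (P * N * I) := one_le_pow₀ hex1
      have e3 : (1 : ℝ) ≤ I := by exact_mod_cast hI
      have e4 : (1 : ℝ) ≤ X := by exact_mod_cast hX
      exact one_le_mul_of_one_le_of_one_le (one_le_mul_of_one_le_of_one_le (one_le_mul_of_one_le_of_one_le
        (one_le_mul_of_one_le_of_one_le e3 e4) hCs1) e1) e2
    · intro σ
      rw [hWeq, map_sum]
      refine (norm_sum_le _ _).trans ?_
      have : ∀ i ∈ range I, ‖σ (∑ s ∈ range S,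
          ((q i s * (e.choose s : ℤ) : ℤ) : K) * (((α ^ P) ^ j * (γ ^ P) ^ l) ^ i * ((Da : K) ^ (P * D * I) * (Dc : K) ^ (P * N * I))))‖ ≤
          X * Cs * Real.exp h0 ^ (P * D * I) * Real.exp h1 ^ (P * N * I) := by
        intro i hi
        rw [map_sum]
        refine (norm_sum_le _ _).trans ?_
        calc _ ≤ ∑ s ∈ range S, (X * (e.choose s : ℝ)) * (Real.exp h0 ^ (P * D * I) * Real.exp h1 ^ (P * N * I)) := by
              refine sum_le_sum fun s _ => ?_
              rw [map_mul, norm_mul]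
              gcongr
              · rw [map_intCast, Complex.norm_intCast]
                push_cast
                rw [abs_mul, Nat.abs_cast]
                gcongr
                exact_mod_cast hqX i s
              · exact (hterm i (Finset.mem_range.1 hi)).2 σ
          _ = X * (∑ s ∈ range S, (e.choose s : ℝ)) * (Real.exp h0 ^ (P * D * I) * Real.exp h1 ^ (P * N * I)) := by
              rw [← sum_mul, ← mul_sum]
          _ ≤ X * Cs * (Real.exp h0 ^ (P * D * I) * Real.exp h1 ^ (P * N * I)) := by
              gcongr; exact hCs e heL
          _ = _ := by ring
      refine (sum_le_sum this).trans ?_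
      rw [sum_const, card_range, nsmul_eq_mul]
      apply le_of_eq; ring
    · let v : ℤ_[p] := ∑ i ∈ range I, ∑ s ∈ range S,
        (q i s : ℤ_[p]) * (e.choose s : ℤ_[p]) * ((a ^ P) ^ j * (b ^ P) ^ l) ^ i
      have hv : φ V = (v : ℚ_[p]) := by
        have : (v : ℚ_[p]) = PadicInt.Coe.ringHom v := rfl
        rw [this, hV]
        simp only [v, map_sum, map_mul, map_pow, map_intCast, map_natCast]
        rfl
      have hvz : T v = 0 := by
        rw [← hf e]
        simp only [v, map_sum, map_mul, map_pow, map_intCast, map_natCast]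
        refine sum_congr rfl fun i _ => sum_congr rfl fun s _ => ?_
        congr 1
        rw [← hgr, ← hgw, he]
        rw [← pow_mul, ← pow_mul, ← pow_add, ← pow_mul]
        congr 1; ring
      have hvn := (hTz v).1 hvz
      rw [hW, map_mul, norm_mul, hv]
      have : ‖φ ((Da : K) ^ (P * D * I) * (Dc : K) ^ (P * N * I))‖ ≤ 1 := by
        have : ((Da : K) ^ (P * D * I) * (Dc : K) ^ (P * N * I)) = ((Da ^ (P * D * I) * Dc ^ (P * N * I) : ℕ) : K) := by
          push_cast; rfl
        rw [this, map_natCast]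
        exact_mod_cast Padic.norm_int_le_one ((Da ^ (P * D * I) * Dc ^ (P * N * I) : ℕ) : ℤ)
      calc _ ≤ ‖(v : ℚ_[p])‖ * 1 := by gcongr
        _ ≤ _ := by simpa using hvn
  rw [hW] at hW0
  rcases mul_eq_zero.1 hW0 with h | h
  · exact h
  · exfalso
    have h3 : (Da : K) ≠ 0 := by exact_mod_cast hDa0.ne'
    have h4 : (Dc : K) ≠ 0 := by exact_mod_cast hDc0.ne'
    exact (mul_ne_zero (pow_ne_zero _ h3) (pow_ne_zero _ h4)) h
end Part4

section Part5
open Finset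

lemma binsum (x : ℝ) (hx : 0 < x) (hx1 : x ≤ 1) (e S : ℕ) :
    ∑ s ∈ range S, (e.choose s : ℝ) ≤ (1 / x) ^ S * (1 + x) ^ e := by
  calc ∑ s ∈ range S, (e.choose s : ℝ) ≤ ∑ s ∈ range S, (1 / x) ^ S * (x ^ s * (e.choose s : ℝ)) := by
        refine sum_le_sum fun s hs => ?_
        have h1 : 1 ≤ (1 / x) ^ S * x ^ s := by
          have : x ^ S ≤ x ^ s := pow_le_pow_of_le_one hx.le hx1 (Finset.mem_range.1 hs).le
          rw [one_div, inv_pow, ← div_eq_inv_mul, le_div_iff₀ (by positivity)]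
          linarith
        rw [← mul_assoc]
        exact le_mul_of_one_le_left (by positivity) h1
    _ = (1 / x) ^ S * ∑ s ∈ range S, (x ^ s * (e.choose s : ℝ)) := by rw [mul_sum]
    _ ≤ (1 / x) ^ S * (1 + x) ^ e := by
        gcongr
        rw [add_comm, add_pow]
        simp only [one_pow, mul_one]
        calc _ ≤ ∑ s ∈ range (S + (e + 1)), x ^ s * (e.choose s : ℝ) := by
              apply sum_le_sum_of_subset_of_nonneg
              · intro s; simp only [Finset.mem_range]; omega
              · intros; positivity
          _ = _ := by
              symm
              apply sum_subset
              · intro s; simp only [Finset.mem_range]; omega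
              · intro s _ h
                rw [Nat.choose_eq_zero_of_lt (by simpa using h)]; simp

lemma exists_k (p : ℕ) (hp : 2 ≤ p) (C : ℝ) : ∃ k : ℕ, 2 ≤ k ∧ C * k ≤ (p : ℝ) ^ k := by
  have h := tendsto_pow_const_div_const_pow_of_one_lt 1 (r := (2 : ℝ)) (by norm_num)
  have h2 : Filter.Tendsto (fun n : ℕ => C * ((n : ℝ) ^ 1 / 2 ^ n)) Filter.atTop (nhds 0) := by
    simpa using h.const_mul C
  have h3 := (h2.eventually (gt_mem_nhds (zero_lt_one))).and (Filter.eventually_ge_atTop 2)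
  obtain ⟨k, hk1, hk2⟩ := h3.exists
  refine ⟨k, hk2, ?_⟩
  rw [pow_one, ← mul_div_assoc, div_lt_one (by positivity)] at hk1
  refine hk1.le.trans ?_
  gcongr
  exact_mod_cast hp

set_option maxHeartbeats 1000000 in
theorem key {K : Type*} [Field K] [NumberField K] {p : ℕ} [hp : Fact p.Prime] (φ : K →+* ℚ_[p])
    (κ W : ℝ) (hκ : 0 < κ) (hκ1 : κ ≤ 1) (hW : 1 ≤ W) :
    ∃ ε : ℝ, 0 < ε ∧ ∃ r0 : ℕ, ∀ r : ℕ, r0 ≤ r → ∀ w : ℕ, Nat.Coprime r w → ∀ h0 : ℝ, 1 ≤ h0 →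
      (w : ℝ) ≤ W * h0 → ∀ α γ : K, ‖φ α‖ = 1 → ‖φ γ‖ = 1 → HtLE α h0 → HtLE γ (ε * r) →
      ((∀ n : ℕ, 0 < n → α ^ n ≠ 1) ∨ (∀ n : ℕ, 0 < n → γ ^ n ≠ 1)) →
      Real.exp (-(κ * r * h0)) < ‖φ α ^ r - φ γ ^ w‖ := by
  set d := Module.finrank ℚ K with hd
  have hd1 : 1 ≤ d := Module.finrank_pos
  set J := 6 * d with hJ
  have hJ1 : 1 ≤ J := by omega
  set I := J * (J + 1) with hI
  have hI1 : 1 ≤ I := Nat.mul_pos (by omega) (by omega)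
  set ℓ := Real.log p with hℓ
  have hp2 : 2 ≤ p := hp.1.two_le
  have hp2' : (2 : ℝ) ≤ p := by exact_mod_cast hp2
  have hp0 : (0 : ℝ) < p := by linarith
  have hℓ2 : 0.6 ≤ ℓ := by
    have := Real.log_two_gt_d9
    have h2 : Real.log 2 ≤ ℓ := Real.log_le_log (by norm_num) hp2'
    linarith
  obtain ⟨k, hk2, hk⟩ := exists_k p hp2 (48 * (2 + W) * J * I ^ 2 * ℓ / κ + 2 * I)
  have hk2' : (2 : ℝ) ≤ k := by exact_mod_cast hk2
  have hkl : 1 ≤ k * ℓ := by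
    calc (1 : ℝ) ≤ 2 * 0.6 := by norm_num
      _ ≤ k * ℓ := by gcongr
  have hJ' : (1 : ℝ) ≤ J := by exact_mod_cast hJ1
  have hI' : (1 : ℝ) ≤ I := by exact_mod_cast hI1
  set P := (p ^ k).totient with hP
  have hP0 : 0 < P := Nat.totient_pos.2 (pow_pos hp.1.pos _)
  have hP1 : (1 : ℝ) ≤ P := by exact_mod_cast hP0
  have hPle : (P : ℝ) ≤ (p : ℝ) ^ k := by exact_mod_cast Nat.totient_le _
  have hℓ0 : 0 < ℓ := by linarith
  set cD := κ / (8 * k * J * I ^ 2 * P * ℓ) with hcD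
  have hden : 0 < 8 * k * J * I ^ 2 * P * ℓ := by positivity
  have hcD0 : 0 < cD := by positivity
  have hA1 : 0 ≤ 48 * (2 + W) * J * I ^ 2 * ℓ / κ := by positivity
  have hk_a : 2 * (I : ℝ) ≤ (p : ℝ) ^ k := by
    refine le_trans ?_ hk
    have : 0 ≤ 48 * (2 + W) * J * I ^ 2 * ℓ / κ * k := by positivity
    have h2 : 2 * (I : ℝ) * 1 ≤ 2 * I * k := by gcongr; linarith
    linarith
  have hk_b : 48 * (2 + W) * J * I ^ 2 * ℓ / κ * k ≤ (p : ℝ) ^ k := by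
    refine le_trans ?_ hk
    gcongr
    have : (0 : ℝ) ≤ 2 * I := by positivity
    linarith
  refine ⟨cD / (8 * I * P), by positivity, ⌈1 / cD⌉₊ + 1, ?_⟩
  intro r hr w hrw h0 hh0 hw α γ hα hγ hHα hHγ hord
  by_contra hcon
  push Not at hcon
  have hr1 : 1 / cD ≤ r := by
    refine (Nat.le_ceil _).trans ?_
    exact_mod_cast (by omega : ⌈1 / cD⌉₊ ≤ r)
  have hrpos : 0 < r := by omega
  have hrpos' : (0 : ℝ) < r := by exact_mod_cast hrpos
  have hcr : 1 ≤ cD * r := by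
    rw [div_le_iff₀ hcD0] at hr1; linarith
  set D' := ⌊cD * r⌋₊ with hD'
  have hD'1 : 1 ≤ D' := Nat.le_floor (by simpa using hcr)
  have hD'1' : (1 : ℝ) ≤ D' := by exact_mod_cast hD'1
  have hD'le : (D' : ℝ) ≤ cD * r := Nat.floor_le (by positivity)
  have hD'ge : cD * r / 2 ≤ D' := by
    have := Nat.lt_floor_add_one (cD * r)
    rw [← hD'] at this; linarith
  set N' := ⌈4 * (I : ℝ) ^ 2 * P * h0⌉₊ with hN'
  have hbase : (I : ℝ) ≤ 4 * (I : ℝ) ^ 2 * P * h0 := by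
    have : (1 : ℝ) ≤ P * h0 := one_le_mul_of_one_le_of_one_le hP1 hh0
    have h2 : (I : ℝ) ≤ (I : ℝ) ^ 2 := le_self_pow₀ hI' two_ne_zero
    have h3 : (I : ℝ) ^ 2 * 1 ≤ (I : ℝ) ^ 2 * (P * h0) := by gcongr
    linarith
  have hN'ge : 4 * (I : ℝ) ^ 2 * P * h0 ≤ N' := Nat.le_ceil _
  have hN'le : (N' : ℝ) ≤ 8 * (I : ℝ) ^ 2 * P * h0 := by
    have := Nat.ceil_lt_add_one (a := 4 * (I : ℝ) ^ 2 * P * h0) (by positivity)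
    rw [← hN'] at this; linarith [hbase, hI']
  have hIN : I ≤ N' := by exact_mod_cast hbase.trans hN'ge
  have hN'1 : 1 ≤ N' := le_trans hI1 hIN
  have hh0N : h0 ≤ N' := by
    refine le_trans ?_ hN'ge
    have : (1 : ℝ) ≤ 4 * (I : ℝ) ^ 2 * P := by
      have h1 : (1 : ℝ) ≤ (I : ℝ) ^ 2 := one_le_pow₀ hI'
      have h2 : (1 : ℝ) ≤ (I : ℝ) ^ 2 * P := one_le_mul_of_one_le_of_one_le h1 hP1
      linarith
    exact le_mul_of_one_le_left (by linarith) this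
  set S := D' * N' with hS
  have hS1 : 1 ≤ S := Nat.mul_pos hD'1 hN'1
  have hSr : (S : ℝ) = D' * N' := by rw [hS]; push_cast; rfl
  set D := I + I * D' with hD
  set N := I + N' with hN
  have hD2 : D ≤ 2 * I * D' := by
    rw [hD]
    have : I * 1 ≤ I * D' := Nat.mul_le_mul_left _ hD'1
    linarith
  have hN2 : N ≤ 2 * N' := by omega
  have hD2' : (D : ℝ) ≤ 2 * I * D' := by exact_mod_cast hD2
  have hN2' : (N : ℝ) ≤ 2 * N' := by exact_mod_cast hN2
  have hcDI : 2 * I * cD ≤ 1 := by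
    rw [hcD, ← mul_div_assoc, div_le_one hden]
    have e1 : 2 * (I : ℝ) * κ ≤ 2 * I := mul_le_of_le_one_right (by positivity) hκ1
    have e2 : (1 : ℝ) ≤ J * P * (k * ℓ) := by
      exact one_le_mul_of_one_le_of_one_le (one_le_mul_of_one_le_of_one_le hJ' hP1) hkl
    have e3 : (I : ℝ) ≤ (I : ℝ) ^ 2 := le_self_pow₀ hI' two_ne_zero
    have e4 : (I : ℝ) ^ 2 * 1 ≤ (I : ℝ) ^ 2 * (J * P * (k * ℓ)) := by gcongr
    linarith
  have hDr' : (D : ℝ) ≤ r := by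
    calc (D : ℝ) ≤ 2 * I * D' := hD2'
      _ ≤ 2 * I * (cD * r) := by gcongr
      _ = (2 * I * cD) * r := by ring
      _ ≤ 1 * r := by gcongr
      _ = r := one_mul _
  have hDr : D ≤ r := by exact_mod_cast hDr'
  set μ := S * J with hμ
  set Y : ℝ := (p : ℝ) ^ (k * S) with hY
  have hpk1 : 1 ≤ (p : ℝ) ^ k := one_le_pow₀ (by linarith)
  have hYexp : Y = Real.exp (k * S * ℓ) := by
    rw [hY, hℓ, ← Real.rpow_natCast, Real.rpow_def_of_pos hp0]; push_cast; ring_nf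
  have hY2 : (2 : ℝ) * I ≤ Y := by
    refine hk_a.trans ?_
    rw [hY]; apply pow_le_pow_right₀ (by linarith); exact Nat.le_mul_of_pos_right k hS1
  have hY1 : 1 < Y := by linarith [hY2, hI']
  -- the binomial bound
  have he1 : Real.exp 1 < 3 := by have := Real.exp_one_lt_d9; linarith
  have hCs : ∀ e : ℕ, e ≤ r * N + w * D → ∑ s ∈ range S, (e.choose s : ℝ) ≤ Y ^ 2 := by
    intro e he
    set Z : ℝ := (p : ℝ) ^ (2 * k) with hZ
    have hZ' : Z = (p : ℝ) ^ k * (p : ℝ) ^ k := by rw [hZ, two_mul, pow_add]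
    have hL : (e : ℝ) ≤ (2 + W) * r * N' := by
      have : (e : ℝ) ≤ r * N + w * D := by exact_mod_cast he
      have h1 : (r : ℝ) * N ≤ r * (2 * N') := by gcongr
      have h2 : (w : ℝ) * D ≤ (W * N') * r := by
        calc (w : ℝ) * D ≤ (W * h0) * r := by gcongr
          _ ≤ (W * N') * r := by gcongr
      linarith
    have hLS : Real.exp 1 * e ≤ S * Z := by
      have h1 : (r : ℝ) ≤ 2 * D' / cD := by rw [le_div_iff₀ hcD0]; linarith
      have h2 : (2 + W) * (2 / cD) * 3 ≤ Z := by
        have : (2 + W) * (2 / cD) * 3 = (48 * (2 + W) * J * I ^ 2 * ℓ / κ * k) * P := by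
          rw [hcD]; field_simp; ring
        rw [this, hZ']
        gcongr
      calc Real.exp 1 * e ≤ 3 * ((2 + W) * r * N') := by gcongr
        _ ≤ 3 * ((2 + W) * (2 * D' / cD) * N') := by gcongr
        _ = ((2 + W) * (2 / cD) * 3) * (D' * N') := by ring
        _ ≤ Z * (D' * N') := by gcongr
        _ = S * Z := by rw [hSr]; ring
    have hZ0 : 0 < Z := by positivity
    have hZ3 : 3 ≤ Z := by
      have : (2 : ℝ) ≤ (p : ℝ) ^ k := by linarith [hk_a, hI']
      rw [hZ']; exact le_trans (by norm_num) (mul_le_mul this this (by norm_num) (by positivity))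
    have hx0 : 0 < Real.exp 1 / Z := by positivity
    refine (binsum (Real.exp 1 / Z) hx0 ?_ e S).trans ?_
    · rw [div_le_one hZ0]; linarith
    · have h3 : (1 + Real.exp 1 / Z) ^ e ≤ Real.exp S := by
        calc (1 + Real.exp 1 / Z) ^ e ≤ (Real.exp (Real.exp 1 / Z)) ^ e := by
              gcongr; have := Real.add_one_le_exp (Real.exp 1 / Z); linarith
          _ = Real.exp (e * (Real.exp 1 / Z)) := by rw [Real.exp_nat_mul]
          _ ≤ Real.exp S := by
              apply Real.exp_le_exp.2
              rw [← mul_div_assoc, div_le_iff₀ hZ0]; linarith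
      calc (1 / (Real.exp 1 / Z)) ^ S * (1 + Real.exp 1 / Z) ^ e
          ≤ (1 / (Real.exp 1 / Z)) ^ S * Real.exp S := by gcongr
        _ = Z ^ S := by
            rw [one_div_div, div_pow, ← Real.exp_nat_mul, mul_one]
            field_simp
        _ = Y ^ 2 := by rw [hZ, hY, ← pow_mul, ← pow_mul]; congr 1; ring
        _ ≤ Y ^ 2 := le_refl _
  refine core φ α γ hα hγ hord h0 _ hHα hHγ I k μ P S D N r w (p ^ (k * S)) hI1
    (Nat.mul_pos hS1 hJ1) hS1 (Nat.pow_pos hp.1.pos) hP0 (dvd_refl _) hrw hrpos hDr ?_ ?_ (Y ^ 2) hCs ?_ ?_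
  · rw [hD, hN, hS]
    simp only [Nat.add_sub_cancel_left]
    apply le_of_eq; ring
  · calc (p ^ (k * μ)) ^ (μ + S) = (p ^ (k * S)) ^ (I * S) := by
          rw [← pow_mul, ← pow_mul, hμ, hI]; congr 1; ring
      _ < (p ^ (k * S) + 1) ^ (I * S) := by
          apply Nat.pow_lt_pow_left (Nat.lt_succ_self _)
          exact (Nat.mul_pos hI1 hS1).ne'
  · have hE : Real.exp h0 ^ (P * D * I) * Real.exp (cD / (8 * I * P) * r) ^ (P * N * I) ≤ Y := by
      rw [← Real.exp_nat_mul, ← Real.exp_nat_mul, ← Real.exp_add, hYexp]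
      apply Real.exp_le_exp.2
      push_cast
      have t1 : (P : ℝ) * D * I * h0 ≤ S / 2 := by
        calc (P : ℝ) * D * I * h0 ≤ P * (2 * I * D') * I * h0 := by gcongr
          _ = (4 * (I : ℝ) ^ 2 * P * h0) * D' / 2 := by ring
          _ ≤ N' * D' / 2 := by gcongr
          _ = S / 2 := by rw [hSr]; ring
      have t2 : (P : ℝ) * N * I * (cD / (8 * I * P) * r) ≤ S / 2 := by
        calc (P : ℝ) * N * I * (cD / (8 * I * P) * r) ≤ P * (2 * N') * I * (cD / (8 * I * P) * r) := by gcongr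
          _ = N' * (cD * r / 2) / 2 := by field_simp; ring
          _ ≤ N' * D' / 2 := by gcongr
          _ = S / 2 := by rw [hSr]; ring
      have t3 : (S : ℝ) * 1 ≤ S * (k * ℓ) := by gcongr
      linarith
    have hB : 2 * ((I : ℝ) * ((p ^ (k * S) : ℕ) : ℝ) * Y ^ 2 * Real.exp h0 ^ (P * D * I) *
        Real.exp (cD / (8 * I * P) * r) ^ (P * N * I)) ≤ Y ^ 5 := by
      have hXY : ((p ^ (k * S) : ℕ) : ℝ) = Y := by rw [hY]; push_cast; rfl
      rw [hXY]
      calc _ = (2 * (I : ℝ)) * Y ^ 3 * (Real.exp h0 ^ (P * D * I) * Real.exp (cD / (8 * I * P) * r) ^ (P * N * I)) := by ring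
        _ ≤ Y * Y ^ 3 * Y := by gcongr
        _ = Y ^ 5 := by ring
    calc _ ≤ (Y ^ 5) ^ d := by gcongr
      _ = Y ^ (5 * d) := by rw [pow_mul]
      _ < Y ^ (6 * d) := by apply pow_lt_pow_right₀ hY1; omega
      _ = (p : ℝ) ^ (k * μ) := by rw [hY, ← pow_mul, hμ, hJ]; congr 1; ring
  · refine hcon.trans ?_
    rw [zpow_neg, zpow_natCast, ← Real.exp_log (pow_pos hp0 (k * μ)), ← Real.exp_neg]
    apply Real.exp_le_exp.2
    rw [Real.log_pow, neg_le_neg_iff, ← hℓ, hμ]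
    push_cast
    calc (k : ℝ) * (S * J) * ℓ = k * J * ℓ * (D' * N') := by rw [hSr]; ring
      _ ≤ k * J * ℓ * ((cD * r) * (8 * (I : ℝ) ^ 2 * P * h0)) := by gcongr
      _ = κ * r * h0 := by rw [hcD]; field_simp
end Part5

section Part6
open Finset

section HtAPI
variable {K : Type*} [Field K]

lemma HtLE.mono {a : K} {h h' : ℝ} (H : HtLE a h) (hh : h ≤ h') : HtLE a h' := by
  obtain ⟨D, h0, h1, h2, h3⟩ := H
  have := Real.exp_le_exp.2 hh
  exact ⟨D, h0, h1.trans this, h2, fun σ => (h3 σ).trans this⟩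

lemma HtLE.mul {a b : K} {h h' : ℝ} (H : HtLE a h) (H' : HtLE b h') : HtLE (a * b) (h + h') := by
  obtain ⟨D, h0, h1, h2, h3⟩ := H
  obtain ⟨D', h0', h1', h2', h3'⟩ := H'
  have e : ((D * D' : ℕ) : K) * (a * b) = (D * a) * (D' * b) := by push_cast; ring
  refine ⟨D * D', Nat.mul_pos h0 h0', ?_, ?_, ?_⟩
  · rw [Real.exp_add]; push_cast; gcongr
  · rw [e]; exact h2.mul h2'
  · intro σ
    rw [e, map_mul, norm_mul, Real.exp_add]
    gcongr
    · exact h3 σ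
    · exact h3' σ

lemma HtLE.one : HtLE (1 : K) 0 :=
  ⟨1, one_pos, by simp, by simpa using isIntegral_one, by simp⟩

lemma HtLE.pow {a : K} {h : ℝ} (H : HtLE a h) (n : ℕ) : HtLE (a ^ n) (n * h) := by
  induction n with
  | zero => simpa using HtLE.one
  | succ n ih =>
    rw [pow_succ]
    have := ih.mul H
    convert this using 1
    push_cast; ring

lemma HtLE.zpow {a : K} {h : ℝ} (H : HtLE a h) (H' : HtLE a⁻¹ h) (n : ℤ) :
    HtLE (a ^ n) (|(n : ℝ)| * h) := by
  obtain ⟨m, rfl | rfl⟩ := n.eq_nat_or_neg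
  · simpa using H.pow m
  · have := H'.pow m
    simpa using this

lemma HtLE.prod {ι : Type*} (s : Finset ι) {a : ι → K} {h : ι → ℝ} (H : ∀ i ∈ s, HtLE (a i) (h i)) :
    HtLE (∏ i ∈ s, a i) (∑ i ∈ s, h i) := by
  classical
  induction s using Finset.induction_on with
  | empty => simpa using HtLE.one
  | insert i s hi ih =>
    rw [prod_insert hi, sum_insert hi]
    exact (H i (mem_insert_self _ _)).mul (ih fun j hj => H j (mem_insert_of_mem hj))

lemma HtLE.prod_zpow {ι : Type*} (s : Finset ι) {a : ι → K} {h T : ℝ} (hh : 0 ≤ h)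
    (H : ∀ i ∈ s, HtLE (a i) h ∧ HtLE (a i)⁻¹ h)
    (m : ι → ℤ) (hm : ∀ i ∈ s, |(m i : ℝ)| ≤ T) :
    HtLE (∏ i ∈ s, a i ^ m i) (s.card * (T * h)) := by
  have := HtLE.prod s (a := fun i => a i ^ m i) (h := fun _ => T * h) (fun i hi =>
    ((H i hi).1.zpow (H i hi).2 (m i)).mono (by gcongr; exact hm i hi))
  simpa using this

lemma HtLE.nonneg {a : K} {h : ℝ} (H : HtLE a h) : 0 ≤ h := by
  obtain ⟨D, h0, h1, -⟩ := H
  have : (1 : ℝ) ≤ D := by exact_mod_cast h0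
  rw [← Real.one_le_exp_iff]; linarith

lemma HtLE.ratio {a b : ℤ} (hb : b ≠ 0) {h : ℝ} (h1 : |(a : ℝ)| ≤ Real.exp h) (h2 : |(b : ℝ)| ≤ Real.exp h) :
    HtLE ((a : K) / (b : K)) h := by
  by_cases hbK : (b : K) = 0
  · rw [hbK, div_zero]
    refine ⟨1, one_pos, ?_, by simp [isIntegral_zero], fun σ => by simp [(Real.exp_pos _).le]⟩
    have : (1 : ℝ) ≤ |(b : ℝ)| := by
      have := Int.one_le_abs hb
      exact_mod_cast this
    push_cast; linarith
  have key : ∃ e : ℤ, |e| = |a| ∧ ((b.natAbs : ℕ) : K) * ((a : K) / (b : K)) = e := by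
    rcases Int.natAbs_eq b with h | h
    · refine ⟨a, rfl, ?_⟩
      have : ((b.natAbs : ℕ) : K) = (b : K) := by
        conv_rhs => rw [h]
        simp
      rw [this]; field_simp
    · refine ⟨-a, abs_neg a, ?_⟩
      have : ((b.natAbs : ℕ) : K) = -(b : K) := by
        conv_rhs => rw [h]
        simp
      rw [this]; push_cast; field_simp
  obtain ⟨e, he1, he2⟩ := key
  refine ⟨b.natAbs, Int.natAbs_pos.2 hb, ?_, ?_, ?_⟩
  · rw [Nat.cast_natAbs]; push_cast; exact h2
  · rw [he2]
    have := isIntegral_algebraMap (R := ℤ) (A := K) (x := e); simpa using this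
  · intro σ
    rw [he2, map_intCast, Complex.norm_intCast]
    have : |(e : ℝ)| = |(a : ℝ)| := by exact_mod_cast he1
    rw [this]; exact h1

lemma exists_HtLE [NumberField K] (a : K) : ∃ h : ℝ, 0 ≤ h ∧ HtLE a h := by
  have halg : IsAlgebraic ℤ a := by
    have := IsLocalization.isAlgebraic ℚ (nonZeroDivisors ℤ)
    have := Algebra.IsAlgebraic.trans ℤ ℚ K
    exact Algebra.IsAlgebraic.isAlgebraic a
  obtain ⟨y, hy, hintg⟩ := halg.exists_integral_multiple
  have hintg2 : IsIntegral ℤ (((y.natAbs : ℕ) : K) * a) := by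
    rw [zsmul_eq_mul] at hintg
    rcases Int.natAbs_eq y with h | h
    · rw [h] at hintg; simpa using hintg
    · rw [h] at hintg; simpa using hintg.neg
  set T : ℝ := y.natAbs + ∑ σ : K →+* ℂ, ‖σ (((y.natAbs : ℕ) : K) * a)‖ with hT
  have hs0 : 0 ≤ ∑ σ : K →+* ℂ, ‖σ (((y.natAbs : ℕ) : K) * a)‖ := sum_nonneg fun _ _ => norm_nonneg _
  have hy1 : (1 : ℝ) ≤ (y.natAbs : ℝ) := by exact_mod_cast Int.natAbs_pos.2 hy
  have hT1 : 1 ≤ T := by rw [hT]; linarith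
  have hlT : Real.exp (Real.log T) = T := Real.exp_log (by linarith)
  refine ⟨Real.log T, Real.log_nonneg hT1, y.natAbs, Int.natAbs_pos.2 hy, ?_, hintg2, fun σ => ?_⟩
  · rw [hlT, hT]; linarith
  · rw [hlT, hT]
    have := single_le_sum (f := fun σ : K →+* ℂ => ‖σ (((y.natAbs : ℕ) : K) * a)‖) (fun _ _ => norm_nonneg _) (mem_univ σ)
    linarith
end HtAPI

lemma dirichlet {ι : Type*} [Fintype ι] (η : ℝ) (hη : 0 < η) :
    ∃ Q : ℕ, 1 ≤ Q ∧ ∀ B : ℕ, 1 ≤ B → ∀ b : ι → ℤ, ∃ j : ℕ, 1 ≤ j ∧ j ≤ Q ∧ ∃ l t : ι → ℤ,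
      ∀ i, (j : ℤ) * b i = B * l i + t i ∧ |(t i : ℝ)| ≤ η * B := by
  classical
  set M := ⌈1 / η⌉₊ + 1 with hM
  have hMη : 1 / η ≤ M := (Nat.le_ceil _).trans (by push_cast [hM]; linarith)
  have hM0 : (0 : ℤ) < M := by simp [hM]
  have hMR : (0 : ℝ) < M := by exact_mod_cast hM0
  set Q := M ^ (Fintype.card ι) with hQ
  refine ⟨Q, Nat.pos_of_ne_zero (pow_ne_zero _ (by omega)), fun B hB b => ?_⟩
  have hB0 : (0 : ℤ) < B := by exact_mod_cast hB
  let F : Fin (Q + 1) → (ι → Fin M) := fun j i =>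
    ⟨((M * (((j : ℕ) : ℤ) * b i % B)) / B).toNat, by
      have h1 := Int.emod_nonneg (((j : ℕ) : ℤ) * b i) hB0.ne'
      have h2 := Int.emod_lt_of_pos (((j : ℕ) : ℤ) * b i) hB0
      have h3 : (M * (((j : ℕ) : ℤ) * b i % B)) / B < M := by
        rw [Int.ediv_lt_iff_lt_mul hB0]
        exact mul_lt_mul_of_pos_left h2 hM0
      have h4 : 0 ≤ (M * (((j : ℕ) : ℤ) * b i % B)) / B := by positivity
      omega⟩
  obtain ⟨j1, j2, hne, heq⟩ := Fintype.exists_ne_map_eq_of_card_lt F (by simp [hQ])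
  wlog hlt : (j1 : ℕ) < j2 generalizing j1 j2
  · exact this j2 j1 hne.symm heq.symm (by
      have : (j1 : ℕ) ≠ j2 := fun h => hne (Fin.ext h)
      omega)
  refine ⟨j2 - j1, by omega, by omega, fun i => ((j2 : ℕ) : ℤ) * b i / B - ((j1 : ℕ) : ℤ) * b i / B,
    fun i => ((j2 : ℕ) : ℤ) * b i % B - ((j1 : ℕ) : ℤ) * b i % B, fun i => ⟨?_, ?_⟩⟩
  · have e1 := Int.mul_ediv_add_emod (((j2 : ℕ) : ℤ) * b i) B
    have e2 := Int.mul_ediv_add_emod (((j1 : ℕ) : ℤ) * b i) B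
    push_cast [Nat.cast_sub hlt.le]
    linear_combination e2 - e1
  · have h0 := congrArg Fin.val (congrFun heq i)
    simp only [F] at h0
    set x := ((j1 : ℕ) : ℤ) * b i % B with hx
    set y := ((j2 : ℕ) : ℤ) * b i % B with hy
    have hx0 : 0 ≤ x := Int.emod_nonneg _ hB0.ne'
    have hy0 : 0 ≤ y := Int.emod_nonneg _ hB0.ne'
    have h1 : M * x / B = M * y / B := by
      have a1 : 0 ≤ M * x / B := by positivity
      have a2 : 0 ≤ M * y / B := by positivity
      omega
    have e1 := Int.mul_ediv_add_emod (M * x) B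
    have e2 := Int.mul_ediv_add_emod (M * y) B
    have f1 := Int.emod_nonneg (M * x) hB0.ne'
    have f2 := Int.emod_lt_of_pos (M * x) hB0
    have f3 := Int.emod_nonneg (M * y) hB0.ne'
    have f4 := Int.emod_lt_of_pos (M * y) hB0
    rw [h1] at e1
    have g1 : |M * (y - x)| ≤ B := by
      rw [abs_le]; constructor <;> linarith [mul_sub (M : ℤ) y x]
    have g2 : (M : ℝ) * |((y - x : ℤ) : ℝ)| ≤ B := by
      have : ((|(M : ℤ) * (y - x)| : ℤ) : ℝ) ≤ B := by exact_mod_cast g1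
      rw [abs_mul] at this
      push_cast at this ⊢
      simpa using this
    have g3 : |((y - x : ℤ) : ℝ)| ≤ B / M := by rw [le_div_iff₀ hMR]; linarith
    refine g3.trans ?_
    rw [div_le_iff₀ hMR]
    have : 1 ≤ η * M := by rw [div_le_iff₀ hη] at hMη; linarith
    have hBR : (0 : ℝ) ≤ B := by positivity
    nlinarith

/-- version with quotient and remainder -/
lemma dirichlet2 {ι : Type*} [Fintype ι] (η : ℝ) (hη : 0 < η) (hη1 : η ≤ 1) :
    ∃ Q : ℕ, 1 ≤ Q ∧ ∀ B : ℕ, 1 ≤ B → ∀ b : ι → ℤ, (∀ i, |b i| ≤ B) → ∃ j : ℕ, 1 ≤ j ∧ j ≤ Q ∧ 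
      ∃ l s : ι → ℤ, ∀ i, b i = (B / j : ℕ) * l i + s i ∧ |(l i : ℝ)| ≤ 2 * j ∧ |(s i : ℝ)| ≤ 2 * Q + η * (B / j) := by
  obtain ⟨Q, hQ, H⟩ := dirichlet (ι := ι) η hη
  refine ⟨Q, hQ, fun B hB b hb => ?_⟩
  obtain ⟨j, hj1, hjQ, l, t, hlt⟩ := H B hB b
  have hBR : (1 : ℝ) ≤ B := by exact_mod_cast hB
  have hjR : (1 : ℝ) ≤ j := by exact_mod_cast hj1
  have hjQR : (j : ℝ) ≤ Q := by exact_mod_cast hjQ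
  refine ⟨j, hj1, hjQ, l, fun i => b i - (B / j : ℕ) * l i, fun i => ?_⟩
  obtain ⟨h1, h2⟩ := hlt i
  have h1R : (j : ℝ) * b i = B * l i + t i := by exact_mod_cast h1
  have hbR : |(b i : ℝ)| ≤ B := by exact_mod_cast hb i
  have hl : |(l i : ℝ)| ≤ 2 * j := by
    have : (B : ℝ) * |(l i : ℝ)| ≤ B * (2 * j) := by
      have e : (B : ℝ) * l i = j * b i - t i := by linarith
      calc (B : ℝ) * |(l i : ℝ)| = |(B : ℝ) * l i| := by rw [abs_mul, Nat.abs_cast]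
        _ = |(j : ℝ) * b i - t i| := by rw [e]
        _ ≤ |(j : ℝ) * b i| + |(t i : ℝ)| := abs_sub _ _
        _ ≤ j * B + η * B := by rw [abs_mul, Nat.abs_cast]; gcongr
        _ ≤ j * B + 1 * B := by gcongr
        _ ≤ j * B + j * B := by gcongr
        _ = B * (2 * j) := by ring
    exact le_of_mul_le_mul_left this (by linarith)
  refine ⟨by ring, hl, ?_⟩
  have hdm := Nat.div_add_mod B j
  have hmod := Nat.mod_lt B (show 0 < j by omega)
  have hdmR : (j : ℝ) * ((B / j : ℕ) : ℝ) + ((B % j : ℕ) : ℝ) = B := by exact_mod_cast hdm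
  have hmodR : ((B % j : ℕ) : ℝ) ≤ j := by exact_mod_cast hmod.le
  push_cast
  have key : (j : ℝ) * |(b i : ℝ) - ((B / j : ℕ) : ℝ) * l i| ≤ j * (2 * Q + η * (B / j)) := by
    have e : (j : ℝ) * (b i - ((B / j : ℕ) : ℝ) * l i) = ((B % j : ℕ) : ℝ) * l i + t i := by
      rw [mul_sub, h1R, ← hdmR]; ring
    calc (j : ℝ) * |(b i : ℝ) - ((B / j : ℕ) : ℝ) * l i| = |((B % j : ℕ) : ℝ) * l i + t i| := by
          rw [← e, abs_mul, Nat.abs_cast]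
      _ ≤ |((B % j : ℕ) : ℝ) * l i| + |(t i : ℝ)| := abs_add_le _ _
      _ ≤ j * (2 * Q) + 1 * (η * B) := by
          rw [abs_mul, Nat.abs_cast, one_mul]
          have : |(l i : ℝ)| ≤ 2 * Q := hl.trans (by linarith)
          gcongr
      _ = _ := by field_simp
  exact le_of_mul_le_mul_left key (by linarith)
end Part6

section Part7
open Finset

/-- solution predicate with the larger term first -/
structure Sol (S : Finset ℕ) (x y z : ℤ) (n : ℕ) : Prop where
  hx : IsSUnit S x
  hy : IsSUnit S y
  hz : z ≠ 0
  hn : 2 ≤ n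
  hf : NthPowerFree n (Int.gcd x y)
  heq : x + y = z ^ n
  hle : |y| ≤ |x|

lemma sunit_prod (S : Finset ℕ) (m : ℕ) (hm : m ≠ 0) (h : ∀ p : ℕ, p.Prime → p ∣ m → p ∈ S) :
    m = ∏ p ∈ S, p ^ m.factorization p := by
  conv_lhs => rw [← Nat.prod_factorization_pow_eq_self hm]
  rw [Finsupp.prod]
  apply prod_subset
  · intro p hp
    rw [Nat.support_factorization, Nat.mem_primeFactors] at hp
    exact h p hp.1 hp.2.1
  · intro p _ hp
    rw [Finsupp.notMem_support_iff] at hp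
    rw [hp, pow_zero]

lemma odd_sunit {S : Finset ℕ} (h2 : 2 ∉ S) {x : ℤ} (hx : IsSUnit S x) : ¬ (2 : ℤ) ∣ x := by
  intro h; exact h2 (hx.2 2 Nat.prime_two (by exact_mod_cast h))

lemma lemmaP (S : Finset ℕ) (hS : ∀ p ∈ S, p.Prime) (h2 : 2 ∉ S) :
    ∃ c : ℝ, 0 < c ∧ ∀ x y z n, Sol S x y z n → ((n : ℝ) - 1) * Real.log 2 ≤ Real.log |(x : ℝ)| ∧
      ∃ p ∈ S, ∃ a : ℕ, (p : ℤ) ^ a ∣ x ∧ ¬ (p : ℤ) ∣ y ∧ ¬ (p : ℤ) ∣ z ∧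
        c * Real.log |(x : ℝ)| ≤ a * Real.log p := by
  set M := ∏ p ∈ S, p with hM
  have hM1 : 1 ≤ M := Nat.pos_of_ne_zero (prod_ne_zero_iff.2 fun p hp => (hS p hp).ne_zero)
  have hlM : 0 ≤ Real.log M := Real.log_nonneg (by exact_mod_cast hM1)
  have hl2 : 0 < Real.log 2 := Real.log_pos (by norm_num)
  set c : ℝ := 1 / ((S.card + 1) * (1 + 2 * Real.log M / Real.log 2)) with hc
  have hA : 0 < 1 + 2 * Real.log M / Real.log 2 := by positivity
  refine ⟨c, by positivity, ?_⟩
  intro x y z n hs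
  obtain ⟨hx, hy, hz, hn, hf, heq, hle⟩ := hs
  set g := Int.gcd x y with hg
  have hgpos : 0 < g := Int.gcd_pos_of_ne_zero_left _ hx.1
  obtain ⟨x', hx'⟩ : (g : ℤ) ∣ x := Int.gcd_dvd_left ..
  obtain ⟨y', hy'⟩ : (g : ℤ) ∣ y := Int.gcd_dvd_right ..
  have hx'0 : x' ≠ 0 := by rintro rfl; exact hx.1 (by simpa using hx')
  have hcop : Int.gcd x' y' = 1 := by
    have : Int.gcd x y = g * Int.gcd x' y' := by
      conv_lhs => rw [hx', hy']
      rw [Int.gcd_mul_left]; simp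
    rw [← hg] at this
    exact Nat.eq_of_mul_eq_mul_left hgpos (by omega)
  have hprim : ∀ q : ℕ, q.Prime → (q : ℤ) ∣ x' → (q : ℤ) ∣ y' → False := by
    intro q hq h1 h2
    have := Int.dvd_gcd h1 h2
    rw [hcop] at this
    exact hq.one_lt.ne' (Nat.dvd_one.1 this)
  -- 2 power
  have hgodd : ¬ (2 : ℤ) ∣ g := fun h => odd_sunit h2 hx (h.trans ⟨x', hx'⟩)
  have hz2 : (2 : ℤ) ∣ z := by
    have h1 := odd_sunit h2 hx
    have h3 := odd_sunit h2 hy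
    have : (2 : ℤ) ∣ z ^ n := by rw [← heq]; omega
    exact Int.prime_two.dvd_of_dvd_pow this
  have hsum : (g : ℤ) * (x' + y') = z ^ n := by rw [← heq, mul_add, ← hx', ← hy']
  have h2n : (2 : ℤ) ^ n ∣ x' + y' := by
    have h1 : (2 : ℤ) ^ n ∣ (g : ℤ) * (x' + y') := by rw [hsum]; exact pow_dvd_pow_of_dvd hz2 n
    have h3 : IsCoprime ((2 : ℤ) ^ n) (g : ℤ) :=
      IsCoprime.pow_left ((Int.prime_two.coprime_iff_not_dvd).2 hgodd)
    exact h3.dvd_of_dvd_mul_left h1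
  have hne : x' + y' ≠ 0 := by
    intro h; rw [h, mul_zero] at hsum; exact pow_ne_zero n hz hsum.symm
  have hle' : |y'| ≤ |x'| := by
    rw [hx', hy', abs_mul, abs_mul] at hle
    exact le_of_mul_le_mul_left hle (by simpa using hgpos)
  have hbig : (2 : ℤ) ^ (n - 1) ≤ |x'| := by
    have h1 : (2 : ℤ) ^ n ≤ |x' + y'| := Int.le_of_dvd (abs_pos.2 hne) ((dvd_abs _ _).2 h2n)
    have h3 := abs_add_le x' y'
    have h4 : (2 : ℤ) ^ n = 2 * 2 ^ (n - 1) := by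
      rw [← pow_succ']; congr 1; omega
    linarith
  set X := x'.natAbs with hX
  have hX0 : X ≠ 0 := Int.natAbs_ne_zero.2 hx'0
  have hXr : (X : ℝ) = |(x' : ℝ)| := by rw [hX, Nat.cast_natAbs]; push_cast; rfl
  have hbigR : (2 : ℝ) ^ (n - 1) ≤ X := by
    rw [hXr]; exact_mod_cast hbig
  have hXpos : (0 : ℝ) < X := by positivity
  have hlogX : ((n : ℝ) - 1) * Real.log 2 ≤ Real.log X := by
    have := Real.log_le_log (by positivity) hbigR
    rw [Real.log_pow, Nat.cast_sub (by omega)] at this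
    simpa using this
  have hxabs : |(x : ℝ)| = g * X := by
    rw [hXr, hx']; push_cast; rw [abs_mul, Nat.abs_cast]
  have hgR : (1 : ℝ) ≤ g := by exact_mod_cast hgpos
  have hlogx : Real.log |(x : ℝ)| = Real.log g + Real.log X := by
    rw [hxabs, Real.log_mul (by positivity) hXpos.ne']
  have hlogg0 : 0 ≤ Real.log g := Real.log_nonneg hgR
  refine ⟨by linarith, ?_⟩
  -- bound on g
  have hgfac : ∀ p : ℕ, g.factorization p ≤ n := by
    intro p
    by_cases hp : p.Prime
    · by_contra h
      push Not at h
      exact hf p hp ((pow_dvd_pow p h.le).trans (Nat.ordProj_dvd g p))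
    · simp [Nat.factorization_eq_zero_of_not_prime g hp]
  have hgle : g ≤ M ^ n := by
    rw [sunit_prod S g hgpos.ne' (fun p hp hpg => hx.2 p hp ((Int.natCast_dvd_natCast.2 hpg).trans ⟨x', hx'⟩)),
      hM, ← prod_pow]
    exact prod_le_prod' fun p hp => Nat.pow_le_pow_right (hS p hp).pos (hgfac p)
  have hlogg : Real.log g ≤ n * Real.log M := by
    rw [← Real.log_pow]; apply Real.log_le_log (by linarith); exact_mod_cast hgle
  have hnR : (2 : ℝ) ≤ n := by exact_mod_cast hn
  have htot : Real.log |(x : ℝ)| ≤ (1 + 2 * Real.log M / Real.log 2) * Real.log X := by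
    rw [hlogx]
    have h1 : (n : ℝ) * Real.log M ≤ 2 * Real.log M / Real.log 2 * Real.log X := by
      calc (n : ℝ) * Real.log M ≤ (2 * ((n : ℝ) - 1)) * Real.log M := by gcongr; linarith
        _ = 2 * Real.log M / Real.log 2 * (((n : ℝ) - 1) * Real.log 2) := by field_simp
        _ ≤ _ := by gcongr
    linarith
  -- primes dividing the quotient
  have hq : ∀ q : ℕ, q.Prime → q ∣ X → ¬ (q : ℤ) ∣ y := by
    intro q hq hqX hqy
    have hqx' : (q : ℤ) ∣ x' := Int.natCast_dvd.2 hqX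
    have hqy' : ¬ (q : ℤ) ∣ y' := fun h => hprim q hq hqx' h
    have hqg : q ∣ g := by
      rw [hy'] at hqy
      rcases (Nat.prime_iff_prime_int.1 hq).dvd_or_dvd hqy with h | h
      · exact Int.natCast_dvd_natCast.1 h
      · exact absurd h hqy'
    have hqs : ¬ q ∣ (x' + y').natAbs := by
      intro h
      have := Int.natCast_dvd.2 h
      exact hqy' ((Int.dvd_add_right hqx').1 this)
    have e1 : g * (x' + y').natAbs = z.natAbs ^ n := by
      have := congrArg Int.natAbs hsum
      rwa [Int.natAbs_mul, Int.natAbs_pow, Int.natAbs_natCast] at this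
    have e2 := congrArg (fun m => m.factorization q) e1
    rw [Nat.factorization_mul hgpos.ne' (Int.natAbs_ne_zero.2 hne), Nat.factorization_pow] at e2
    simp only [Finsupp.add_apply, Finsupp.smul_apply, smul_eq_mul, Nat.factorization_eq_zero_of_not_dvd hqs, add_zero] at e2
    have e3 : 0 < g.factorization q := hq.factorization_pos_of_dvd hgpos.ne' hqg
    have e4 : n ≤ g.factorization q := by
      rw [e2] at e3 ⊢
      exact Nat.le_mul_of_pos_right n (Nat.pos_of_mul_pos_left e3)
    exact hf q hq ((pow_dvd_pow q e4).trans (Nat.ordProj_dvd g q))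
  have hXS : ∀ p : ℕ, p.Prime → p ∣ X → p ∈ S := by
    intro p hp hpX
    apply hx.2 p hp
    rw [hx']
    exact (Int.natCast_dvd.2 hpX).mul_left _
  have hXprod := sunit_prod S X hX0 hXS
  have hX2 : 2 ≤ X := by
    have h1 : (2 : ℝ) ^ 1 ≤ 2 ^ (n - 1) := pow_le_pow_right₀ (by norm_num) (by omega)
    have : (2 : ℝ) ≤ X := by linarith
    exact_mod_cast this
  have hSne : S.Nonempty := by
    by_contra h
    rw [Finset.not_nonempty_iff_eq_empty] at h
    rw [h] at hXprod
    simp at hXprod; omega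
  obtain ⟨p, hpS, hmax⟩ := S.exists_max_image (fun p => p ^ X.factorization p) hSne
  have hXle : X ≤ (p ^ X.factorization p) ^ S.card := by
    conv_lhs => rw [hXprod]
    exact prod_le_pow_card _ _ _ hmax
  have hp := hS p hpS
  have hfp : X.factorization p ≠ 0 := by
    intro h; rw [h, pow_zero, one_pow] at hXle; omega
  have hpX : p ∣ X := Nat.dvd_of_factorization_pos hfp
  have hpx : (p : ℤ) ^ X.factorization p ∣ x := by
    rw [hx']
    apply Dvd.dvd.mul_left
    have := Int.natCast_dvd.2 (Nat.ordProj_dvd X p)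
    exact_mod_cast this
  refine ⟨p, hpS, X.factorization p, hpx, hq p hp hpX, ?_, ?_⟩
  · intro hpz
    apply hq p hp hpX
    have h1 : (p : ℤ) ∣ x := (dvd_pow_self _ hfp).trans hpx
    have h3 : (p : ℤ) ∣ x + y := by rw [heq]; exact dvd_pow hpz (by omega)
    exact (Int.dvd_add_right h1).1 h3
  · have h1 : Real.log X ≤ S.card * (X.factorization p * Real.log p) := by
      rw [← Real.log_pow, ← Real.log_pow]
      apply Real.log_le_log hXpos
      exact_mod_cast hXle
    have h3 : 0 ≤ X.factorization p * Real.log p :=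
      mul_nonneg (by positivity) (Real.log_nonneg (by exact_mod_cast hp.one_lt.le))
    have hS1 : (0:ℝ) < (S.card + 1) * (1 + 2 * Real.log M / Real.log 2) := mul_pos (Nat.cast_add_one_pos _) hA
    rw [hc, one_div_mul_eq_div, div_le_iff₀ hS1]
    calc _ ≤ (1 + 2 * Real.log M / Real.log 2) * Real.log X := htot
      _ ≤ (1 + 2 * Real.log M / Real.log 2) * ((S.card + 1) * (X.factorization p * Real.log p)) := by
          gcongr
          linarith
      _ = _ := by ring
end Part7

section Part8
open Finset

section AppB
variable {K : Type*} [Field K] [NumberField K] {p : ℕ} [hp : Fact p.Prime]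

lemma norm_prod_one {ι : Type*} [Fintype ι] (φ : K →+* ℚ_[p]) (a : ι → K) (ha : ∀ i, ‖φ (a i)‖ = 1)
    (l : ι → ℤ) : ‖φ (∏ i, a i ^ l i)‖ = 1 := by
  rw [map_prod, norm_prod]
  apply prod_eq_one
  intro i _
  rw [map_zpow₀, norm_zpow, ha, one_zpow]

/-- transfer of the key bound -/
lemma transfer (φ : K →+* ℚ_[p]) {X Y α γ E : K} {r w : ℕ} (hX : X = α ^ r * E) (hY : Y = γ ^ w * E)
    (hE : ‖φ E‖ = 1) : ‖φ X - φ Y‖ = ‖φ α ^ r - φ γ ^ w‖ := by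
  rw [hX, hY, ← map_sub, ← sub_mul, map_mul, norm_mul, hE, mul_one, map_sub, map_pow, map_pow]

lemma transfer_ord {X Y α γ E : K} {r w : ℕ} (hX : X = α ^ r * E) (hY : Y = γ ^ w * E)
    (h : ∀ k : ℕ, 0 < k → X ^ k ≠ Y ^ k) :
    (∀ n : ℕ, 0 < n → α ^ n ≠ 1) ∨ (∀ n : ℕ, 0 < n → γ ^ n ≠ 1) := by
  by_contra hc
  push Not at hc
  obtain ⟨⟨u, hu, hu1⟩, ⟨v, hv, hv1⟩⟩ := hc
  apply h (u * v) (Nat.mul_pos hu hv)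
  rw [hX, hY, mul_pow, mul_pow]
  congr 1
  calc (α ^ r) ^ (u * v) = (α ^ u) ^ (r * v) := by ring
    _ = (γ ^ v) ^ (w * u) := by rw [hu1, hv1]; simp
    _ = _ := by ring

lemma regime1 {ι : Type*} [Fintype ι] (φ : K →+* ℚ_[p]) (a : ι → K) (ha0 : ∀ i, a i ≠ 0)
    (ha : ∀ i, ‖φ (a i)‖ = 1) (L : ℝ) (hL : 0 ≤ L) (haL : ∀ i, HtLE (a i) L ∧ HtLE (a i)⁻¹ L)
    (c' : ℝ) (hc' : 0 < c') :
    ∃ c1 : ℝ, 0 < c1 ∧ ∃ N0 : ℕ, ∀ n, N0 ≤ n → ∀ h : ℝ, 1 ≤ h → h ≤ c1 * n → ∀ A : K, A ≠ 0 → ‖φ A‖ = 1 →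
      HtLE A h → HtLE A⁻¹ h → ∀ c : ι → ℤ, (∀ i, |c i| ≤ n) →
      (∀ k : ℕ, 0 < k → (A ^ n) ^ k ≠ (∏ i, a i ^ c i) ^ k) →
      Real.exp (-(c' * n * h)) < ‖φ (A ^ n) - φ (∏ i, a i ^ c i)‖ := by
  set m : ℝ := (Fintype.card ι : ℝ) with hm
  have hm0 : 0 ≤ m := by positivity
  set C : ℝ := 1 + 2 * m * L with hC
  have hC1 : 1 ≤ C := by have : 0 ≤ 2 * m * L := by positivity
                         linarith
  set κ : ℝ := min 1 (c' / C) with hκ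
  have hκ0 : 0 < κ := lt_min one_pos (by positivity)
  have hκC : κ * C ≤ c' := by
    have : κ ≤ c' / C := min_le_right _ _
    rwa [le_div_iff₀ (by linarith)] at this
  obtain ⟨ε, hε, r0, H⟩ := key φ κ 1 hκ0 (min_le_left _ _) le_rfl
  set η : ℝ := min 1 (ε / (6 * (m * L + 1))) with hη
  have hmL : 0 ≤ m * L := by positivity
  have hη0 : 0 < η := lt_min one_pos (by positivity)
  have hηε : η * (m * L) ≤ ε / 6 := by
    have h1 : η ≤ ε / (6 * (m * L + 1)) := min_le_right _ _
    rw [le_div_iff₀ (by positivity)] at h1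
    nlinarith
  obtain ⟨Q, hQ, HD⟩ := dirichlet2 (ι := ι) η hη0 (min_le_left _ _)
  have hQR : (1 : ℝ) ≤ Q := by exact_mod_cast hQ
  refine ⟨ε / (6 * Q ^ 2), by positivity, 2 * Q + Q * r0 + ⌈12 * Q ^ 2 * (m * L) / ε⌉₊, ?_⟩
  intro n hn h hh hhc A hA0 hA hA1 hA2 c hc hnt
  have hnR : ((2 * Q + Q * r0 + ⌈12 * Q ^ 2 * (m * L) / ε⌉₊ : ℕ) : ℝ) ≤ n := by exact_mod_cast hn
  push_cast at hnR
  have hceil := Nat.le_ceil (12 * Q ^ 2 * (m * L) / ε)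
  have hn1 : 1 ≤ n := by
    have : 2 * Q ≤ n := by omega
    omega
  obtain ⟨j, hj1, hjQ, l, s, hls⟩ := HD n hn1 c hc
  have hjR : (1 : ℝ) ≤ j := by exact_mod_cast hj1
  have hjQR : (j : ℝ) ≤ Q := by exact_mod_cast hjQ
  set r := n / j with hr
  set s0 := n % j with hs0
  have hdm : j * r + s0 = n := Nat.div_add_mod n j
  have hmod : s0 < j := Nat.mod_lt n hj1
  have hdmR : (j : ℝ) * r + s0 = n := by exact_mod_cast hdm
  have hmodR : (s0 : ℝ) ≤ j := by exact_mod_cast hmod.le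
  have hrn : (n : ℝ) / j ≤ 2 * r := by
    rw [div_le_iff₀ (by linarith)]
    have : (j : ℝ) ≤ j * r := by
      have : j ≤ j * r := by
        have : 0 < r := Nat.div_pos (by omega) hj1
        exact Nat.le_mul_of_pos_right j this
      exact_mod_cast this
    nlinarith
  have hrQ : (n : ℝ) ≤ 2 * Q * r := by
    rw [div_le_iff₀ (by linarith)] at hrn
    nlinarith [(Nat.cast_nonneg r : (0 : ℝ) ≤ r)]
  have hr0 : r0 ≤ r := by
    rw [hr, Nat.le_div_iff_mul_le hj1]
    have : r0 * j ≤ Q * r0 := by rw [mul_comm]; exact Nat.mul_le_mul_right _ hjQ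
    omega
  set P := ∏ i, a i ^ l i with hP
  have hP0 : P ≠ 0 := prod_ne_zero_iff.2 fun i _ => zpow_ne_zero _ (ha0 i)
  have hPn : ‖φ P‖ = 1 := norm_prod_one φ a ha l
  set α := A ^ j * ∏ i, a i ^ (-l i) with hα
  set γ := A⁻¹ ^ s0 * ∏ i, a i ^ (s i) with hγ
  have hαP : α * P = A ^ j := by
    rw [hα, hP, mul_assoc, ← prod_mul_distrib]
    rw [prod_eq_one (fun i _ => by rw [← zpow_add₀ (ha0 i)]; simp), mul_one]
  have hαn : ‖φ α‖ = 1 := by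
    rw [hα, map_mul, norm_mul, norm_prod_one φ a ha, map_pow, norm_pow, hA]; simp
  have hγn : ‖φ γ‖ = 1 := by
    rw [hγ, map_mul, norm_mul, norm_prod_one φ a ha, map_pow, norm_pow, map_inv₀, norm_inv, hA]; simp
  have hX : A ^ n = α ^ r * (A ^ s0 * P ^ r) := by
    rw [← hdm, pow_add, pow_mul, ← hαP]; ring
  have hY : ∏ i, a i ^ c i = γ ^ 1 * (A ^ s0 * P ^ r) := by
    rw [hγ, hP, pow_one, ← prod_pow]
    have : A⁻¹ ^ s0 * (∏ i, a i ^ s i) * (A ^ s0 * ∏ i, (a i ^ l i) ^ r) =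
      (∏ i, a i ^ s i) * ∏ i, (a i ^ l i) ^ r := by
      rw [inv_pow]; field_simp
    rw [this, ← prod_mul_distrib]
    refine prod_congr rfl fun i _ => ?_
    rw [← zpow_natCast, ← zpow_mul, ← zpow_add₀ (ha0 i), (hls i).1]
    congr 1; ring
  have hE : ‖φ (A ^ s0 * P ^ r)‖ = 1 := by
    rw [map_mul, norm_mul, map_pow, map_pow, norm_pow, norm_pow, hA, hPn]; simp
  rw [transfer φ hX hY hE]
  have hord := transfer_ord hX hY hnt
  have hh0 : 1 ≤ C * j * h := by
    have : 1 ≤ C * j := one_le_mul_of_one_le_of_one_le hC1 hjR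
    exact one_le_mul_of_one_le_of_one_le this hh
  have hHα : HtLE α (C * j * h) := by
    refine ((hA1.pow j).mul (HtLE.prod_zpow univ (T := 2 * j) hL (fun i _ => haL i) (fun i => - l i) ?_)).mono ?_
    · intro i _
      push_cast; rw [abs_neg]; exact (hls i).2.1
    · rw [card_univ, ← hm, hC]
      have : m * (2 * j * L) * 1 ≤ m * (2 * j * L) * h := by gcongr
      linarith
  have hHγ : HtLE γ (ε * r) := by
    refine ((hA2.pow s0).mul (HtLE.prod_zpow univ (T := 2 * Q + η * (n / j)) hL (fun i _ => haL i) s ?_)).mono ?_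
    · intro i _
      exact (hls i).2.2
    · rw [card_univ, ← hm]
      have e1 : (s0 : ℝ) * h ≤ ε / 3 * r := by
        calc (s0 : ℝ) * h ≤ Q * (ε / (6 * Q ^ 2) * (2 * Q * r)) := by
              have : h ≤ ε / (6 * Q ^ 2) * (2 * Q * r) := hhc.trans (by gcongr)
              have h0 : 0 ≤ h := by linarith
              gcongr
              linarith
          _ = _ := by field_simp; ring
      have e2 : m * (2 * Q * L) ≤ ε / 3 * r := by
        have : 12 * Q ^ 2 * (m * L) / ε ≤ 2 * Q * r := by
          have : (0 : ℝ) ≤ 2 * Q + Q * r0 := by positivity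
          linarith
        rw [div_le_iff₀ hε] at this
        have h2 : 2 * (Q : ℝ) * (6 * Q * (m * L)) ≤ 2 * Q * (r * ε) := by linarith
        have := le_of_mul_le_mul_left h2 (by positivity)
        linarith
      have e3 : m * (η * (n / j) * L) ≤ ε / 3 * r := by
        calc m * (η * (n / j) * L) = η * (m * L) * (n / j) := by ring
          _ ≤ ε / 6 * (2 * r) := by gcongr
          _ = _ := by ring
      have : m * ((2 * Q + η * (n / j)) * L) = m * (2 * Q * L) + m * (η * (n / j) * L) := by ring
      linarith
  have := H r hr0 1 (Nat.coprime_one_right r) (C * j * h) hh0 (by simpa using hh0) α γ hαn hγn hHα hHγ hord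
  refine lt_of_le_of_lt ?_ this
  apply Real.exp_le_exp.2
  have h0 : 0 ≤ h := by linarith
  have e : (j : ℝ) * r ≤ n := by linarith [(Nat.cast_nonneg s0 : (0 : ℝ) ≤ s0)]
  have : κ * r * (C * j * h) ≤ c' * n * h := by
    calc κ * r * (C * j * h) = (κ * C) * (j * r) * h := by ring
      _ ≤ c' * n * h := by gcongr
  linarith

lemma regime2 {ι : Type*} [Fintype ι] (φ : K →+* ℚ_[p]) (a : ι → K) (ha0 : ∀ i, a i ≠ 0)
    (ha : ∀ i, ‖φ (a i)‖ = 1) (L : ℝ) (hL : 0 ≤ L) (haL : ∀ i, HtLE (a i) L ∧ HtLE (a i)⁻¹ L)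
    (c' : ℝ) (hc' : 0 < c') (c1 : ℝ) (hc1 : 0 < c1) :
    ∃ N0 : ℕ, ∀ n, N0 ≤ n → ∀ h : ℝ, 1 ≤ h → c1 * n ≤ h → ∀ A : K, A ≠ 0 → ‖φ A‖ = 1 →
      HtLE A h → HtLE A⁻¹ h → ∀ c : ι → ℤ, (∀ i, |c i| ≤ n) →
      (∀ k : ℕ, 0 < k → (A ^ n) ^ k ≠ (∏ i, a i ^ c i) ^ k) →
      Real.exp (-(c' * n * h)) < ‖φ (A ^ n) - φ (∏ i, a i ^ c i)‖ := by
  set m : ℝ := (Fintype.card ι : ℝ) with hm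
  have hm0 : 0 ≤ m := by positivity
  have hmL : 0 ≤ m * L := by positivity
  set C : ℝ := 1 + m * L * (1 + 1 / c1) with hC
  have hC1 : 1 ≤ C := by have : 0 ≤ m * L * (1 + 1 / c1) := by positivity
                         linarith
  set κ : ℝ := min 1 (c' / C) with hκ
  have hκ0 : 0 < κ := lt_min one_pos (by positivity)
  have hκC : κ * C ≤ c' := by
    have : κ ≤ c' / C := min_le_right _ _
    rwa [le_div_iff₀ (by linarith)] at this
  obtain ⟨ε, hε, r0, H⟩ := key φ κ (1 + 1 / c1) hκ0 (min_le_left _ _) (by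
    have : 0 < 1 / c1 := by positivity
    linarith)
  set η : ℝ := min 1 (ε / (m * L + 1)) with hη
  have hη0 : 0 < η := lt_min one_pos (by positivity)
  have hη1 : η ≤ 1 := min_le_left _ _
  have hηε : η * (m * L) ≤ ε := by
    have h1 : η ≤ ε / (m * L + 1) := min_le_right _ _
    rw [le_div_iff₀ (by positivity)] at h1
    nlinarith
  obtain ⟨Q, hQ, HD⟩ := dirichlet (ι := ι) η hη0
  refine ⟨Q * (r0 + 2), ?_⟩
  intro n hn h hh hhc A hA0 hA hA1 hA2 c hc hnt
  have hn1 : 1 ≤ n := by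
    have : 0 < Q * (r0 + 2) := Nat.mul_pos hQ (by omega)
    omega
  obtain ⟨q, hq1, hqQ, l, t, hlt⟩ := HD n hn1 c
  set g := Nat.gcd q n with hg
  have hgpos : 0 < g := Nat.gcd_pos_of_pos_left _ hq1
  have hgQ : g ≤ Q := (Nat.gcd_le_left n hq1).trans hqQ
  obtain ⟨q', hq'⟩ : g ∣ q := Nat.gcd_dvd_left ..
  obtain ⟨r, hr⟩ : g ∣ n := Nat.gcd_dvd_right ..
  have hcop : Nat.Coprime q' r := by
    have : g * Nat.gcd q' r = g * 1 := by
      rw [← Nat.gcd_mul_left, ← hq', ← hr, mul_one]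
    exact Nat.eq_of_mul_eq_mul_left hgpos this
  have hrr0 : r0 + 2 ≤ r := by
    have : Q * (r0 + 2) ≤ Q * r := hn.trans (by rw [hr]; exact Nat.mul_le_mul_right _ hgQ)
    exact Nat.le_of_mul_le_mul_left this hQ
  obtain ⟨w, hwr, hw⟩ := Nat.exists_mul_mod_eq_one_of_coprime hcop (by omega)
  have hwcop : Nat.Coprime r w := by
    have h1 : q' * w ≡ 1 [MOD r] := by
      rw [Nat.ModEq, hw, Nat.mod_eq_of_lt (by omega)]
    have h2 : Nat.gcd (q' * w) r = 1 := by rw [h1.gcd_eq, Nat.gcd_one_left]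
    have : Nat.Coprime (q' * w) r := h2
    exact (Nat.Coprime.coprime_mul_left this).symm
  obtain ⟨k, hk⟩ : ∃ k : ℤ, (q' : ℤ) * w = 1 + r * k := by
    refine ⟨((q' * w / r : ℕ) : ℤ), ?_⟩
    have := Nat.mod_add_div (q' * w) r
    rw [hw] at this
    exact_mod_cast this.symm
  have hμ : ∀ i, ∃ μ : ℤ, t i = g * μ := by
    intro i
    refine ⟨q' * c i - r * l i, ?_⟩
    have := (hlt i).1
    rw [hq', hr] at this
    push_cast at this
    linear_combination -this
  choose μ hμ using hμ
  have hgR : (1 : ℝ) ≤ g := by exact_mod_cast hgpos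
  have hnR : (n : ℝ) = g * r := by exact_mod_cast hr
  have hrR : (2 : ℝ) ≤ r := by
    have : 2 ≤ r := by omega
    exact_mod_cast this
  have hμb : ∀ i, |(μ i : ℝ)| ≤ η * r := by
    intro i
    have h1 := (hlt i).2
    have h2 : (t i : ℝ) = g * μ i := by exact_mod_cast hμ i
    rw [h2, abs_mul, Nat.abs_cast, hnR] at h1
    have : (g : ℝ) * |(μ i : ℝ)| ≤ g * (η * r) := by linarith
    exact le_of_mul_le_mul_left this (by linarith)
  have hd : ∀ i, ∃ d : ℤ, c i = w * μ i + r * d := by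
    intro i
    have h1 : (q' : ℤ) * c i = r * l i + μ i := by
      have := (hlt i).1
      rw [hq', hr, hμ] at this
      push_cast at this
      have h2 : (g : ℤ) * (q' * c i) = g * (r * l i + μ i) := by linear_combination this
      exact mul_left_cancel₀ (by exact_mod_cast hgpos.ne') h2
    refine ⟨w * l i - k * c i, ?_⟩
    linear_combination w * h1 - c i * hk
  choose d hd using hd
  have hwrR : (w : ℝ) ≤ r := by exact_mod_cast hwr.le
  have hdb : ∀ i, |(d i : ℝ)| ≤ g + η * r := by
    intro i
    have h1 : (c i : ℝ) = w * μ i + r * d i := by exact_mod_cast hd i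
    have h2 : |(c i : ℝ)| ≤ n := by exact_mod_cast hc i
    have h3 : (r : ℝ) * |(d i : ℝ)| ≤ r * (g + η * r) := by
      calc (r : ℝ) * |(d i : ℝ)| = |(r : ℝ) * d i| := by rw [abs_mul, Nat.abs_cast]
        _ = |(c i : ℝ) - w * μ i| := by rw [h1]; ring_nf
        _ ≤ |(c i : ℝ)| + |(w : ℝ) * μ i| := abs_sub _ _
        _ ≤ g * r + r * (η * r) := by
            rw [abs_mul, Nat.abs_cast, ← hnR]
            have := hμb i
            gcongr
        _ = _ := by ring
    exact le_of_mul_le_mul_left h3 (by linarith)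
  set P := ∏ i, a i ^ d i with hP
  have hP0 : P ≠ 0 := prod_ne_zero_iff.2 fun i _ => zpow_ne_zero _ (ha0 i)
  have hPn : ‖φ P‖ = 1 := norm_prod_one φ a ha d
  set α := A ^ g * ∏ i, a i ^ (-d i) with hα
  set γ := ∏ i, a i ^ (μ i) with hγ
  have hαP : α * P = A ^ g := by
    rw [hα, hP, mul_assoc, ← prod_mul_distrib]
    rw [prod_eq_one (fun i _ => by rw [← zpow_add₀ (ha0 i)]; simp), mul_one]
  have hαn : ‖φ α‖ = 1 := by
    rw [hα, map_mul, norm_mul, norm_prod_one φ a ha, map_pow, norm_pow, hA]; simp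
  have hγn : ‖φ γ‖ = 1 := norm_prod_one φ a ha μ
  have hX : A ^ n = α ^ r * P ^ r := by
    rw [← mul_pow, hαP, ← pow_mul, ← hr]
  have hY : ∏ i, a i ^ c i = γ ^ w * P ^ r := by
    rw [hγ, hP, ← prod_pow, ← prod_pow, ← prod_mul_distrib]
    refine prod_congr rfl fun i _ => ?_
    rw [← zpow_natCast, ← zpow_mul, ← zpow_natCast, ← zpow_mul, ← zpow_add₀ (ha0 i), hd i]
    congr 1; ring
  have hE : ‖φ (P ^ r)‖ = 1 := by
    rw [map_pow, norm_pow, hPn]; simp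
  rw [transfer φ hX hY hE]
  have hord := transfer_ord hX hY hnt
  have h0 : 0 ≤ h := by linarith
  have hnh : (n : ℝ) ≤ h / c1 := by rw [le_div_iff₀ hc1]; linarith
  have hgh : h ≤ g * h := le_mul_of_one_le_left h0 hgR
  have hh0 : g * h ≤ C * g * h := by
    rw [mul_assoc]; exact le_mul_of_one_le_left (by positivity) hC1
  have hrn : (r : ℝ) ≤ n := by rw [hnR]; exact le_mul_of_one_le_left (by linarith) hgR
  have hHα : HtLE α (C * g * h) := by
    refine ((hA1.pow g).mul (HtLE.prod_zpow univ (T := g + η * r) hL (fun i _ => haL i) (fun i => - d i) ?_)).mono ?_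
    · intro i _
      push_cast; rw [abs_neg]; exact hdb i
    · rw [card_univ, ← hm, hC]
      have e1 : (g : ℝ) + η * r ≤ (1 + 1 / c1) * (g * h) := by
        have e2 : (g : ℝ) ≤ g * h := le_mul_of_one_le_right (by linarith) hh
        have e3 : η * r ≤ 1 / c1 * (g * h) := by
          calc η * r ≤ 1 * (h / c1) := by gcongr; linarith
            _ = 1 / c1 * h := by ring
            _ ≤ _ := by gcongr
        linarith
      calc g * h + m * ((g + η * r) * L) = g * h + m * L * (g + η * r) := by ring
        _ ≤ g * h + m * L * ((1 + 1 / c1) * (g * h)) := by gcongr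
        _ = _ := by ring
  have hHγ : HtLE γ (ε * r) := by
    refine (HtLE.prod_zpow univ (T := η * r) hL (fun i _ => haL i) μ (fun i _ => hμb i)).mono ?_
    rw [card_univ, ← hm]
    calc m * (η * r * L) = η * (m * L) * r := by ring
      _ ≤ _ := by gcongr
  have hwW : (w : ℝ) ≤ (1 + 1 / c1) * (C * g * h) := by
    have e1 : (w : ℝ) ≤ 1 / c1 * h := by
      have : h / c1 = 1 / c1 * h := by ring
      linarith
    calc (w : ℝ) ≤ 1 / c1 * h := e1
      _ ≤ 1 / c1 * (C * g * h) := by gcongr; linarith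
      _ ≤ _ := by
        have : 0 ≤ C * g * h := by linarith
        nlinarith
  have := H r (by omega) w hwcop (C * g * h) (by linarith) hwW α γ hαn hγn hHα hHγ hord
  refine lt_of_le_of_lt ?_ this
  apply Real.exp_le_exp.2
  have : κ * r * (C * g * h) ≤ c' * n * h := by
    calc κ * r * (C * g * h) = (κ * C) * (g * r) * h := by ring
      _ ≤ c' * n * h := by rw [hnR]; gcongr
  linarith

/-- combined lower bound -/
theorem lowerB {ι : Type*} [Fintype ι] (φ : K →+* ℚ_[p]) (a : ι → K) (ha0 : ∀ i, a i ≠ 0)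
    (ha : ∀ i, ‖φ (a i)‖ = 1) (c' : ℝ) (hc' : 0 < c') :
    ∃ N0 : ℕ, ∀ n, N0 ≤ n → ∀ h : ℝ, 1 ≤ h → ∀ A : K, A ≠ 0 → ‖φ A‖ = 1 →
      HtLE A h → HtLE A⁻¹ h → ∀ c : ι → ℤ, (∀ i, |c i| ≤ n) →
      (∀ k : ℕ, 0 < k → (A ^ n) ^ k ≠ (∏ i, a i ^ c i) ^ k) →
      Real.exp (-(c' * n * h)) < ‖φ (A ^ n) - φ (∏ i, a i ^ c i)‖ := by
  choose h1 h1n h1H using fun i => exists_HtLE (a i)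
  choose h2 h2n h2H using fun i => exists_HtLE (a i)⁻¹
  set L : ℝ := ∑ i, (h1 i + h2 i) with hL
  have hs : ∀ i, h1 i + h2 i ≤ L := fun i =>
    single_le_sum (f := fun i => h1 i + h2 i) (fun j _ => add_nonneg (h1n j) (h2n j)) (mem_univ i)
  have hL0 : 0 ≤ L := sum_nonneg fun j _ => add_nonneg (h1n j) (h2n j)
  have haL : ∀ i, HtLE (a i) L ∧ HtLE (a i)⁻¹ L := fun i =>
    ⟨(h1H i).mono (by linarith [hs i, h2n i]), (h2H i).mono (by linarith [hs i, h1n i])⟩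
  obtain ⟨c1, hc1, N1, H1⟩ := regime1 φ a ha0 ha L hL0 haL c' hc'
  obtain ⟨N2, H2⟩ := regime2 φ a ha0 ha L hL0 haL c' hc' c1 hc1
  refine ⟨max N1 N2, fun n hn h hh A hA0 hA hA1 hA2 c hc hnt => ?_⟩
  rcases le_total h (c1 * n) with h' | h'
  · exact H1 n (le_of_max_le_left hn) h hh h' A hA0 hA hA1 hA2 c hc hnt
  · exact H2 n (le_of_max_le_right hn) h hh h' A hA0 hA hA1 hA2 c hc hnt
end AppB
end Part8

section Part9
open Finset

lemma boundP (S : Finset ℕ) (hS : ∀ q ∈ S, q.Prime) (h2 : 2 ∉ S) (p : ℕ) [hp : Fact p.Prime]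
    (c : ℝ) (hc : 0 < c) : ∃ N : ℕ, ∀ x y z n (a : ℕ), Sol S x y z n → (p : ℤ) ^ a ∣ x → ¬ (p : ℤ) ∣ y →
      ¬ (p : ℤ) ∣ z → c * Real.log |(x : ℝ)| ≤ a * Real.log p → ((n : ℝ) - 1) * Real.log 2 ≤ Real.log |(x : ℝ)| →
      n < N := by
  classical
  have hpp := hp.out
  set φ : ℚ →+* ℚ_[p] := algebraMap ℚ ℚ_[p] with hφ
  have hunit : ∀ q : ℕ, ¬ p ∣ q → ‖φ (q : ℚ)‖ = 1 := by
    intro q hq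
    rw [map_natCast, Padic.norm_natCast_eq_one_iff]
    exact (hpp.coprime_iff_not_dvd).2 hq
  have hunitZ : ∀ q : ℤ, ¬ (p : ℤ) ∣ q → ‖φ (q : ℚ)‖ = 1 := by
    intro q hq
    rw [map_intCast, Padic.norm_intCast_eq_one_iff]
    exact ((Nat.prime_iff_prime_int.1 hpp).coprime_iff_not_dvd.2 hq).symm
  have hqS : ∀ i : ↥(S.erase p), ¬ p ∣ (i : ℕ) := by
    intro i h
    have hi := mem_erase.1 i.2
    exact hi.1 ((Nat.prime_dvd_prime_iff_eq hpp (hS _ hi.2)).1 h).symm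
  have hpos : ∀ i : ↥(S.erase p), 0 < (i : ℕ) := fun i => (hS _ (mem_erase.1 i.2).2).pos
  have hposQ : ∀ i : ↥(S.erase p), (0 : ℚ) < ((i : ℕ) : ℚ) := fun i => by exact_mod_cast hpos i
  obtain ⟨N, HN⟩ := lowerB φ (fun i : ↥(S.erase p) => ((i : ℕ) : ℚ) ^ 2)
    (fun i => pow_ne_zero _ (hposQ i).ne')
    (fun i => by rw [map_pow, norm_pow, hunit _ (hqS i), one_pow]) (c / 8) (by positivity)
  refine ⟨N, fun x y z n a hs hpx hpy hpz hcl hnl => ?_⟩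
  by_contra hnN
  push Not at hnN
  have hn2 : 2 ≤ n := hs.hn
  have hnR : (2 : ℝ) ≤ n := by exact_mod_cast hn2
  have hx0 := hs.hx.1
  have hy0 := hs.hy.1
  have hxR : (0 : ℝ) < |(x : ℝ)| := abs_pos.2 (by exact_mod_cast hx0)
  have hyx : |(y : ℝ)| ≤ |(x : ℝ)| := by exact_mod_cast hs.hle
  have hl2 : 0 < Real.log 2 := Real.log_pos (by norm_num)
  have hl2' : (0.6931471803 : ℝ) < Real.log 2 := Real.log_two_gt_d9
  set H := Real.log |(x : ℝ)| with hH
  have hH1 : Real.log 2 ≤ H := by nlinarith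
  have hHn : n * Real.log 2 ≤ 2 * H := by nlinarith
  have hxe : |(x : ℝ)| = Real.exp H := (Real.exp_log hxR).symm
  set h : ℝ := 8 * H / n with hh
  have hh1 : 1 ≤ h := by
    rw [hh, le_div_iff₀ (by linarith)]
    nlinarith
  set Y := y.natAbs with hY
  have hY0 : Y ≠ 0 := Int.natAbs_ne_zero.2 hy0
  have hYS := sunit_prod S Y hY0 (fun q hq hqY => hs.hy.2 q hq (Int.natCast_dvd.2 hqY))
  have hfp : Y.factorization p = 0 := Nat.factorization_eq_zero_of_not_dvd
    (fun h => hpy (Int.natCast_dvd.2 h))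
  set f := Y.factorization with hf
  have hYprod : Y = ∏ i : ↥(S.erase p), (i : ℕ) ^ f i := by
    rw [Finset.prod_coe_sort (S.erase p) (fun q => q ^ f q), Finset.prod_erase _ (by rw [hfp, pow_zero])]
    exact hYS
  set v : ℕ := ∏ i : ↥(S.erase p), (i : ℕ) ^ (f i / n) with hv
  set G : ℕ := ∏ i : ↥(S.erase p), (i : ℕ) ^ (f i % n) with hG
  have hYvG : Y = v ^ n * G := by
    rw [hYprod, hv, hG, ← prod_pow, ← prod_mul_distrib]
    refine prod_congr rfl fun i _ => ?_
    rw [← pow_mul, ← pow_add, Nat.div_add_mod']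
  have hG1 : 0 < G := Finset.prod_pos fun i _ => pow_pos (hpos i) _
  have hv1 : 0 < v := Finset.prod_pos fun i _ => pow_pos (hpos i) _
  have hvQ : (v : ℚ) ≠ 0 := by exact_mod_cast hv1.ne'
  have hpv : ¬ p ∣ v := by
    intro h
    apply hpy
    apply Int.natCast_dvd.2
    rw [← hY, hYvG]
    exact (dvd_pow h (by omega)).mul_right _
  have hYR : (Y : ℝ) = |(y : ℝ)| := by rw [hY, Nat.cast_natAbs]; push_cast; rfl
  have hYy : (Y : ℚ) ^ 2 = (y : ℚ) ^ 2 := by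
    rw [hY, Nat.cast_natAbs]; push_cast; rw [sq_abs]
  set A : ℚ := ((z : ℚ) / ((v : ℤ) : ℚ)) ^ 2 with hA
  have hzQ : (z : ℚ) ≠ 0 := by exact_mod_cast hs.hz
  have hA0 : A ≠ 0 := by rw [hA]; push_cast; positivity
  have hAn : ‖φ A‖ = 1 := by
    rw [hA, map_pow, map_div₀, norm_pow, norm_div, hunitZ z hpz]
    push_cast
    rw [hunit v hpv]; simp
  have hhalf : h / 2 * n = 4 * H := by rw [hh]; field_simp; ring
  have hroot : ∀ u : ℝ, 0 ≤ u → u ^ n ≤ Real.exp (4 * H) → u ≤ Real.exp (h / 2) := by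
    intro u hu hun
    refine le_of_pow_le_pow_left₀ (show n ≠ 0 by omega) (Real.exp_pos _).le ?_
    rw [← Real.exp_nat_mul, mul_comm (n : ℝ), hhalf]; exact hun
  have hzb : |(z : ℝ)| ≤ Real.exp (h / 2) := by
    apply hroot _ (abs_nonneg _)
    rw [← abs_pow]
    have e1 : (z : ℝ) ^ n = x + y := by exact_mod_cast hs.heq.symm
    rw [e1]
    calc |(x : ℝ) + y| ≤ |(x : ℝ)| + |(y : ℝ)| := abs_add_le _ _
      _ ≤ 2 * Real.exp H := by rw [← hxe]; linarith
      _ ≤ Real.exp H * Real.exp H := by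
          gcongr
          rw [← Real.exp_log (show (0:ℝ) < 2 by norm_num)]
          exact Real.exp_le_exp.2 hH1
      _ = Real.exp (2 * H) := by rw [← Real.exp_add]; ring_nf
      _ ≤ _ := Real.exp_le_exp.2 (by linarith)
  have hvb : |((v : ℤ) : ℝ)| ≤ Real.exp (h / 2) := by
    apply hroot _ (abs_nonneg _)
    rw [Int.cast_natCast, Nat.abs_cast]
    have e1 : v ^ n ≤ Y := by rw [hYvG]; exact Nat.le_mul_of_pos_right _ hG1
    have e2 : (v : ℝ) ^ n ≤ Y := by exact_mod_cast e1
    rw [hYR] at e2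
    calc (v : ℝ) ^ n ≤ Real.exp H := by rw [← hxe]; linarith
      _ ≤ _ := Real.exp_le_exp.2 (by linarith)
  have hHA : HtLE A h := by
    have := (HtLE.ratio (K := ℚ) (a := z) (b := (v : ℤ)) (by exact_mod_cast hv1.ne') hzb hvb).pow 2
    refine this.mono ?_
    push_cast; linarith
  have hHA' : HtLE A⁻¹ h := by
    have := (HtLE.ratio (K := ℚ) (a := (v : ℤ)) (b := z) hs.hz hvb hzb).pow 2
    rw [hA, ← inv_pow, inv_div]
    refine this.mono ?_
    push_cast; linarith
  have hprodG : ∏ i : ↥(S.erase p), (((i : ℕ) : ℚ) ^ 2) ^ ((f i % n : ℕ) : ℤ) = (G : ℚ) ^ 2 := by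
    rw [hG, Nat.cast_prod, ← prod_pow]
    refine prod_congr rfl fun i _ => ?_
    rw [zpow_natCast, Nat.cast_pow, ← pow_mul, ← pow_mul, mul_comm]
  have hy2 : (y : ℚ) ^ 2 = (v : ℚ) ^ (2 * n) * (G : ℚ) ^ 2 := by
    rw [← hYy, hYvG]; push_cast; ring
  have hAnz : A ^ n = (z : ℚ) ^ (2 * n) / (v : ℚ) ^ (2 * n) := by
    rw [hA, Int.cast_natCast, ← pow_mul, div_pow]
  have hzn : (z : ℚ) ^ n = x + y := by exact_mod_cast hs.heq.symm
  have hz2n : (z : ℚ) ^ (2 * n) = (x + y) ^ 2 := by rw [mul_comm, pow_mul, hzn]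
  have hdiff : A ^ n - (G : ℚ) ^ 2 = ((x * (x + 2 * y) : ℤ) : ℚ) / ((v : ℕ) : ℚ) ^ (2 * n) := by
    have : (G : ℚ) ^ 2 = (y : ℚ) ^ 2 / (v : ℚ) ^ (2 * n) := by
      rw [hy2]; field_simp
    rw [this, hAnz, ← sub_div, hz2n]
    push_cast; ring_nf
  have hlow := HN n hnN h hh1 A hA0 hAn hHA hHA' (fun i => ((f i % n : ℕ) : ℤ)) (by
    intro i
    rw [Nat.abs_cast]
    exact_mod_cast (Nat.mod_lt _ (by omega)).le) (by
    intro k hk heq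
    rw [hprodG] at heq
    have e1 : A ^ n = (G : ℚ) ^ 2 := (pow_left_inj₀ (by rw [hA]; positivity) (by positivity) hk.ne').1 heq
    have e2 := sub_eq_zero.2 e1
    rw [hdiff, div_eq_zero_iff] at e2
    rcases e2 with e2 | e2
    · have e3 : x * (x + 2 * y) = 0 := by exact_mod_cast e2
      rcases mul_eq_zero.1 e3 with e4 | e4
      · exact hx0 e4
      · exact odd_sunit h2 hs.hx ⟨-y, by linarith⟩
    · exact pow_ne_zero _ hvQ e2)
  rw [hprodG, ← map_sub, hdiff, map_div₀, norm_div, map_pow, norm_pow, hunit v hpv, one_pow, div_one,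
    map_intCast] at hlow
  have hup : ‖((x * (x + 2 * y) : ℤ) : ℚ_[p])‖ ≤ (p : ℝ) ^ (-(a : ℤ)) := by
    rw [Padic.norm_int_le_pow_iff_dvd]
    have : (p : ℤ) ^ a ∣ x * (x + 2 * y) := hpx.mul_right _
    exact_mod_cast this
  have hpR : (0 : ℝ) < p := by exact_mod_cast hpp.pos
  have e1 : (p : ℝ) ^ (-(a : ℤ)) = Real.exp (-(a * Real.log p)) := by
    rw [zpow_neg, zpow_natCast, Real.exp_neg, ← Real.log_pow, Real.exp_log (by positivity)]
  have e2 : c / 8 * n * h = c * H := by rw [hh]; field_simp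
  rw [e2] at hlow
  rw [e1] at hup
  have := Real.exp_lt_exp.1 (hlow.trans_le hup)
  linarith

theorem n_bounded (S : Finset ℕ) (hS : ∀ q ∈ S, q.Prime) (h2 : 2 ∉ S) :
    ∃ N : ℕ, ∀ x y z n, Sol S x y z n → n < N := by
  obtain ⟨c, hc, H⟩ := lemmaP S hS h2
  have : ∀ p : ℕ, ∃ N : ℕ, p ∈ S → ∀ x y z n (a : ℕ), Sol S x y z n → (p : ℤ) ^ a ∣ x → ¬ (p : ℤ) ∣ y →
      ¬ (p : ℤ) ∣ z → c * Real.log |(x : ℝ)| ≤ a * Real.log p → ((n : ℝ) - 1) * Real.log 2 ≤ Real.log |(x : ℝ)| →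
      n < N := by
    intro p
    by_cases hp : p ∈ S
    · have : Fact p.Prime := ⟨hS p hp⟩
      obtain ⟨N, hN⟩ := boundP S hS h2 p c hc
      exact ⟨N, fun _ => hN⟩
    · exact ⟨0, fun h => absurd h hp⟩
  choose N hN using this
  refine ⟨∑ p ∈ S, N p, fun x y z n hs => ?_⟩
  obtain ⟨h1, p, hp, a, h3, h4, h5, h6⟩ := H x y z n hs
  exact (hN p hp x y z n a hs h3 h4 h5 h6 h1).trans_le (single_le_sum (fun _ _ => Nat.zero_le _) hp)
end Part9

section Part10
open Finset

lemma lattice_coords {E : Type*} [NormedAddCommGroup E] [NormedSpace ℝ E] [FiniteDimensional ℝ E]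
    (L : Submodule ℤ E) [DiscreteTopology L] :
    ∃ (k : ℕ) (b : Fin k → E), (∀ i, b i ∈ L) ∧ ∃ C : ℝ, 0 < C ∧ ∀ x ∈ L, ∃ m : Fin k → ℤ,
      x = ∑ i, m i • b i ∧ ∀ i, |(m i : ℝ)| ≤ C * ‖x‖ := by
  classical
  let F := Submodule.span ℝ (L : Set E)
  let L₀ : Submodule ℤ F := ZLattice.comap ℝ L F.subtype
  have hd : DiscreteTopology L₀ := ZLattice.comap_discreteTopology ℝ L
    (LinearMap.continuous_of_finiteDimensional _) (Submodule.injective_subtype _)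
  have hl : IsZLattice ℝ L₀ := ⟨by
    rw [← (Submodule.map_injective_of_injective (Submodule.injective_subtype F)).eq_iff, Submodule.map_span,
      Submodule.map_top, Submodule.range_subtype]
    congr 1
    ext x
    constructor
    · rintro ⟨y, hy, rfl⟩; exact hy
    · intro hx; exact ⟨⟨x, Submodule.subset_span hx⟩, hx, rfl⟩⟩
  have hfin : Module.Finite ℤ L₀ := ZLattice.module_finite ℝ L₀
  have hfree : Module.Free ℤ L₀ := ZLattice.module_free ℝ L₀
  let b := Module.finBasis ℤ L₀
  let B := b.ofZLatticeBasis ℝ L₀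
  let g : F →L[ℝ] (Fin (Module.finrank ℤ L₀) → ℝ) := LinearMap.toContinuousLinearMap B.equivFun.toLinearMap
  refine ⟨_, fun i => ((b i : F) : E), fun i => (b i).2, ‖g‖ + 1, by positivity, fun x hx => ?_⟩
  let y : L₀ := ⟨⟨x, Submodule.subset_span hx⟩, hx⟩
  refine ⟨fun i => b.repr y i, ?_, fun i => ?_⟩
  · have h1 := b.sum_repr y
    have h2 := congrArg (fun u : L₀ => ((u : F) : E)) h1
    simp only [Submodule.coe_sum, Submodule.coe_smul] at h2
    exact h2.symm
  · have h1 : ((b.repr y i : ℤ) : ℝ) = g y i := by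
      have := b.ofZLatticeBasis_repr_apply ℝ L₀ y i
      exact this.symm
    rw [h1]
    calc |g y i| ≤ ‖g y‖ := norm_le_pi_norm (g y) i
      _ ≤ ‖g‖ * ‖(y : F)‖ := g.le_opNorm _
      _ ≤ (‖g‖ + 1) * ‖x‖ := by
        have : ‖(y : F)‖ = ‖x‖ := rfl
        rw [this]; gcongr; linarith

lemma group_coords {E : Type*} [NormedAddCommGroup E] [NormedSpace ℝ E] [FiniteDimensional ℝ E]
    {G : Type*} [CommGroup G] (f : Additive G →+ E) (hfin : ∀ R : ℝ, {u : Additive G | ‖f u‖ ≤ R}.Finite) :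
    ∃ (k : ℕ) (ξ : Fin k → G) (M : ℕ), 0 < M ∧ ∃ C : ℝ, 0 < C ∧ ∀ u : G, ∃ m : Fin k → ℤ,
      u ^ M = ∏ i, (ξ i ^ M) ^ m i ∧ ∀ i, |(m i : ℝ)| ≤ C * ‖f (Additive.ofMul u)‖ := by
  classical
  let L : Submodule ℤ E := AddSubgroup.toIntSubmodule f.range
  have hmem : ∀ x, x ∈ L ↔ ∃ u, f u = x := fun x => Iff.rfl
  have hd : DiscreteTopology L := by
    refine discreteTopology_of_isOpen_singleton_zero ?_
    refine isOpen_singleton_of_finite_mem_nhds 0 (s := Metric.closedBall 0 1) ?_ ?_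
    · exact Metric.closedBall_mem_nhds _ (by norm_num)
    · refine Set.Finite.of_finite_image (f := ((↑) : L → E)) ?_ (Subtype.val_injective.injOn)
      refine ((hfin 1).image f).subset ?_
      rintro _ ⟨⟨x, hx⟩, hx1, rfl⟩
      obtain ⟨u, rfl⟩ := (hmem x).1 hx
      refine ⟨u, ?_, rfl⟩
      simpa using hx1
  obtain ⟨k, b, hb, C, hC, H⟩ := lattice_coords L
  choose ξ hξ using fun i => (hmem _).1 (hb i)
  have hker : Finite f.ker := by
    have := (hfin 0).subset (show ((f.ker : Set (Additive G)) ⊆ _) from fun u hu => by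
      have : f u = 0 := hu
      simp [this])
    exact this.to_subtype
  refine ⟨k, fun i => (ξ i).toMul, Nat.card f.ker, Nat.card_pos, C, hC, fun u => ?_⟩
  obtain ⟨m, hm, hmC⟩ := H (f (Additive.ofMul u)) ((hmem _).2 ⟨_, rfl⟩)
  refine ⟨m, ?_, hmC⟩
  have hk : Additive.ofMul u - ∑ i, m i • ξ i ∈ f.ker := by
    rw [AddMonoidHom.mem_ker, map_sub, map_sum, sub_eq_zero, hm]
    simp [hξ]
  have h1 : Nat.card f.ker • (⟨_, hk⟩ : f.ker) = 0 := card_nsmul_eq_zero'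
  have h2 := congrArg (fun z : f.ker => (z : Additive G)) h1
  simp only [AddSubmonoidClass.coe_nsmul, nsmul_sub] at h2
  have h3 := sub_eq_zero.1 h2
  have h4 := congrArg Additive.toMul h3
  simp only [toMul_nsmul, toMul_ofMul, toMul_sum, toMul_zsmul] at h4
  rw [h4, ← prod_pow]
  refine prod_congr rfl fun i _ => ?_
  rw [← zpow_natCast, ← zpow_natCast, ← zpow_mul, ← zpow_mul, mul_comm]
end Part10

section Part11
open Finset NumberField

section Astar
variable {K : Type*} [Field K] [NumberField K]

lemma fp_le_one_of_integral (w : FinitePlace K) {x : K} (hx : IsIntegral ℤ x) : w x ≤ 1 := by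
  have h := FinitePlace.norm_le_one K w.maximalIdeal (⟨x, hx⟩ : 𝓞 K)
  rw [← FinitePlace.norm_embedding_eq w x]
  exact h

lemma integral_of_fp {x : K} (h : ∀ w : FinitePlace K, w x ≤ 1) : IsIntegral ℤ x := by
  have := IsDedekindDomain.HeightOneSpectrum.mem_integers_of_valuation_le_one (R := 𝓞 K) K x (by
    intro v
    have h1 := h (FinitePlace.mk v)
    rw [FinitePlace.mk_apply, FinitePlace.norm_embedding'] at h1
    exact (WithZeroMulInt.toNNReal_le_one_iff (HeightOneSpectrum.one_lt_absNorm_nnreal v)).1 (by exact_mod_cast h1))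
  obtain ⟨y, rfl⟩ := this
  exact y.2

lemma fp_nat_le_one (w : FinitePlace K) (m : ℕ) : w (m : K) ≤ 1 :=
  fp_le_one_of_integral w (by simpa using (isIntegral_algebraMap (R := ℤ) (A := K) (x := (m : ℤ))))

lemma fp_finite {N0 : ℕ} (hN0 : N0 ≠ 0) : Finite {w : FinitePlace K // w (N0 : K) ≠ 1} := by
  have := FinitePlace.hasFiniteMulSupport (K := K) (x := (N0 : K)) (by exact_mod_cast hN0)
  exact Set.Finite.to_subtype this

lemma su_finite {N0 : ℕ} (hN0 : N0 ≠ 0) (R : ℝ) :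
    {u : K | u ≠ 0 ∧ (∀ w : FinitePlace K, w (N0 : K) = 1 → w u = 1) ∧
      (∀ w : InfinitePlace K, Real.log (w u) ≤ R) ∧
      (∀ w : FinitePlace K, w (N0 : K) ≠ 1 → Real.log (w u) ≤ R)}.Finite := by
  have hfin := fp_finite (K := K) hN0
  have hN0K : (N0 : K) ≠ 0 := by exact_mod_cast hN0
  obtain ⟨k, hk⟩ : ∃ k : ℕ, ∀ w : {w : FinitePlace K // w (N0 : K) ≠ 1}, w.1 (N0 : K) ^ k ≤ Real.exp (-R) := by
    have : ∀ w : {w : FinitePlace K // w (N0 : K) ≠ 1}, ∀ᶠ k : ℕ in Filter.atTop,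
        w.1 (N0 : K) ^ k ≤ Real.exp (-R) := by
      intro w
      have h1 : w.1 (N0 : K) < 1 := lt_of_le_of_ne (fp_nat_le_one _ _) w.2
      have := tendsto_pow_atTop_nhds_zero_of_lt_one (apply_nonneg w.1 (N0 : K)) h1
      exact this.eventually (eventually_le_nhds (Real.exp_pos _))
    exact (Filter.eventually_all.2 this).exists
  refine Set.Finite.of_finite_image (f := fun u : K => (N0 : K) ^ k * u) ?_
    (fun a _ b _ h => mul_left_cancel₀ (pow_ne_zero k hN0K) h)
  refine (Embeddings.finite_of_norm_le K ℂ ((N0 : ℝ) ^ k * Real.exp R)).subset ?_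
  rintro _ ⟨u, ⟨hu0, hu1, hu2, hu3⟩, rfl⟩
  refine ⟨integral_of_fp fun w => ?_, fun σ => ?_⟩
  · rw [map_mul, map_pow]
    by_cases hw : w (N0 : K) = 1
    · rw [hw, hu1 w hw]; simp
    · have h1 := hk ⟨w, hw⟩
      have h2 := hu3 w hw
      have hpos : 0 < w u := FinitePlace.pos_iff.2 hu0
      rw [Real.log_le_iff_le_exp hpos] at h2
      calc w (N0 : K) ^ k * w u ≤ Real.exp (-R) * Real.exp R := by gcongr
        _ = 1 := by rw [← Real.exp_add]; simp
  · have h2 := hu2 (InfinitePlace.mk σ)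
    have hpos : 0 < InfinitePlace.mk σ u := InfinitePlace.pos_iff.2 hu0
    rw [Real.log_le_iff_le_exp hpos, InfinitePlace.apply] at h2
    rw [map_mul, map_pow, map_natCast, norm_mul, norm_pow, RCLike.norm_natCast]
    gcongr

variable {p : ℕ} [hp : Fact p.Prime]

lemma norm_pow_sub_one_le (a : ℚ_[p]) (ha : ‖a‖ ≤ 1) (M : ℕ) : ‖a ^ M - 1‖ ≤ ‖a - 1‖ := by
  induction M with
  | zero => simp
  | succ M ih =>
    have : a ^ (M + 1) - 1 = a ^ M * (a - 1) + (a ^ M - 1) := by ring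
    rw [this]
    refine (Padic.nonarchimedean _ _).trans (max_le ?_ ih)
    rw [norm_mul, norm_pow]
    exact mul_le_of_le_one_left (norm_nonneg _) (pow_le_one₀ (norm_nonneg _) ha)

/-- group of units outside `N0` -/
def SU (φ : K →+* ℚ_[p]) (N0 : ℕ) : Subgroup Kˣ where
  carrier := {u | (∀ w : FinitePlace K, w (N0 : K) = 1 → w (u : K) = 1) ∧ ‖φ (u : K)‖ = 1}
  one_mem' := by simp
  mul_mem' := by
    rintro a b ⟨h1, h2⟩ ⟨h3, h4⟩
    refine ⟨fun w hw => ?_, ?_⟩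
    · rw [Units.val_mul, map_mul, h1 w hw, h3 w hw, one_mul]
    · rw [Units.val_mul, map_mul, norm_mul, h2, h4, one_mul]
  inv_mem' := by
    rintro a ⟨h1, h2⟩
    refine ⟨fun w hw => ?_, ?_⟩
    · rw [Units.val_inv_eq_inv_val, map_inv₀, h1 w hw, inv_one]
    · rw [Units.val_inv_eq_inv_val, map_inv₀, norm_inv, h2, inv_one]

/-- logarithm map -/
noncomputable def SUlog (φ : K →+* ℚ_[p]) (N0 : ℕ) :
    Additive (SU φ N0) →+ (InfinitePlace K ⊕ {w : FinitePlace K // w (N0 : K) ≠ 1} → ℝ) where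
  toFun u := Sum.elim (fun w => Real.log (w ((u.toMul : Kˣ) : K))) (fun w => Real.log (w.1 ((u.toMul : Kˣ) : K)))
  map_zero' := by
    ext i; rcases i with i | i <;> simp
  map_add' a b := by
    ext i
    have ha : ((a.toMul : Kˣ) : K) ≠ 0 := Units.ne_zero _
    have hb : ((b.toMul : Kˣ) : K) ≠ 0 := Units.ne_zero _
    rcases i with i | i
    · simp only [toMul_add, Subgroup.coe_mul, Units.val_mul, map_mul, Sum.elim_inl, Pi.add_apply]
      exact Real.log_mul (InfinitePlace.pos_iff.2 ha).ne' (InfinitePlace.pos_iff.2 hb).ne'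
    · simp only [toMul_add, Subgroup.coe_mul, Units.val_mul, map_mul, Sum.elim_inr, Pi.add_apply]
      exact Real.log_mul (FinitePlace.pos_iff.2 ha).ne' (FinitePlace.pos_iff.2 hb).ne'

theorem Astar (φ : K →+* ℚ_[p]) {N0 : ℕ} (hN0 : N0 ≠ 0) (κ : ℝ) (hκ : 0 < κ) :
    ∃ R0 : ℝ, ∀ R, R0 ≤ R → ∀ u : K, u ≠ 0 → (∀ w : FinitePlace K, w (N0 : K) = 1 → w u = 1) → ‖φ u‖ = 1 →
      (∀ w : InfinitePlace K, |Real.log (w u)| ≤ R) →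
      (∀ w : FinitePlace K, w (N0 : K) ≠ 1 → |Real.log (w u)| ≤ R) →
      (∀ k : ℕ, 0 < k → u ^ k ≠ 1) → Real.exp (-(κ * R)) < ‖φ u - 1‖ := by
  classical
  have hfin := fp_finite (K := K) hN0
  have := Fintype.ofFinite {w : FinitePlace K // w (N0 : K) ≠ 1}
  obtain ⟨k, ξ, M, hM, C, hC, H⟩ := group_coords (SUlog φ N0) (by
    intro R
    have h1 := su_finite (K := K) hN0 R
    refine Set.Finite.of_finite_image (f := fun u : Additive (SU φ N0) => ((u.toMul : Kˣ) : K)) (h1.subset ?_) ?_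
    · rintro _ ⟨u, hu, rfl⟩
      refine ⟨Units.ne_zero _, u.toMul.2.1, fun w => ?_, fun w hw => ?_⟩
      · exact (le_abs_self _).trans ((norm_le_pi_norm (SUlog φ N0 u) (Sum.inl w)).trans hu)
      · exact (le_abs_self _).trans ((norm_le_pi_norm (SUlog φ N0 u) (Sum.inr ⟨w, hw⟩)).trans hu)
    · intro a _ b _ h
      exact Additive.toMul.injective (Subtype.ext (Units.ext h)))
  obtain ⟨N1, HN⟩ := lowerB φ (fun i => (((ξ i : Kˣ) : K)) ^ M) (fun i => pow_ne_zero _ (Units.ne_zero _))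
    (fun i => by rw [map_pow, norm_pow, (ξ i).2.2, one_pow]) (κ / (2 * C)) (by positivity)
  refine ⟨max (1 / C) (N1 / C), fun R hR u hu0 hu1 hu2 hu3 hu4 hu5 => ?_⟩
  have hR1 : 1 ≤ C * R := by
    have := (le_max_left _ _).trans hR
    rw [div_le_iff₀ hC] at this; linarith
  have hR2 : N1 ≤ C * R := by
    have := (le_max_right _ _).trans hR
    rw [div_le_iff₀ hC] at this; linarith
  set n := ⌈C * R⌉₊ with hn
  have hnN : N1 ≤ n := by
    have : (N1 : ℝ) ≤ n := hR2.trans (Nat.le_ceil _)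
    exact_mod_cast this
  have hn2 : (n : ℝ) ≤ 2 * C * R := by
    have := (Nat.ceil_lt_add_one (show 0 ≤ C * R by linarith)).le
    rw [← hn] at this; linarith
  let U : SU φ N0 := ⟨Units.mk0 u hu0, hu1, hu2⟩
  obtain ⟨m, hm1, hm2⟩ := H U
  have hRpos : 0 ≤ R := by
    by_contra h
    push Not at h
    nlinarith
  have hnorm : ‖SUlog φ N0 (Additive.ofMul U)‖ ≤ R := by
    rw [pi_norm_le_iff_of_nonneg hRpos]
    rintro (w | w)
    · exact hu3 w
    · exact hu4 w.1 w.2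
  have hprod : ∏ i, ((((ξ i : Kˣ) : K)) ^ M) ^ m i = u ^ M := by
    have := congrArg (fun x : SU φ N0 => ((x : Kˣ) : K)) hm1
    simp only [Subgroup.coe_pow, Units.val_pow_eq_pow_val, Subgroup.val_finsetProd, Units.coe_prod, Subgroup.coe_zpow, Units.val_zpow_eq_zpow_val] at this
    exact this.symm
  have hlow := HN n hnN 1 le_rfl 1 one_ne_zero (by simp) (HtLE.one.mono zero_le_one)
    (by rw [inv_one]; exact HtLE.one.mono zero_le_one) m (by
      intro i
      have h1 : |(m i : ℝ)| ≤ n := (hm2 i).trans ((mul_le_mul_of_nonneg_left hnorm hC.le).trans (Nat.le_ceil _))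
      exact_mod_cast h1) (by
      intro j hj
      rw [hprod, one_pow, one_pow, ← pow_mul]
      exact (hu5 _ (Nat.mul_pos hM hj)).symm)
  rw [hprod, one_pow, map_one, map_pow, norm_sub_rev] at hlow
  refine lt_of_le_of_lt ?_ (hlow.trans_le (norm_pow_sub_one_le _ hu2.le M))
  apply Real.exp_le_exp.2
  have : κ / (2 * C) * n * 1 ≤ κ * R := by
    calc κ / (2 * C) * n * 1 ≤ κ / (2 * C) * (2 * C * R) * 1 := by gcongr
      _ = κ * R := by field_simp
  linarith
end Astar
end Part11

section Part12
open Finset NumberField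

section AppA
variable {K : Type*} [Field K] [NumberField K]

/-- the cofactor -/
def cof (n : ℕ) (z : ℤ) (T : K) : K := ∑ i ∈ range n, (z : K) ^ i * T ^ (n - 1 - i)

lemma cof_mul (n : ℕ) {x y z : ℤ} (heq : x + y = z ^ n) {T : K} (hT : T ^ n = (y : K)) :
    cof n z T * ((z : K) - T) = (x : K) := by
  rw [cof, geom_sum₂_mul, hT]
  have : (x : K) + y = (z : K) ^ n := by exact_mod_cast heq
  linear_combination -this

lemma arch_bound {n : ℕ} (hn : 2 ≤ n) {x y z : ℤ} (hx : x ≠ 0) (hy : y ≠ 0) (hz : z ≠ 0) (heq : x + y = z ^ n)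
    (hle : |y| ≤ |x|) {T : K} (hT : T ^ n = (y : K)) (w : InfinitePlace K) :
    |Real.log (w (cof n z T / (n * T ^ (n - 1))))| ≤
      (n + Real.log (4 * n * 2 ^ n)) * (Real.log |(x : ℝ)| + 1) := by
  set X := |(x : ℝ)| with hX
  have hX1 : 1 ≤ X := by
    have := Int.one_le_abs hx
    rw [hX]; exact_mod_cast this
  have hXn : 1 ≤ X ^ n := one_le_pow₀ hX1
  have hyX : |(y : ℝ)| ≤ X := by rw [hX]; exact_mod_cast hle
  have hy1 : 1 ≤ |(y : ℝ)| := by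
    have := Int.one_le_abs hy
    exact_mod_cast this
  have hz1 : 1 ≤ |(z : ℝ)| := by
    have := Int.one_le_abs hz
    exact_mod_cast this
  have hn0 : n ≠ 0 := by omega
  have hnR : (2 : ℝ) ≤ n := by exact_mod_cast hn
  have hzX : |(z : ℝ)| ≤ 2 * X := by
    calc |(z : ℝ)| ≤ |(z : ℝ)| ^ n := le_self_pow₀ hz1 hn0
      _ = |(x : ℝ) + y| := by
          rw [← abs_pow]; congr 1; exact_mod_cast heq.symm
      _ ≤ |(x : ℝ)| + |(y : ℝ)| := abs_add_le _ _
      _ ≤ 2 * X := by linarith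
  rw [← w.norm_embedding_eq]
  set σ := w.embedding with hσ
  have hTn : ‖σ T‖ ^ n = |(y : ℝ)| := by
    rw [← norm_pow, ← map_pow, hT, map_intCast, Complex.norm_intCast]
  have hT1 : 1 ≤ ‖σ T‖ := by
    by_contra h
    push Not at h
    have := pow_lt_one₀ (norm_nonneg _) h hn0
    linarith
  have hTX : ‖σ T‖ ≤ X := (le_self_pow₀ hT1 hn0).trans (by rw [hTn]; exact hyX)
  have hprod : ‖σ (cof n z T)‖ * ‖σ z - σ T‖ = X := by
    rw [← map_sub, ← norm_mul, ← map_mul, cof_mul n heq hT, map_intCast, Complex.norm_intCast]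
  have hzσ : ‖σ (z : K)‖ = |(z : ℝ)| := by rw [map_intCast, Complex.norm_intCast]
  have hd : ‖σ z - σ T‖ ≤ 4 * X := (norm_sub_le _ _).trans (by rw [hzσ]; linarith)
  have hup : ‖σ (cof n z T)‖ ≤ n * (2 * X) ^ n := by
    rw [cof, map_sum]
    refine (norm_sum_le _ _).trans ?_
    have : ∀ i ∈ range n, ‖σ ((z : K) ^ i * T ^ (n - 1 - i))‖ ≤ (2 * X) ^ n := by
      intro i hi
      have hi := mem_range.1 hi
      rw [map_mul, map_pow, map_pow, norm_mul, norm_pow, norm_pow, hzσ]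
      calc |(z : ℝ)| ^ i * ‖σ T‖ ^ (n - 1 - i) ≤ (2 * X) ^ i * (2 * X) ^ (n - 1 - i) := by
            gcongr; linarith
        _ = (2 * X) ^ (n - 1) := by rw [← pow_add]; congr 1; omega
        _ ≤ _ := pow_le_pow_right₀ (by linarith) (by omega)
    refine (sum_le_card_nsmul _ _ _ this).trans ?_
    rw [card_range, nsmul_eq_mul]
  have hcpos : 0 < ‖σ (cof n z T)‖ := by
    by_contra h
    have h0 : ‖σ (cof n z T)‖ = 0 := le_antisymm (not_lt.1 h) (norm_nonneg _)
    rw [h0, zero_mul] at hprod; linarith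
  have hlow : 1 / 4 ≤ ‖σ (cof n z T)‖ := by
    have : X ≤ ‖σ (cof n z T)‖ * (4 * X) := by
      conv_lhs => rw [← hprod]
      gcongr
    nlinarith
  have hden : ‖σ ((n : K) * T ^ (n - 1))‖ = n * ‖σ T‖ ^ (n - 1) := by
    rw [map_mul, map_pow, norm_mul, norm_pow, map_natCast, RCLike.norm_natCast]
  have hT1' : 1 ≤ ‖σ T‖ ^ (n - 1) := one_le_pow₀ hT1
  have hTX' : ‖σ T‖ ^ (n - 1) ≤ X ^ n := by
    calc ‖σ T‖ ^ (n - 1) ≤ X ^ (n - 1) := by gcongr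
      _ ≤ X ^ n := pow_le_pow_right₀ hX1 (by omega)
  rw [map_div₀, norm_div, hden]
  have hD1 : 1 ≤ n * ‖σ T‖ ^ (n - 1) := by nlinarith
  have hD2 : n * ‖σ T‖ ^ (n - 1) ≤ n * X ^ n := by gcongr
  set B : ℝ := 4 * n * 2 ^ n * X ^ n with hB
  have h2n : (1 : ℝ) ≤ 2 ^ n := one_le_pow₀ (by norm_num)
  have hBpos : 0 < B := by positivity
  have hlogB : Real.log B ≤ (n + Real.log (4 * n * 2 ^ n)) * (Real.log X + 1) := by
    rw [hB, Real.log_mul (by positivity) (by positivity), Real.log_pow]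
    have h1 : 0 ≤ Real.log X := Real.log_nonneg hX1
    have h2 : 0 ≤ Real.log (4 * n * 2 ^ n) := Real.log_nonneg (by nlinarith)
    nlinarith
  refine le_trans ?_ hlogB
  rw [abs_le]
  have hq : 0 < ‖σ (cof n z T)‖ / (n * ‖σ T‖ ^ (n - 1)) := by positivity
  constructor
  · rw [← Real.log_inv]
    apply Real.log_le_log (by positivity)
    rw [le_div_iff₀ (by linarith)]
    calc B⁻¹ * (n * ‖σ T‖ ^ (n - 1)) ≤ B⁻¹ * (n * X ^ n) := by gcongr
      _ = 1 / (4 * 2 ^ n) := by rw [hB]; field_simp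
      _ ≤ 1 / 4 := by
          apply one_div_le_one_div_of_le (by norm_num); linarith
      _ ≤ _ := hlow
  · apply Real.log_le_log hq
    rw [div_le_iff₀ (by linarith)]
    calc ‖σ (cof n z T)‖ ≤ n * (2 * X) ^ n := hup
      _ = (n * 2 ^ n * X ^ n) * 1 := by rw [mul_pow]; ring
      _ ≤ B * (n * ‖σ T‖ ^ (n - 1)) := by
          have : n * 2 ^ n * X ^ n ≤ B := by
            rw [hB]
            have : 0 ≤ n * 2 ^ n * X ^ n := by positivity
            nlinarith
          gcongr

lemma sunit_dvd {S : Finset ℕ} (hS : ∀ q ∈ S, q.Prime) {x : ℤ} (hx : IsSUnit S x) {k : ℕ} (hk : Nat.log 2 x.natAbs ≤ k) :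
    x ∣ ((∏ q ∈ S, q : ℕ) : ℤ) ^ k := by
  rw [← Int.natAbs_dvd_natAbs, Int.natAbs_pow, Int.natAbs_natCast]
  have hx0 := Int.natAbs_ne_zero.2 hx.1
  rw [sunit_prod S x.natAbs hx0 (fun q hq h => hx.2 q hq (Int.natCast_dvd.2 h)), ← prod_pow]
  apply prod_dvd_prod_of_dvd
  intro q hq
  apply pow_dvd_pow
  refine le_trans ?_ hk
  apply Nat.le_log_of_pow_le (by norm_num)
  calc 2 ^ x.natAbs.factorization q ≤ q ^ x.natAbs.factorization q := Nat.pow_le_pow_left (hS q hq).two_le _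
    _ ≤ _ := Nat.ordProj_le q hx0

lemma fp_int_le_one (w : FinitePlace K) (m : ℤ) : w (m : K) ≤ 1 :=
  fp_le_one_of_integral w (by simpa using (isIntegral_algebraMap (R := ℤ) (A := K) (x := m)))

lemma fin_bound {S : Finset ℕ} (hS : ∀ q ∈ S, q.Prime) {n : ℕ} (hn : 2 ≤ n) {x y z : ℤ} (hx : IsSUnit S x)
    (hy : IsSUnit S y) (heq : x + y = z ^ n)
    (hle : |y| ≤ |x|) {T : K} (hT : T ^ n = (y : K)) (w : FinitePlace K) :
    |Real.log (w (cof n z T / (n * T ^ (n - 1))))| ≤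
      2 * |Real.log (w ((n * ∏ q ∈ S, q : ℕ) : K))| * (Real.log |(x : ℝ)| + 1) := by
  set N0 := n * ∏ q ∈ S, q with hN0
  have hS0 : ∏ q ∈ S, q ≠ 0 := prod_ne_zero_iff.2 fun q hq => (hS q hq).ne_zero
  have hN00 : N0 ≠ 0 := Nat.mul_ne_zero (by omega) hS0
  set k := Nat.log 2 x.natAbs with hk
  set δ := w (N0 : K) with hδ
  have hδ1 : δ ≤ 1 := fp_nat_le_one w N0
  have hδ0 : 0 < δ := FinitePlace.pos_iff.2 (by exact_mod_cast hN00)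
  have hx0 := Int.natAbs_ne_zero.2 hx.1
  have hdvd : ∀ m : ℤ, IsSUnit S m → |m| ≤ |x| → δ ^ k ≤ w (m : K) := by
    intro m hm hmx
    have h1 : Nat.log 2 m.natAbs ≤ k := Nat.log_mono_right (by
      rw [Int.abs_eq_natAbs, Int.abs_eq_natAbs] at hmx; exact_mod_cast hmx)
    obtain ⟨q, hq⟩ := sunit_dvd hS hm h1
    have h2 : (N0 : K) ^ k = (m : K) * ((q * n ^ k : ℤ) : K) := by
      have : (N0 : ℤ) ^ k = m * (q * n ^ k) := by
        rw [hN0, Nat.cast_mul, mul_pow, hq]; ring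
      exact_mod_cast this
    have h3 := congrArg w h2
    rw [map_pow, map_mul, ← hδ] at h3
    rw [h3]
    exact mul_le_of_le_one_right (apply_nonneg w _) (fp_int_le_one w _)
  have hwx := hdvd x hx le_rfl
  have hwy := hdvd y hy hle
  have hTint : IsIntegral ℤ T := by
    refine IsIntegral.of_pow (n := n) (by omega) ?_
    rw [hT]; simpa using (isIntegral_algebraMap (R := ℤ) (A := K) (x := y))
  have hzint : IsIntegral ℤ (z : K) := by
    simpa using (isIntegral_algebraMap (R := ℤ) (A := K) (x := z))
  have hcint : IsIntegral ℤ (cof n z T) := by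
    rw [cof]
    exact IsIntegral.sum _ fun i _ => (hzint.pow _).mul (hTint.pow _)
  have hc1 := fp_le_one_of_integral w hcint
  have hd1 := fp_le_one_of_integral w (hzint.sub hTint)
  have hprod := congrArg w (cof_mul n heq hT)
  rw [map_mul] at hprod
  have hck : δ ^ k ≤ w (cof n z T) := by
    refine hwx.trans ?_
    rw [← hprod]
    exact mul_le_of_le_one_right (apply_nonneg w _) hd1
  have hT1 := fp_le_one_of_integral w hTint
  have hTk : δ ^ k ≤ w T ^ (n - 1) := by
    have : w T ^ n ≤ w T ^ (n - 1) := pow_le_pow_of_le_one (apply_nonneg w _) hT1 (by omega)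
    refine le_trans ?_ this
    have e : w T ^ n = w (y : K) := (map_pow w T n).symm.trans (congrArg w hT)
    rw [e]; exact hwy
  have hn1 := fp_nat_le_one w n
  have hnδ : δ ≤ w (n : K) := by
    rw [hδ, hN0, Nat.cast_mul, map_mul]
    exact mul_le_of_le_one_right (apply_nonneg w _) (fp_nat_le_one w _)
  have hTle : w T ^ (n - 1) ≤ 1 := pow_le_one₀ (apply_nonneg w _) hT1
  have hδk : 0 < δ ^ k := by positivity
  rw [map_div₀, map_mul, map_pow]
  set D := w (n : K) * w T ^ (n - 1) with hD
  have hD1 : D ≤ 1 := mul_le_one₀ hn1 (by positivity) hTle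
  have hDk : δ ^ (k + 1) ≤ D := by
    rw [pow_succ', hD]; gcongr
  have hD0 : 0 < D := lt_of_lt_of_le (by positivity) hDk
  have hkH : (k : ℝ) ≤ 2 * Real.log |(x : ℝ)| := by
    have h1 : 2 ^ k ≤ x.natAbs := Nat.pow_log_le_self 2 hx0
    have h2 : (2 : ℝ) ^ k ≤ |(x : ℝ)| := by
      have h3 : (2 : ℝ) ^ k ≤ (x.natAbs : ℝ) := by exact_mod_cast h1
      rwa [Nat.cast_natAbs, Int.cast_abs] at h3
    have h3 := Real.log_le_log (by positivity) h2
    rw [Real.log_pow] at h3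
    have hl2 : (0.6931471803 : ℝ) < Real.log 2 := Real.log_two_gt_d9
    have : (0 : ℝ) ≤ k := by positivity
    nlinarith
  have hlδ : Real.log δ ≤ 0 := Real.log_nonpos hδ0.le hδ1
  have habs : |Real.log δ| = - Real.log δ := abs_of_nonpos hlδ
  have hq0 : 0 < w (cof n z T) / D := div_pos (hδk.trans_le hck) hD0
  have hfinal : ((k + 1 : ℕ) : ℝ) * |Real.log δ| ≤ 2 * |Real.log δ| * (Real.log |(x : ℝ)| + 1) := by
    push_cast
    have := abs_nonneg (Real.log δ)
    nlinarith
  refine le_trans ?_ hfinal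
  rw [habs, abs_le]
  constructor
  · rw [mul_neg, neg_neg, ← Real.log_pow]
    apply Real.log_le_log (by positivity)
    rw [le_div_iff₀ hD0]
    calc δ ^ (k + 1) * D ≤ δ ^ (k + 1) * 1 := by gcongr
      _ = δ ^ k * δ := by rw [mul_one, pow_succ]
      _ ≤ δ ^ k * 1 := by gcongr
      _ ≤ _ := by rw [mul_one]; exact hck
  · rw [mul_neg, ← Real.log_pow, ← Real.log_inv]
    apply Real.log_le_log hq0
    rw [div_le_iff₀ hD0]
    calc w (cof n z T) ≤ 1 := hc1
      _ = (δ ^ (k + 1))⁻¹ * δ ^ (k + 1) := by rw [inv_mul_cancel₀ (by positivity)]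
      _ ≤ _ := by gcongr

variable {p : ℕ} [hp : Fact p.Prime]

lemma norm_pow_sub_le (a b : ℚ_[p]) (ha : ‖a‖ ≤ 1) (hb : ‖b‖ ≤ 1) (M : ℕ) : ‖a ^ M - b ^ M‖ ≤ ‖a - b‖ := by
  induction M with
  | zero => simp
  | succ M ih =>
    have : a ^ (M + 1) - b ^ (M + 1) = a ^ M * (a - b) + (a ^ M - b ^ M) * b := by ring
    rw [this]
    refine (Padic.nonarchimedean _ _).trans (max_le ?_ ?_)
    · rw [norm_mul, norm_pow]
      exact mul_le_of_le_one_left (norm_nonneg _) (pow_le_one₀ (norm_nonneg _) ha)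
    · rw [norm_mul]
      exact (mul_le_of_le_one_right (norm_nonneg _) hb).trans ih

lemma padic_bound (φ : K →+* ℚ_[p]) {n : ℕ} (hn : 2 ≤ n) {x y z : ℤ} (heq : x + y = z ^ n) {T : K} (hT : T ^ n = (y : K))
    (hz : ‖φ (z : K)‖ = 1) (hT1 : ‖φ T‖ = 1) (hclose : ‖φ (z : K) - φ T‖ < ‖(n : ℚ_[p])‖) :
    ‖φ (cof n z T / (n * T ^ (n - 1)))‖ = 1 ∧
      ‖φ (cof n z T / (n * T ^ (n - 1))) - 1‖ ≤ ‖(x : ℚ_[p])‖ / ‖(n : ℚ_[p])‖ ^ 2 := by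
  have hn0 : (n : ℚ_[p]) ≠ 0 := by exact_mod_cast (show n ≠ 0 by omega)
  have hnpos : 0 < ‖(n : ℚ_[p])‖ := norm_pos_iff.2 hn0
  set d := φ (z : K) - φ T with hd
  have h1 : ‖φ (cof n z T) - n * φ T ^ (n - 1)‖ ≤ ‖d‖ := by
    have : φ (cof n z T) - n * φ T ^ (n - 1) =
        ∑ i ∈ range n, φ T ^ (n - 1 - i) * (φ (z : K) ^ i - φ T ^ i) := by
      have e : (n : ℚ_[p]) * φ T ^ (n - 1) = ∑ i ∈ range n, φ T ^ (n - 1) := by simp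
      rw [e, cof, map_sum, ← sum_sub_distrib]
      refine sum_congr rfl fun i hi => ?_
      have hi := mem_range.1 hi
      have e2 : φ T ^ (n - 1) = φ T ^ (n - 1 - i) * φ T ^ i := by rw [← pow_add]; congr 1; omega
      rw [map_mul, map_pow, map_pow, e2]; ring
    rw [this]
    refine IsUltrametricDist.norm_sum_le_of_forall_le_of_nonneg (norm_nonneg _) fun i _ => ?_
    rw [norm_mul, norm_pow, hT1, one_pow, one_mul]
    exact norm_pow_sub_le _ _ hz.le hT1.le i
  have hden : ‖(n : ℚ_[p]) * φ T ^ (n - 1)‖ = ‖(n : ℚ_[p])‖ := by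
    rw [norm_mul, norm_pow, hT1, one_pow, mul_one]
  have hcn : ‖φ (cof n z T)‖ = ‖(n : ℚ_[p])‖ := by
    have e : φ (cof n z T) = (φ (cof n z T) - n * φ T ^ (n - 1)) + n * φ T ^ (n - 1) := by ring
    rw [e, ← hden]
    have := IsUltrametricDist.norm_add_eq_max_of_norm_ne_norm
      (x := φ (cof n z T) - n * φ T ^ (n - 1)) (y := n * φ T ^ (n - 1)) (by
        rw [hden]; exact (h1.trans_lt hclose).ne)
    rw [this, max_eq_right]
    rw [hden]; exact (h1.trans_lt hclose).le
  have hprod : ‖φ (cof n z T)‖ * ‖d‖ = ‖(x : ℚ_[p])‖ := by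
    rw [← norm_mul, hd, ← map_sub, ← map_mul, cof_mul n heq hT, map_intCast]
  have hdx : ‖d‖ = ‖(x : ℚ_[p])‖ / ‖(n : ℚ_[p])‖ := by
    rw [eq_div_iff hnpos.ne', ← hprod, hcn, mul_comm]
  have hT0 : φ T ≠ 0 := by
    intro h; rw [h, norm_zero] at hT1; norm_num at hT1
  have hmap : φ (cof n z T / (n * T ^ (n - 1))) = φ (cof n z T) / (n * φ T ^ (n - 1)) := by
    rw [map_div₀, map_mul, map_pow, map_natCast]
  rw [hmap]
  refine ⟨by rw [norm_div, hden, hcn, div_self hnpos.ne'], ?_⟩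
  have hD0 : (n : ℚ_[p]) * φ T ^ (n - 1) ≠ 0 := mul_ne_zero hn0 (pow_ne_zero _ hT0)
  rw [div_sub_one hD0, norm_div, hden, div_le_iff₀ hnpos]
  refine h1.trans (le_of_eq ?_)
  rw [hdx]; field_simp
end AppA
end Part12

section Part13
open Finset NumberField

section AppB
variable {K : Type*} [Field K] [NumberField K]

lemma units_finite : {u : K | ∃ k : ℕ, 0 < k ∧ u ^ k = 1}.Finite := by
  refine (su_finite (K := K) (N0 := 1) one_ne_zero 0).subset ?_
  rintro u ⟨k, hk, hu⟩
  have hfin : ∀ w : FinitePlace K, w u = 1 := fun w => by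
    have h := congrArg w hu
    rw [map_pow, map_one] at h
    exact (pow_eq_one_iff_of_nonneg (apply_nonneg w _) hk.ne').1 h
  have hinf : ∀ w : InfinitePlace K, w u = 1 := fun w => by
    have h := congrArg w hu
    rw [map_pow, map_one] at h
    exact (pow_eq_one_iff_of_nonneg (apply_nonneg w _) hk.ne').1 h
  refine ⟨?_, fun w _ => hfin w, fun w => by rw [hinf w, Real.log_one], fun w _ => by rw [hfin w, Real.log_one]⟩
  rintro rfl
  rw [zero_pow hk.ne'] at hu
  exact zero_ne_one hu

lemma geom_finite {n : ℕ} (hn : 2 ≤ n) (c : K) : {t : K | ∑ i ∈ range n, t ^ i = c}.Finite := by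
  set P : Polynomial K := ∑ i ∈ range n, Polynomial.X ^ i - Polynomial.C c with hP
  have hP0 : P ≠ 0 := by
    intro h
    have h1 := congrArg (fun Q => Polynomial.coeff Q 1) h
    simp only [hP, Polynomial.coeff_sub, Polynomial.finsetSum_coeff, Polynomial.coeff_X_pow,
      Polynomial.coeff_zero, Polynomial.coeff_C] at h1
    rw [Finset.sum_ite_eq, if_pos (mem_range.2 (by omega))] at h1
    norm_num at h1
  refine (Polynomial.finite_setOfPred_isRoot hP0).subset ?_
  intro t ht
  simp only [Set.mem_ofPred_eq] at ht ⊢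
  rw [Polynomial.IsRoot.def, hP, Polynomial.eval_sub, Polynomial.eval_finsetSum]
  simp [ht]

variable {p : ℕ} [hp : Fact p.Prime]

lemma perField (S : Finset ℕ) (hS : ∀ q ∈ S, q.Prime) (φ : K →+* ℚ_[p]) {n : ℕ} (hn : 2 ≤ n) (y0 : ℤ) (ϑ : K)
    (hϑ : ϑ ^ n = (y0 : K)) (c : ℝ) (hc : 0 < c) :
    ∃ R : ℝ, ∀ x y z (a v : ℕ), Sol S x y z n → (p : ℤ) ^ a ∣ x → ¬ (p : ℤ) ∣ y → ¬ (p : ℤ) ∣ z →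
      c * Real.log |(x : ℝ)| ≤ a * Real.log p → y = y0 * (v : ℤ) ^ n →
      ‖(z : ℚ_[p]) - φ ϑ * v‖ < ‖(n : ℚ_[p])‖ → Real.log |(x : ℝ)| ≤ R := by
  classical
  have hpp := hp.out
  set N0 := n * ∏ q ∈ S, q with hN0
  have hS0 : ∏ q ∈ S, q ≠ 0 := prod_ne_zero_iff.2 fun q hq => (hS q hq).ne_zero
  have hN00 : N0 ≠ 0 := Nat.mul_ne_zero (by omega) hS0
  haveI : Finite {w : FinitePlace K // w (N0 : K) ≠ 1} := fp_finite hN00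
  haveI : Fintype {w : FinitePlace K // w (N0 : K) ≠ 1} := Fintype.ofFinite _
  have hnR : (2 : ℝ) ≤ n := by exact_mod_cast hn
  have h2n : (1 : ℝ) ≤ 2 ^ n := one_le_pow₀ (by norm_num)
  have hlog0 : 0 ≤ Real.log (4 * n * 2 ^ n) := Real.log_nonneg (by nlinarith)
  set C1 : ℝ := (n + Real.log (4 * n * 2 ^ n)) +
    ∑ w : {w : FinitePlace K // w (N0 : K) ≠ 1}, 2 * |Real.log (w.1 (N0 : K))| with hC1
  have hsum0 : 0 ≤ ∑ w : {w : FinitePlace K // w (N0 : K) ≠ 1}, 2 * |Real.log (w.1 (N0 : K))| :=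
    sum_nonneg fun _ _ => by positivity
  have hC1pos : 0 < C1 := by linarith
  obtain ⟨R0, HA⟩ := Astar φ hN00 (c / (2 * C1)) (by positivity)
  have hUf := units_finite (K := K)
  have hF : (⋃ u ∈ {u : K | ∃ k : ℕ, 0 < k ∧ u ^ k = 1}, {t : K | ∑ i ∈ range n, t ^ i = n * u}).Finite :=
    hUf.biUnion fun u _ => geom_finite hn _
  obtain ⟨B, HB⟩ := (hF.image fun t => ‖φ (t ^ n - 1)‖⁻¹).bddAbove
  have hn0 : (n : ℚ_[p]) ≠ 0 := by exact_mod_cast (show n ≠ 0 by omega)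
  have hnpos : 0 < ‖(n : ℚ_[p])‖ := norm_pos_iff.2 hn0
  set L := Real.log (1 / ‖(n : ℚ_[p])‖ ^ 2) with hL
  refine ⟨max (R0 / C1) (max (1 + 2 / c * L) (Real.log B / c)), fun x y z a v hs hpx hpy hpz hcl hyv hclose => ?_⟩
  set H := Real.log |(x : ℝ)| with hH
  have hx0 := hs.hx.1
  have hxR : (1 : ℝ) ≤ |(x : ℝ)| := by exact_mod_cast Int.one_le_abs hx0
  have hH0 : 0 ≤ H := Real.log_nonneg hxR
  have hunitZ : ∀ q : ℤ, ¬ (p : ℤ) ∣ q → ‖(q : ℚ_[p])‖ = 1 := by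
    intro q hq
    rw [Padic.norm_intCast_eq_one_iff]
    exact ((Nat.prime_iff_prime_int.1 hpp).coprime_iff_not_dvd.2 hq).symm
  set T : K := ϑ * v with hTd
  have hT : T ^ n = (y : K) := by
    rw [hTd, mul_pow, hϑ, hyv]; push_cast; ring
  have hzn : ‖φ (z : K)‖ = 1 := by rw [map_intCast]; exact hunitZ z hpz
  have hTn : ‖φ T‖ = 1 := by
    have : ‖φ T‖ ^ n = 1 := by
      rw [← norm_pow, ← map_pow, hT, map_intCast]; exact hunitZ y hpy
    exact (pow_eq_one_iff_of_nonneg (norm_nonneg _) (by omega)).1 this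
  have hT0 : T ≠ 0 := by
    rintro h; rw [h, map_zero, norm_zero] at hTn; exact zero_ne_one hTn
  obtain ⟨hρ1, hρ2⟩ := padic_bound φ hn hs.heq hT hzn hTn (by
    rw [map_intCast, hTd, map_mul, map_natCast]; exact hclose)
  set ρ := cof n z T / (n * T ^ (n - 1)) with hρ
  have hρ0 : ρ ≠ 0 := by
    rintro h; rw [h, map_zero, norm_zero] at hρ1; exact zero_ne_one hρ1
  have hxp : ‖(x : ℚ_[p])‖ ≤ Real.exp (-(c * H)) := by
    have h1 := (Padic.norm_int_le_pow_iff_dvd (p := p) x a).2 (by exact_mod_cast hpx)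
    refine h1.trans ?_
    have hp0 : (0 : ℝ) < p := by exact_mod_cast hpp.pos
    have e : (p : ℝ) ^ (-(a : ℤ)) = Real.exp (-(a * Real.log p)) := by
      rw [Real.exp_neg, Real.exp_nat_mul, Real.exp_log hp0, zpow_neg, zpow_natCast]
    rw [e]
    apply Real.exp_le_exp.2
    linarith
  have hxpos : 0 < ‖(x : ℚ_[p])‖ := norm_pos_iff.2 (by exact_mod_cast hx0)
  by_cases hord : ∀ k : ℕ, 0 < k → ρ ^ k ≠ 1
  · by_cases hR : R0 ≤ C1 * (H + 1)
    · have hfb := fin_bound (K := K) hS hn hs.hx hs.hy hs.heq hs.hle hT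
      rw [← hN0, ← hρ] at hfb
      have key := HA _ hR ρ hρ0 (fun w hw => by
          have h := hfb w
          rw [hw, Real.log_one, abs_zero, mul_zero, zero_mul] at h
          have h2 := abs_eq_zero.1 (le_antisymm h (abs_nonneg _))
          exact Real.eq_one_of_pos_of_log_eq_zero (FinitePlace.pos_iff.2 hρ0) h2) hρ1
        (fun w => (arch_bound hn hx0 hs.hy.1 hs.hz hs.heq hs.hle hT w).trans (by
          apply mul_le_mul_of_nonneg_right _ (by linarith)
          linarith))
        (fun w hw => (hfb w).trans (by
          apply mul_le_mul_of_nonneg_right _ (by linarith)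
          have := single_le_sum (f := fun w : {w : FinitePlace K // w (N0 : K) ≠ 1} => 2 * |Real.log (w.1 (N0 : K))|)
            (fun _ _ => by positivity) (mem_univ ⟨w, hw⟩)
          simp only at this
          linarith)) hord
      have e : c / (2 * C1) * (C1 * (H + 1)) = c / 2 * (H + 1) := by field_simp
      rw [e] at key
      have h1 : Real.exp (-(c / 2 * (H + 1))) < Real.exp (-(c * H)) * (1 / ‖(n : ℚ_[p])‖ ^ 2) := by
        refine key.trans_le (hρ2.trans ?_)
        rw [div_eq_mul_one_div]
        gcongr
      have hpos1 : 0 < 1 / ‖(n : ℚ_[p])‖ ^ 2 := by positivity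
      rw [← Real.exp_log hpos1, ← hL, ← Real.exp_add, Real.exp_lt_exp] at h1
      refine le_max_of_le_right (le_max_of_le_left ?_)
      have : c / 2 * (H - 1) ≤ L := by linarith
      have h3 : H - 1 = 2 / c * (c / 2 * (H - 1)) := by field_simp
      have h4 : 2 / c * (c / 2 * (H - 1)) ≤ 2 / c * L := by gcongr
      linarith
    · push Not at hR
      refine le_max_of_le_left ?_
      rw [le_div_iff₀ hC1pos]
      nlinarith
  · push Not at hord
    obtain ⟨k, hk, hρk⟩ := hord
    refine le_max_of_le_right (le_max_of_le_right ?_)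
    have hnK : (n : K) ≠ 0 := by exact_mod_cast (show n ≠ 0 by omega)
    have hmem : (z : K) / T ∈ (⋃ u ∈ {u : K | ∃ k : ℕ, 0 < k ∧ u ^ k = 1}, {t : K | ∑ i ∈ range n, t ^ i = n * u}) := by
      simp only [Set.mem_iUnion, Set.mem_ofPred_eq]
      refine ⟨ρ, ⟨k, hk, hρk⟩, ?_⟩
      have e1 : (n : K) * ρ = cof n z T / T ^ (n - 1) := by
        rw [hρ]; field_simp
      rw [e1, eq_div_iff (pow_ne_zero _ hT0), cof, sum_mul]
      refine sum_congr rfl fun i hi => ?_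
      have hi := mem_range.1 hi
      have e2 : T ^ (n - 1) = T ^ (n - 1 - i) * T ^ i := by rw [← pow_add]; congr 1; omega
      rw [e2, div_pow]; field_simp
    have hb := HB ⟨_, hmem, rfl⟩
    simp only at hb
    have hyK : (y : K) ≠ 0 := by exact_mod_cast hs.hy.1
    have e3 : ((z : K) / T) ^ n - 1 = (x : K) / (y : K) := by
      rw [div_pow, hT, eq_div_iff hyK, sub_mul, div_mul_cancel₀ _ hyK, one_mul, sub_eq_iff_eq_add]
      exact_mod_cast hs.heq.symm
    rw [e3, map_div₀, map_intCast, map_intCast, norm_div, hunitZ y hpy, div_one] at hb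
    have h5 : Real.exp (c * H) ≤ B := by
      refine le_trans ?_ hb
      rw [le_inv_comm₀ (Real.exp_pos _) hxpos, ← Real.exp_neg]
      exact hxp
    rw [le_div_iff₀ hc, mul_comm]
    exact (Real.le_log_iff_exp_le (lt_of_lt_of_le (Real.exp_pos _) h5)).2 h5
end AppB
end Part13

section Part14
open Finset NumberField

section AppC
variable {p : ℕ} [hp : Fact p.Prime]

lemma hensel_root {n : ℕ} (y0 : ℤ) (t : ℚ_[p]) (ht : ‖t‖ = 1)
    (h : ‖t ^ n - y0‖ < ‖(n : ℚ_[p])‖ ^ 2) : ∃ θ : ℚ_[p], θ ^ n = y0 ∧ ‖t - θ‖ < ‖(n : ℚ_[p])‖ := by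
  set a : ℤ_[p] := ⟨t, ht.le⟩ with ha
  have hat : (a : ℚ_[p]) = t := rfl
  set F : Polynomial ℤ_[p] := Polynomial.X ^ n - Polynomial.C (y0 : ℤ_[p]) with hF
  have hFa : ∀ b : ℤ_[p], F.aeval b = b ^ n - y0 := by intro b; simp [hF]
  have hF' : F.derivative.aeval a = n * a ^ (n - 1) := by simp [hF, Polynomial.derivative_X_pow]
  have hna : ‖F.derivative.aeval a‖ = ‖(n : ℚ_[p])‖ := by
    rw [hF', ← PadicInt.padic_norm_e_of_padicInt]
    push_cast
    rw [norm_mul, norm_pow, hat, ht, one_pow, mul_one]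
  obtain ⟨θ, h1, h2, -, -⟩ := hensels_lemma (F := F) (a := a) (by
    rw [hna, hFa, ← PadicInt.padic_norm_e_of_padicInt]
    push_cast
    exact h)
  refine ⟨θ, ?_, ?_⟩
  · rw [hFa] at h1
    have := congrArg (fun b : ℤ_[p] => (b : ℚ_[p])) (sub_eq_zero.1 h1)
    simpa using this
  · rw [hna, ← PadicInt.padic_norm_e_of_padicInt] at h2
    rw [norm_sub_rev]
    simpa using h2

lemma perRoot (S : Finset ℕ) (hS : ∀ q ∈ S, q.Prime) {n : ℕ} (hn : 2 ≤ n) (c : ℝ) (hc : 0 < c)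
    (y0 : ℤ) (θ : ℚ_[p]) (hθ : θ ^ n = (y0 : ℚ_[p])) :
    ∃ R : ℝ, ∀ x y z (a v : ℕ), Sol S x y z n → (p : ℤ) ^ a ∣ x → ¬ (p : ℤ) ∣ y → ¬ (p : ℤ) ∣ z →
      c * Real.log |(x : ℝ)| ≤ a * Real.log p → y = y0 * (v : ℤ) ^ n →
      ‖(z : ℚ_[p]) - θ * v‖ < ‖(n : ℚ_[p])‖ → Real.log |(x : ℝ)| ≤ R := by
  have hintg : IsIntegral ℚ θ := by
    refine IsIntegral.of_pow (n := n) (by omega) ?_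
    rw [hθ]
    simpa using (isIntegral_algebraMap (R := ℚ) (A := ℚ_[p]) (x := (y0 : ℚ)))
  haveI : FiniteDimensional ℚ (IntermediateField.adjoin ℚ {θ}) :=
    IntermediateField.adjoin.finiteDimensional hintg
  haveI : NumberField (IntermediateField.adjoin ℚ {θ}) := ⟨⟩
  obtain ⟨R, hR⟩ := perField S hS (algebraMap (IntermediateField.adjoin ℚ {θ}) ℚ_[p]) hn y0
    (IntermediateField.AdjoinSimple.gen ℚ θ) (by
      apply (algebraMap (IntermediateField.adjoin ℚ {θ}) ℚ_[p]).injective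
      rw [map_pow, IntermediateField.AdjoinSimple.algebraMap_gen, hθ, map_intCast]) c hc
  refine ⟨R, ?_⟩
  rw [IntermediateField.AdjoinSimple.algebraMap_gen] at hR
  exact hR

lemma perPrime (S : Finset ℕ) (hS : ∀ q ∈ S, q.Prime) {n : ℕ} (hn : 2 ≤ n) (c : ℝ) (hc : 0 < c) :
    ∃ R : ℝ, ∀ x y z (a : ℕ), Sol S x y z n → (p : ℤ) ^ a ∣ x → ¬ (p : ℤ) ∣ y → ¬ (p : ℤ) ∣ z →
      c * Real.log |(x : ℝ)| ≤ a * Real.log p → Real.log |(x : ℝ)| ≤ R := by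
  classical
  have hpp := hp.out
  have hall : ∀ q : ℤ × ℚ_[p], ∃ R : ℝ, q.2 ^ n = (q.1 : ℚ_[p]) →
    ∀ x y z (a v : ℕ), Sol S x y z n → (p : ℤ) ^ a ∣ x → ¬ (p : ℤ) ∣ y → ¬ (p : ℤ) ∣ z →
      c * Real.log |(x : ℝ)| ≤ a * Real.log p → y = q.1 * (v : ℤ) ^ n →
      ‖(z : ℚ_[p]) - q.2 * v‖ < ‖(n : ℚ_[p])‖ → Real.log |(x : ℝ)| ≤ R := by
    intro q
    by_cases h : q.2 ^ n = (q.1 : ℚ_[p])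
    · obtain ⟨R, hR⟩ := perRoot S hS hn c hc q.1 q.2 h
      exact ⟨R, fun _ => hR⟩
    · exact ⟨0, fun h' => absurd h' h⟩
  choose Rf hRf using hall
  set M : ℤ := (((∏ q ∈ S, q) ^ n : ℕ) : ℤ) with hM
  have hfin : (⋃ y0 ∈ Set.Icc (-M) M, Set.image (fun θ => (y0, θ)) {θ : ℚ_[p] | θ ^ n = (y0 : ℚ_[p])}).Finite := by
    refine (Set.finite_Icc _ _).biUnion fun y0 _ => Set.Finite.image _ ?_
    have hP : (Polynomial.X ^ n - Polynomial.C (y0 : ℚ_[p]) : Polynomial ℚ_[p]) ≠ 0 :=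
      Polynomial.X_pow_sub_C_ne_zero (by omega) _
    refine (Polynomial.finite_setOfPred_isRoot hP).subset ?_
    intro θ hθ
    simp only [Set.mem_ofPred_eq] at hθ ⊢
    simp [hθ]
  obtain ⟨B, HB⟩ := (hfin.image Rf).bddAbove
  have hn0 : (n : ℚ_[p]) ≠ 0 := by exact_mod_cast (show n ≠ 0 by omega)
  have hnpos : 0 < ‖(n : ℚ_[p])‖ := norm_pos_iff.2 hn0
  refine ⟨max B (- Real.log (‖(n : ℚ_[p])‖ ^ 2) / c), fun x y z a hs hpx hpy hpz hcl => ?_⟩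
  set H := Real.log |(x : ℝ)| with hH
  have hunitZ : ∀ q : ℤ, ¬ (p : ℤ) ∣ q → ‖(q : ℚ_[p])‖ = 1 := by
    intro q hq
    rw [Padic.norm_intCast_eq_one_iff]
    exact ((Nat.prime_iff_prime_int.1 hpp).coprime_iff_not_dvd.2 hq).symm
  have hxp : ‖(x : ℚ_[p])‖ ≤ Real.exp (-(c * H)) := by
    have h1 := (Padic.norm_int_le_pow_iff_dvd (p := p) x a).2 (by exact_mod_cast hpx)
    refine h1.trans ?_
    have hp0 : (0 : ℝ) < p := by exact_mod_cast hpp.pos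
    have e : (p : ℝ) ^ (-(a : ℤ)) = Real.exp (-(a * Real.log p)) := by
      rw [Real.exp_neg, Real.exp_nat_mul, Real.exp_log hp0, zpow_neg, zpow_natCast]
    rw [e]
    apply Real.exp_le_exp.2
    linarith
  by_cases hsmall : ‖(x : ℚ_[p])‖ < ‖(n : ℚ_[p])‖ ^ 2
  swap
  · push Not at hsmall
    refine le_max_of_le_right ?_
    have := Real.log_le_log (by positivity) (hsmall.trans hxp)
    rw [Real.log_exp] at this
    rw [le_div_iff₀ hc]
    linarith
  refine le_max_of_le_left ?_
  set Y := y.natAbs with hY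
  have hY0 : Y ≠ 0 := Int.natAbs_ne_zero.2 hs.hy.1
  have hYS := sunit_prod S Y hY0 (fun q hq hqY => hs.hy.2 q hq (Int.natCast_dvd.2 hqY))
  set f := Y.factorization with hf
  set v : ℕ := ∏ q ∈ S, q ^ (f q / n) with hv
  set G : ℕ := ∏ q ∈ S, q ^ (f q % n) with hG
  have hYvG : Y = G * v ^ n := by
    rw [hv, hG, ← prod_pow, ← prod_mul_distrib]
    conv_lhs => rw [hYS]
    refine prod_congr rfl fun i _ => ?_
    rw [← pow_mul, ← pow_add, Nat.mod_add_div']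
  have hGM : G ≤ (∏ q ∈ S, q) ^ n := by
    rw [hG, ← prod_pow]
    refine prod_le_prod' fun q hq => ?_
    exact Nat.pow_le_pow_right (hS q hq).pos (Nat.mod_lt _ (by omega)).le
  set y0 : ℤ := y.sign * G with hy0
  have hyv : y = y0 * (v : ℤ) ^ n := by
    have h1 := (Int.sign_mul_natAbs y).symm
    rw [← hY, hYvG] at h1
    rw [hy0]
    conv_lhs => rw [h1]
    push_cast; ring
  have hy0M : y0 ∈ Set.Icc (-M) M := by
    have h1 : |y0| ≤ M := by
      have hsg : |y.sign| = 1 := by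
        rcases lt_trichotomy y 0 with h | h | h
        · rw [Int.sign_eq_neg_one_of_neg h]; rfl
        · exact absurd h hs.hy.1
        · rw [Int.sign_eq_one_of_pos h]; rfl
      rw [hy0, abs_mul, hsg, one_mul, Nat.abs_cast, hM]
      exact_mod_cast hGM
    exact abs_le.1 h1
  have hpv : ¬ (p : ℤ) ∣ (v : ℤ) := by
    intro h
    apply hpy
    rw [hyv]
    exact (dvd_pow h (by omega)).mul_left _
  have hv1 := hunitZ v hpv
  rw [Int.cast_natCast] at hv1
  have hv0 : (v : ℚ_[p]) ≠ 0 := by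
    intro h; rw [h, norm_zero] at hv1; exact zero_ne_one hv1
  have hz1 := hunitZ z hpz
  have hxy : ((z : ℚ_[p]) / v) ^ n - y0 = x / (v : ℚ_[p]) ^ n := by
    have h1 : (x : ℚ_[p]) + y = (z : ℚ_[p]) ^ n := by exact_mod_cast hs.heq
    have h2 : (y : ℚ_[p]) = y0 * (v : ℚ_[p]) ^ n := by
      have := congrArg (fun m : ℤ => (m : ℚ_[p])) hyv
      simpa using this
    rw [div_pow, ← h1, h2]
    field_simp
    ring
  obtain ⟨θ, hθ, hclose⟩ := hensel_root (p := p) (n := n) y0 ((z : ℚ_[p]) / v) (by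
    rw [norm_div, hz1, hv1, div_one]) (by
    rw [hxy, norm_div, norm_pow, hv1, one_pow, div_one]; exact hsmall)
  have hcl2 : ‖(z : ℚ_[p]) - θ * v‖ < ‖(n : ℚ_[p])‖ := by
    have : (z : ℚ_[p]) - θ * v = ((z : ℚ_[p]) / v - θ) * v := by field_simp
    rw [this, norm_mul, hv1, mul_one]; exact hclose
  refine (hRf (y0, θ) hθ x y z a v hs hpx hpy hpz hcl hyv hcl2).trans ?_
  apply HB
  refine ⟨(y0, θ), ?_, rfl⟩
  simp only [Set.mem_iUnion]
  exact ⟨y0, hy0M, θ, hθ, rfl⟩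
end AppC

lemma fixed_n (S : Finset ℕ) (hS : ∀ q ∈ S, q.Prime) (h2 : 2 ∉ S) (n : ℕ) :
    ∃ R : ℝ, ∀ x y z, Sol S x y z n → Real.log |(x : ℝ)| ≤ R := by
  classical
  by_cases hn : 2 ≤ n
  swap
  · exact ⟨0, fun x y z hs => absurd hs.hn hn⟩
  obtain ⟨c, hc, hP⟩ := lemmaP S hS h2
  have : ∀ p : ℕ, ∃ R : ℝ, p.Prime → ∀ x y z (a : ℕ), Sol S x y z n → (p : ℤ) ^ a ∣ x → ¬ (p : ℤ) ∣ y → ¬ (p : ℤ) ∣ z →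
      c * Real.log |(x : ℝ)| ≤ a * Real.log p → Real.log |(x : ℝ)| ≤ R := by
    intro p
    by_cases hp : p.Prime
    · haveI := Fact.mk hp
      obtain ⟨R, hR⟩ := perPrime (p := p) S hS hn c hc
      exact ⟨R, fun _ => hR⟩
    · exact ⟨0, fun h => absurd h hp⟩
  choose Rf hRf using this
  refine ⟨∑ p ∈ S, |Rf p|, fun x y z hs => ?_⟩
  obtain ⟨-, p, hpS, a, h1, h3, h4, h5⟩ := hP x y z n hs
  refine (hRf p (hS p hpS) x y z a hs h1 h3 h4 h5).trans ((le_abs_self _).trans ?_)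
  exact single_le_sum (f := fun p => |Rf p|) (fun _ _ => abs_nonneg _) hpS

lemma fixed_n_finite (S : Finset ℕ) (hS : ∀ q ∈ S, q.Prime) (h2 : 2 ∉ S) (n : ℕ) :
    {q : ℤ × ℤ × ℤ | Sol S q.1 q.2.1 q.2.2 n}.Finite := by
  obtain ⟨R, hR⟩ := fixed_n S hS h2 n
  obtain ⟨M, hM⟩ := exists_nat_ge (Real.exp R)
  refine ((Set.finite_Icc (-(M : ℤ)) M).prod ((Set.finite_Icc (-(M : ℤ)) M).prod
    (Set.finite_Icc (-(2 * M : ℤ)) (2 * M)))).subset ?_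
  rintro ⟨x, y, z⟩ hs
  simp only [Set.mem_ofPred_eq] at hs
  have hx0 : (0 : ℝ) < |(x : ℝ)| := abs_pos.2 (by exact_mod_cast hs.hx.1)
  have h1 : |(x : ℝ)| ≤ M := by
    have := (Real.log_le_iff_le_exp hx0).1 (hR x y z hs)
    exact this.trans hM
  have h3 : |x| ≤ M := by exact_mod_cast h1
  have h4 : |y| ≤ M := hs.hle.trans h3
  have hn := hs.hn
  have h5 : |z| ≤ 2 * M := by
    calc |z| ≤ |z| ^ n := le_self_pow₀ (Int.one_le_abs hs.hz) (by omega)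
      _ = |x + y| := by rw [← abs_pow, hs.heq]
      _ ≤ |x| + |y| := abs_add_le _ _
      _ ≤ _ := by linarith
  exact ⟨abs_le.1 h3, abs_le.1 h4, abs_le.1 h5⟩
end Part14

section Part15
open Finset

lemma finite_dir (S : Finset ℕ) (hS : ∀ p ∈ S, p.Prime) (h2 : 2 ∉ S) :
    {q : ℤ × ℤ × ℤ × ℕ | IsSUnit S q.1 ∧ IsSUnit S q.2.1 ∧ q.2.2.1 ≠ 0 ∧
      2 ≤ q.2.2.2 ∧ NthPowerFree q.2.2.2 (Int.gcd q.1 q.2.1) ∧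
      q.1 + q.2.1 = q.2.2.1 ^ q.2.2.2}.Finite := by
  obtain ⟨N, hN⟩ := n_bounded S hS h2
  have h1 : (⋃ n ∈ Set.Iio N, Set.image (fun q : ℤ × ℤ × ℤ => (q.1, q.2.1, q.2.2, n))
      {q : ℤ × ℤ × ℤ | Sol S q.1 q.2.1 q.2.2 n}).Finite :=
    (Set.finite_Iio N).biUnion fun n _ => (fixed_n_finite S hS h2 n).image _
  have h3 : (⋃ n ∈ Set.Iio N, Set.image (fun q : ℤ × ℤ × ℤ => (q.2.1, q.1, q.2.2, n))
      {q : ℤ × ℤ × ℤ | Sol S q.1 q.2.1 q.2.2 n}).Finite :=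
    (Set.finite_Iio N).biUnion fun n _ => (fixed_n_finite S hS h2 n).image _
  refine (h1.union h3).subset ?_
  rintro ⟨x, y, z, n⟩ ⟨hx, hy, hz, hn, hf, heq⟩
  simp only at hx hy hz hn hf heq
  rcases le_total |y| |x| with hle | hle
  · have hs : Sol S x y z n := ⟨hx, hy, hz, hn, hf, heq, hle⟩
    left
    simp only [Set.mem_iUnion]
    exact ⟨n, hN x y z n hs, (x, y, z), hs, rfl⟩
  · have hs : Sol S y x z n := ⟨hy, hx, hz, hn, by rwa [Int.gcd_comm], by rwa [add_comm], hle⟩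
    right
    simp only [Set.mem_iUnion]
    exact ⟨n, hN y x z n hs, (y, x, z), hs, rfl⟩

lemma infinite_dir (S : Finset ℕ) (h2 : 2 ∈ S) :
    {q : ℤ × ℤ × ℤ × ℕ | IsSUnit S q.1 ∧ IsSUnit S q.2.1 ∧ q.2.2.1 ≠ 0 ∧
      2 ≤ q.2.2.2 ∧ NthPowerFree q.2.2.2 (Int.gcd q.1 q.2.1) ∧
      q.1 + q.2.1 = q.2.2.1 ^ q.2.2.2}.Infinite := by
  refine Set.infinite_of_injective_forall_mem
    (f := fun m : ℕ => ((2 : ℤ) ^ (m + 1), (2 : ℤ) ^ (m + 1), (2 : ℤ), m + 2)) ?_ ?_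
  · intro a b h
    simp only [Prod.mk.injEq] at h
    omega
  · intro m
    have hu : IsSUnit S ((2 : ℤ) ^ (m + 1)) := by
      refine ⟨by positivity, fun p hp h => ?_⟩
      have h1 : p ∣ 2 ^ (m + 1) := by exact_mod_cast h
      rwa [(Nat.prime_dvd_prime_iff_eq hp Nat.prime_two).1 (hp.dvd_of_dvd_pow h1)]
    refine ⟨hu, hu, by norm_num, by simp, ?_, ?_⟩
    · intro p hp h
      have e : Int.gcd ((2 : ℤ) ^ (m + 1)) ((2 : ℤ) ^ (m + 1)) = 2 ^ (m + 1) := by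
        rw [Int.gcd_self, Int.natAbs_pow]; rfl
      simp only [e] at h
      have h1 := Nat.le_of_dvd (by positivity) h
      have h3 : 2 ^ (m + 2) ≤ p ^ (m + 2) := Nat.pow_le_pow_left hp.two_le _
      have h4 : 2 ^ (m + 1) < 2 ^ (m + 2) := Nat.pow_lt_pow_right (by norm_num) (by omega)
      omega
    · simp only; ring
end Part15

theorem finitely_many_primitive_solutions_iff_two_not_in_S
    (S : Finset ℕ) (hS : ∀ p ∈ S, p.Prime) :
    {q : ℤ × ℤ × ℤ × ℕ | IsSUnit S q.1 ∧ IsSUnit S q.2.1 ∧ q.2.2.1 ≠ 0 ∧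
      2 ≤ q.2.2.2 ∧ NthPowerFree q.2.2.2 (Int.gcd q.1 q.2.1) ∧
      q.1 + q.2.1 = q.2.2.1 ^ q.2.2.2}.Finite ↔ 2 ∉ S := by
  exact ⟨fun h h2 => infinite_dir S h2 h, finite_dir S hS⟩
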